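/- There exists λ₀ > 1 depending only on g and M such that for every real λ ≥ λ₀ the following holds ℙ-almost surely: there exists N such that for every integer n ≥ N one has |T_n(A)| ≤ λ² log n, where T_n(A) = {x ∈ T_n : Set(x) ⊆ A}. -/

import Mathlib

noncomputable section

open Real MeasureTheory ProbabilityTheory

def IsSidonZ {M : ℕ} (S : Set (ZMod M)) : Prop :=
  ∀ a ∈ S, ∀ b ∈ S, ∀ c ∈ S, ∀ d ∈ S, a + b = c + d → ({a, b} : Set (ZMod M)) = {c, d}

def Covers3 {M : ℕ} (S : Set (ZMod M)) : Prop :=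
  ∀ z : ZMod M, ∃ s₁ ∈ S, ∃ s₂ ∈ S, ∃ s₃ ∈ S,
    s₁ ≠ s₂ ∧ s₁ ≠ s₃ ∧ s₂ ≠ s₃ ∧ z = s₁ + s₂ + s₃

def alph (g : ℕ) : ℝ := ((g : ℝ) + 1) / (2 * (g : ℝ) + 1)

def glam (g : ℕ) (lam : ℝ) (n : ℕ) : ℝ :=
  lam ^ ((2 * (g : ℝ) + 5) / (1 - alph g)) * (n : ℝ) ^ ((1 : ℝ) / (g : ℝ)) *
    Real.log n ^ ((1 : ℝ) / (1 - alph g))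

def GoodS (M : ℕ) (CM : Set (ZMod M)) (s : ℕ → Fin 3 → ZMod M) : Prop :=
  ∀ n : ℕ, (∀ i, s n i ∈ CM) ∧ s n 0 ≠ s n 1 ∧ s n 0 ≠ s n 2 ∧ s n 1 ≠ s n 2 ∧
    s n 0 + s n 1 + s n 2 = (n : ZMod M)

def Rtrip (g M : ℕ) (lam : ℝ) (s : ℕ → Fin 3 → ZMod M) (n x₁ x₂ x₃ : ℕ) : Prop :=
  0 < x₁ ∧ 0 < x₂ ∧ 0 < x₃ ∧ x₁ + x₂ + x₃ = n ∧
  glam g lam n / 2 ≤ (x₁ : ℝ) ∧ (x₁ : ℝ) ≤ glam g lam n ∧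
  (n : ℝ) / 4 ≤ (x₂ : ℝ) ∧ x₂ ≤ n ∧ (n : ℝ) / 4 ≤ (x₃ : ℝ) ∧ x₃ ≤ n ∧
  (x₁ : ZMod M) = s n 0 ∧ (x₂ : ZMod M) = s n 1 ∧ (x₃ : ZMod M) = s n 2

def Rn (g M : ℕ) (lam : ℝ) (s : ℕ → Fin 3 → ZMod M) (n : ℕ) : Set (Finset ℕ) :=
  {ω | ∃ x₁ x₂ x₃ : ℕ, ω = {x₁, x₂, x₃} ∧ Rtrip g M lam s n x₁ x₂ x₃}

def imgF {m : ℕ} (x : Fin m → ℕ) : Finset ℕ := Finset.image x Finset.univ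

def firstThree (g : ℕ) (x : Fin (2 * g + 4) → ℕ) : Finset ℕ :=
  {x ⟨0, by omega⟩, x ⟨1, by omega⟩, x ⟨2, by omega⟩}

def pairOf (g : ℕ) (x : Fin (2 * g + 4) → ℕ) (j : ℕ) : Finset ℕ :=
  if j = 0 then {x ⟨0, by omega⟩, x ⟨3, by omega⟩}
  else if h : j ≤ g then {x ⟨2 * j + 2, by omega⟩, x ⟨2 * j + 3, by omega⟩}
  else ∅

def Tn (g M : ℕ) (lam : ℝ) (s : ℕ → Fin 3 → ZMod M) (n : ℕ) :
    Set (Fin (2 * g + 4) → ℕ) :=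
  {x | (∀ i, 0 < x i) ∧
    firstThree g x ∈ Rn g M lam s n ∧
    (∀ j : ℕ, 2 ≤ j → ∀ _ : j ≤ g + 1,
      x ⟨0, by omega⟩ + x ⟨3, by omega⟩ = x ⟨2 * j, by omega⟩ + x ⟨2 * j + 1, by omega⟩) ∧
    (∀ i : Fin (2 * g + 4), 3 ≤ (i : ℕ) → x i ≤ x ⟨0, by omega⟩) ∧
    (∀ k : ℕ, 2 ≤ k → ∀ _ : k ≤ g + 1,
      (x ⟨2 * k, by omega⟩ : ZMod M) = (x ⟨0, by omega⟩ : ZMod M) ∧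
      (x ⟨2 * k + 1, by omega⟩ : ZMod M) = (x ⟨3, by omega⟩ : ZMod M)) ∧
    (∀ j k : ℕ, j ≤ g → k ≤ g → j ≠ k → pairOf g x j ≠ pairOf g x k)}

def TnInd (g M : ℕ) (lam : ℝ) (s : ℕ → Fin 3 → ZMod M) (n : ℕ) :
    Set (Fin (2 * g + 4) → ℕ) :=
  {x ∈ Tn g M lam s n | Function.Injective x}

def TnDep (g M : ℕ) (lam : ℝ) (s : ℕ → Fin 3 → ZMod M) (n : ℕ) :
    Set (Fin (2 * g + 4) → ℕ) :=
  {x ∈ Tn g M lam s n | ¬ Function.Injective x}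

def Vr (g : ℕ) (r₁ : ℕ) : Set (Fin (2 * g + 1) → ℕ) :=
  {v | (∀ i, 0 < v i) ∧
    (∀ t : ℕ, ∀ _ : t < g,
      r₁ + v ⟨0, by omega⟩ = v ⟨2 * t + 1, by omega⟩ + v ⟨2 * t + 2, by omega⟩) ∧
    (∀ i, v i ≤ r₁) ∧ Function.Injective v ∧ (∀ i, v i ≠ r₁)}

def Tcal (X r : Finset ℕ) (k : ℕ) (eps : ℕ → ℤ) : Set (ℕ → ℕ) :=
  {y | (∀ j < k, y j ∈ X ∪ r) ∧ (∀ j, k ≤ j → y j = 0) ∧ (∃ j < k, y j ∈ X) ∧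
    (∀ i < k, ∀ j < k, y i = y j → eps i = eps j)}

def Fval (k : ℕ) (eps : ℕ → ℤ) (y : ℕ → ℕ) : ℤ :=
  ∑ j ∈ Finset.range k, eps j * (y j : ℤ)

def Ccal (U X r : Finset ℕ) : Set (Finset ℕ) :=
  {w | w.card = 4 ∧ w ⊆ U ∧ (∃ a ∈ w, a ∈ X ∧ a ∉ r) ∧
    ∃ y₁ y₂ y₃ y₄ : ℕ, w = {y₁, y₂, y₃, y₄} ∧ y₁ + y₂ = y₃ + y₄ ∧
      ({y₁, y₂} : Finset ℕ) ≠ {y₃, y₄}}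

def CcalR (g M : ℕ) (lam : ℝ) (s : ℕ → Fin 3 → ZMod M) (n : ℕ) (X r : Finset ℕ) :
    Set (Finset ℕ) :=
  {w | w ∈ Rn g M lam s n ∧ w ⊆ X ∪ r ∧ ∃ a ∈ w, a ∈ X ∧ a ∉ r}

def Sx (g : ℕ) (x : Fin (2 * g + 4) → ℕ) : Set (Finset ℕ) :=
  {w | ∃ l : ℕ, ∃ _ : 3 ≤ l, ∃ _ : l ≤ g + 2,
      w = ({x ⟨0, by omega⟩, x ⟨3, by omega⟩,
            x ⟨2 * l - 2, by omega⟩, x ⟨2 * l - 1, by omega⟩} : Finset ℕ)} ∪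
  {w | ∃ l j : ℕ, ∃ _ : 3 ≤ l, ∃ _ : l < j, ∃ _ : j ≤ g + 2,
      w = ({x ⟨2 * j - 2, by omega⟩, x ⟨2 * j - 1, by omega⟩,
            x ⟨2 * l - 2, by omega⟩, x ⟨2 * l - 1, by omega⟩} : Finset ℕ)}

def SxV (g : ℕ) (r₁ : ℕ) (v : Fin (2 * g + 1) → ℕ) : Set (Finset ℕ) :=
  {w | ∃ l : ℕ, ∃ _ : 3 ≤ l, ∃ _ : l ≤ g + 2,
      w = ({r₁, v ⟨0, by omega⟩, v ⟨2 * l - 5, by omega⟩, v ⟨2 * l - 4, by omega⟩} : Finset ℕ)} ∪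
  {w | ∃ l j : ℕ, ∃ _ : 3 ≤ l, ∃ _ : l < j, ∃ _ : j ≤ g + 2,
      w = ({v ⟨2 * j - 5, by omega⟩, v ⟨2 * j - 4, by omega⟩,
            v ⟨2 * l - 5, by omega⟩, v ⟨2 * l - 4, by omega⟩} : Finset ℕ)}

def tailSet (g : ℕ) (x : Fin (2 * g + 4) → ℕ) : Finset ℕ :=
  Finset.image (fun i : Fin (2 * g + 1) => x ⟨(i : ℕ) + 3, by have := i.isLt; omega⟩)
    Finset.univ

namespace ThinBasis

/-- The product of the weights of the elements of a finite set. -/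
def weight (p : ℕ → ℝ) (F : Finset ℕ) : ℝ := ∏ x ∈ F, p x

lemma weight_nonneg {p : ℕ → ℝ} (hp : ∀ x, 0 ≤ p x) (F : Finset ℕ) : 0 ≤ weight p F :=
  Finset.prod_nonneg fun x _ => hp x

lemma weight_union_sdiff (p : ℕ → ℝ) (W F : Finset ℕ) :
    weight p (W ∪ F) = weight p W * weight p (F \ W) := by
  unfold weight
  rw [← Finset.union_sdiff_self_eq_union, Finset.prod_union Finset.disjoint_sdiff]

lemma weight_union {p : ℕ → ℝ} {W F : Finset ℕ} (h : Disjoint W F) :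
    weight p (W ∪ F) = weight p W * weight p F :=
  Finset.prod_union h

lemma weight_biUnion {ι : Type*} [DecidableEq ι] (p : ℕ → ℝ) {J : Finset ι} {e : ι → Finset ℕ}
    (h : (J : Set ι).PairwiseDisjoint e) :
    weight p (J.biUnion e) = ∏ j ∈ J, weight p (e j) :=
  Finset.prod_biUnion h

open Classical in
/-- The generating function of pairwise disjoint subfamilies is at most exponential. -/
lemma sum_disjoint_le {ι : Type*} {p : ℕ → ℝ} (hp : ∀ x, 0 ≤ p x) (I : Finset ι)
    (e : ι → Finset ℕ) (q : ι → ℝ) (hq : ∀ i, 0 ≤ q i) :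
    ∑ J ∈ I.powerset.filter (fun J : Finset ι => (J : Set ι).PairwiseDisjoint e),
        (∏ j ∈ J, q j) * weight p (J.biUnion e) ≤
      Real.exp (∑ i ∈ I, q i * weight p (e i)) := by
  have hnn : ∀ i, 0 ≤ q i * weight p (e i) := fun i => mul_nonneg (hq i) (weight_nonneg hp _)
  calc _ = ∑ J ∈ I.powerset.filter (fun J : Finset ι => (J : Set ι).PairwiseDisjoint e),
          ∏ j ∈ J, (q j * weight p (e j)) := by
        refine Finset.sum_congr rfl fun J hJ => ?_
        rw [weight_biUnion p (Finset.mem_filter.1 hJ).2, Finset.prod_mul_distrib]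
    _ ≤ ∑ J ∈ I.powerset, ∏ j ∈ J, (q j * weight p (e j)) :=
        Finset.sum_le_sum_of_subset_of_nonneg (Finset.filter_subset _ _)
          fun J _ _ => Finset.prod_nonneg fun j _ => hnn j
    _ = ∏ i ∈ I, (1 + q i * weight p (e i)) := (Finset.prod_one_add I).symm
    _ ≤ ∏ i ∈ I, Real.exp (q i * weight p (e i)) :=
        Finset.prod_le_prod (fun i _ => by have := hnn i; positivity)
          fun i _ => by have := Real.add_one_le_exp (q i * weight p (e i)); linarith
    _ = _ := (Real.exp_sum _ _).symm

section Probability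

variable {Ω : Type*} [MeasurableSpace Ω] {P : Measure Ω} [IsProbabilityMeasure P]
  {A : Ω → Set ℕ} {p : ℕ → ℝ}

open Classical in
lemma prob_disjoint_family {ι : Type*} (hp : ∀ x, 0 ≤ p x)
    (hP : ∀ F : Finset ℕ, P.real {ω | (F : Set ℕ) ⊆ A ω} ≤ weight p F) (I : Finset ι)
    (e : ι → Finset ℕ) (v : ι → ℝ) (s t : ℝ) (hs : 0 ≤ s) :
    P.real {ω | ∃ J ⊆ I, (J : Set ι).PairwiseDisjoint e ∧ (∀ j ∈ J, (e j : Set ℕ) ⊆ A ω) ∧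
      t ≤ ∑ j ∈ J, v j} ≤
      Real.exp (-(s * t) + ∑ i ∈ I, Real.exp (s * v i) * weight p (e i)) := by
  set 𝓙 := I.powerset.filter fun J : Finset ι => (J : Set ι).PairwiseDisjoint e
  have hsub : {ω | ∃ J ⊆ I, (J : Set ι).PairwiseDisjoint e ∧ (∀ j ∈ J, (e j : Set ℕ) ⊆ A ω) ∧
      t ≤ ∑ j ∈ J, v j} ⊆ ⋃ J ∈ 𝓙.filter (fun J => t ≤ ∑ j ∈ J, v j),
        {ω | ((J.biUnion e : Finset ℕ) : Set ℕ) ⊆ A ω} := by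
    rintro ω ⟨J, hJ, hd, hA, ht⟩
    simp only [Set.mem_iUnion]
    refine ⟨J, by simp [𝓙, hJ, hd, ht], ?_⟩
    simpa using hA
  calc _ ≤ _ := measureReal_mono hsub (measure_ne_top _ _)
    _ ≤ ∑ J ∈ 𝓙.filter (fun J => t ≤ ∑ j ∈ J, v j),
        P.real {ω | ((J.biUnion e : Finset ℕ) : Set ℕ) ⊆ A ω} := measureReal_biUnion_finset_le _ _
    _ ≤ ∑ J ∈ 𝓙.filter (fun J => t ≤ ∑ j ∈ J, v j), Real.exp (-(s * t)) *
          ((∏ j ∈ J, Real.exp (s * v j)) * weight p (J.biUnion e)) := by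
        refine Finset.sum_le_sum fun J hJ => (hP _).trans ?_
        rw [← mul_assoc, ← Real.exp_sum, ← Real.exp_add]
        refine le_mul_of_one_le_left (weight_nonneg hp _) (Real.one_le_exp ?_)
        rw [← Finset.mul_sum]
        have := mul_le_mul_of_nonneg_left (Finset.mem_filter.1 hJ).2 hs
        linarith
    _ ≤ ∑ J ∈ 𝓙, Real.exp (-(s * t)) *
          ((∏ j ∈ J, Real.exp (s * v j)) * weight p (J.biUnion e)) :=
        Finset.sum_le_sum_of_subset_of_nonneg (Finset.filter_subset _ _) fun J _ _ => by
          have := weight_nonneg hp (J.biUnion e); positivity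
    _ ≤ _ := by
        rw [← Finset.mul_sum, Real.exp_add]
        exact mul_le_mul_of_nonneg_left
          (sum_disjoint_le hp I e _ fun i => (Real.exp_pos _).le) (Real.exp_pos _).le

/-- A list of finite sets each of which is bad relative to the union of everything before it. -/
def BadChain (Bad : Finset ℕ → Finset ℕ → Prop) : Finset ℕ → List (Finset ℕ) → Prop
  | _, [] => True
  | W, σ :: l => Bad W σ ∧ BadChain Bad (W ∪ σ) l

open Classical in
lemma prob_badChain (hp : ∀ x, 0 ≤ p x)
    (hP : ∀ F : Finset ℕ, P.real {ω | (F : Set ℕ) ⊆ A ω} ≤ weight p F)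
    {Bad : Finset ℕ → Finset ℕ → Prop} {𝓕 : Finset (Finset ℕ)} {w c : ℕ} {β : ℝ} (hβ : 0 ≤ β)
    (hmem : ∀ W σ, Bad W σ → σ ∈ 𝓕) (hcard : ∀ W σ, Bad W σ → σ.card ≤ c)
    (hcost : ∀ W : Finset ℕ, W.card ≤ w → ∑ σ ∈ 𝓕 with Bad W σ, weight p (σ \ W) ≤ β)
    (B : ℕ) (W : Finset ℕ) (hW : W.card + c * B ≤ w) :
    P.real {ω | (W : Set ℕ) ⊆ A ω ∧ ∃ l : List (Finset ℕ), l.length = B ∧ BadChain Bad W l ∧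
      ∀ σ ∈ l, (σ : Set ℕ) ⊆ A ω} ≤ weight p W * β ^ B := by
  induction B generalizing W with
  | zero =>
    refine (measureReal_mono (fun ω h => h.1)).trans ((hP W).trans ?_)
    simp
  | succ B ih =>
    calc _ ≤ P.real (⋃ σ ∈ 𝓕.filter (Bad W), {ω | ((W ∪ σ : Finset ℕ) : Set ℕ) ⊆ A ω ∧
            ∃ l : List (Finset ℕ), l.length = B ∧ BadChain Bad (W ∪ σ) l ∧
              ∀ σ ∈ l, (σ : Set ℕ) ⊆ A ω}) := by
          refine measureReal_mono ?_ (measure_ne_top _ _)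
          rintro ω ⟨hWA, l, hl, hc, hA⟩
          match l, hl, hc, hA with
          | σ :: l, hl, hc, hA =>
            simp only [Set.mem_iUnion]
            refine ⟨σ, Finset.mem_filter.2 ⟨hmem _ _ hc.1, hc.1⟩, ?_, l, by simpa using hl, hc.2,
              fun σ' h => hA σ' (by simp [h])⟩
            rw [Finset.coe_union]
            exact Set.union_subset hWA (hA σ (by simp))
      _ ≤ _ := measureReal_biUnion_finset_le _ _
      _ ≤ ∑ σ ∈ 𝓕 with Bad W σ, (weight p W * β ^ B) * weight p (σ \ W) := by
          refine Finset.sum_le_sum fun σ hσ => (ih (W ∪ σ) ?_).trans ?_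
          · have h1 := Finset.card_union_le W σ
            have h2 := hcard _ _ (Finset.mem_filter.1 hσ).2
            rw [mul_add] at hW
            omega
          · rw [weight_union_sdiff]
            exact le_of_eq (by ring)
      _ ≤ (weight p W * β ^ B) * β := by
          rw [← Finset.mul_sum]
          refine mul_le_mul_of_nonneg_left (hcost W (by omega)) ?_
          have := weight_nonneg hp W
          positivity
      _ = _ := by ring

open Classical in
lemma prob_disjoint_family_badChain {ι : Type*} (hp : ∀ x, 0 ≤ p x)
    (hP : ∀ F : Finset ℕ, P.real {ω | (F : Set ℕ) ⊆ A ω} ≤ weight p F) (I : Finset ι)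
    (e : ι → Finset ℕ)
    {Bad : Finset ℕ → Finset ℕ → Prop} {𝓕 : Finset (Finset ℕ)} {w c : ℕ} {β : ℝ} (hβ : 0 ≤ β)
    (hmem : ∀ W σ, Bad W σ → σ ∈ 𝓕) (hcard : ∀ W σ, Bad W σ → σ.card ≤ c)
    (hcost : ∀ W : Finset ℕ, W.card ≤ w → ∑ σ ∈ 𝓕 with Bad W σ, weight p (σ \ W) ≤ β) (B : ℕ) :
    P.real {ω | ∃ J ⊆ I, (J : Set ι).PairwiseDisjoint e ∧ (∀ j ∈ J, (e j : Set ℕ) ⊆ A ω) ∧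
      (J.biUnion e).card + c * B ≤ w ∧ ∃ l : List (Finset ℕ), l.length = B ∧
        BadChain Bad (J.biUnion e) l ∧ ∀ σ ∈ l, (σ : Set ℕ) ⊆ A ω} ≤
      Real.exp (∑ i ∈ I, weight p (e i)) * β ^ B := by
  set 𝓙 := I.powerset.filter fun J : Finset ι => (J : Set ι).PairwiseDisjoint e
  calc _ ≤ P.real (⋃ J ∈ 𝓙.filter (fun J => (J.biUnion e).card + c * B ≤ w),
        {ω | ((J.biUnion e : Finset ℕ) : Set ℕ) ⊆ A ω ∧ ∃ l : List (Finset ℕ), l.length = B ∧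
          BadChain Bad (J.biUnion e) l ∧ ∀ σ ∈ l, (σ : Set ℕ) ⊆ A ω}) := by
        refine measureReal_mono ?_ (measure_ne_top _ _)
        rintro ω ⟨J, hJ, hd, hA, hw, hl⟩
        simp only [Set.mem_iUnion]
        exact ⟨J, by simp [𝓙, hJ, hd, hw], by simpa using hA, hl⟩
    _ ≤ _ := measureReal_biUnion_finset_le _ _
    _ ≤ ∑ J ∈ 𝓙.filter (fun J => (J.biUnion e).card + c * B ≤ w),
          weight p (J.biUnion e) * β ^ B := Finset.sum_le_sum fun J hJ =>
        prob_badChain hp hP hβ hmem hcard hcost B _ (Finset.mem_filter.1 hJ).2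
    _ ≤ ∑ J ∈ 𝓙, weight p (J.biUnion e) * β ^ B :=
        Finset.sum_le_sum_of_subset_of_nonneg (Finset.filter_subset _ _) fun J _ _ => by
          have := weight_nonneg hp (J.biUnion e); positivity
    _ ≤ _ := by
        rw [← Finset.sum_mul]
        refine mul_le_mul_of_nonneg_right ?_ (by positivity)
        simpa using sum_disjoint_le hp I e (fun _ => 1) (fun _ => zero_le_one)

end Probability

lemma sum_union_le {τ : Type*} [DecidableEq τ] {f : τ → ℝ} (hf : ∀ s, 0 ≤ f s)
    (X Y : Finset τ) : ∑ s ∈ X ∪ Y, f s ≤ ∑ s ∈ X, f s + ∑ s ∈ Y, f s := by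
  rw [← Finset.sum_union_inter]
  exact le_add_of_nonneg_right (Finset.sum_nonneg fun s _ => hf s)

lemma sum_biUnion_le {κ τ : Type*} [DecidableEq τ] {f : τ → ℝ} (hf : ∀ s, 0 ≤ f s)
    (I : Finset κ) (X : κ → Finset τ) : ∑ s ∈ I.biUnion X, f s ≤ ∑ i ∈ I, ∑ s ∈ X i, f s := by
  classical
  induction I using Finset.induction_on with
  | empty => simp
  | insert i I hi ih =>
    rw [Finset.biUnion_insert, Finset.sum_insert hi]
    exact (sum_union_le hf _ _).trans (by gcongr)

/-- The set of entries of a triple. -/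
def headSet (h : ℕ × ℕ × ℕ) : Finset ℕ := {h.1, h.2.1, h.2.2}

/-- `x` is what has to be added to `V` to witness that the root `r` either has a close element
below it or an additive relation `r + a = z + z'` meeting `V`. -/
def Conf (D r : ℕ) (V x : Finset ℕ) : Prop :=
  (∃ z, z < r ∧ r < z + D ∧ x = {z} \ V) ∨
  ∃ a z z', a < z ∧ a < z' ∧ z < r ∧ z' < r ∧ r + a = z + z' ∧ D ≤ z ∧ D ≤ z' ∧
    x = {a, z, z'} \ V ∧ ¬ Disjoint {a, z, z'} V

/-- The set `σ` consists of a head from `H` which is not in general position with respect to `W`,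
together with a witness of this. -/
def IsBad (D : ℕ) (H : Finset (ℕ × ℕ × ℕ)) (W σ : Finset ℕ) : Prop :=
  ∃ h ∈ H, h.1 ∉ W ∧ ((h.2.1 ∈ W ∨ h.2.2 ∈ W) ∧ σ = headSet h ∨
    Disjoint (headSet h) W ∧ ∃ x, Conf D h.1 (W ∪ {h.2.1, h.2.2}) x ∧ σ = headSet h ∪ x)

/-- A nontrivial relation `r + a = z + z'` among elements of `V` and small integers. -/
def Lin (D r : ℕ) (V : Finset ℕ) : Prop :=
  ∃ a z z', a ∈ V ∪ Finset.range (D + 1) ∧ z ∈ V ∪ Finset.range (D + 1) ∧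
    z' ∈ V ∪ Finset.range (D + 1) ∧ a ≠ z ∧ a ≠ z' ∧ r + a = z + z'

/-- The total weight of the representations of `m` as a sum of two elements. -/
def pairSum (p : ℕ → ℝ) (m : ℕ) : ℝ := ∑ z ∈ Finset.range (m / 2 + 1), weight p {z, m - z}

/-- The total weight of the pairs below `r` with difference `d` and larger element at least `D`. -/
def diffSum (p : ℕ → ℝ) (D r d : ℕ) : ℝ :=
  ∑ a ∈ (Finset.range r).filter (fun a => D ≤ a + d), p a * p (a + d)

lemma Conf.disjoint {D r : ℕ} {V x : Finset ℕ} (h : Conf D r V x) : Disjoint x V := by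
  rcases h with ⟨z, -, -, rfl⟩ | ⟨a, z, z', -, -, -, -, -, -, -, rfl, -⟩ <;>
  exact Finset.sdiff_disjoint

lemma Conf.lt {D r : ℕ} {V x : Finset ℕ} (h : Conf D r V x) : ∀ y ∈ x, y < r := by
  rcases h with ⟨z, h1, -, rfl⟩ | ⟨a, z, z', h1, h2, h3, h4, -, -, -, rfl, -⟩ <;>
  · intro y hy
    simp only [Finset.mem_sdiff, Finset.mem_insert, Finset.mem_singleton] at hy
    omega

lemma Conf.card_le {D r : ℕ} {V x : Finset ℕ} (h : Conf D r V x) : x.card ≤ 3 := by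
  rcases h with ⟨z, -, -, rfl⟩ | ⟨a, z, z', -, -, -, -, -, -, -, rfl, -⟩
  · exact (Finset.card_le_card Finset.sdiff_subset).trans (by simp)
  · exact (Finset.card_le_card Finset.sdiff_subset).trans Finset.card_le_three

lemma headSet_card_le (h : ℕ × ℕ × ℕ) : (headSet h).card ≤ 3 := Finset.card_le_three

lemma IsBad.card_le {D : ℕ} {H : Finset (ℕ × ℕ × ℕ)} {W σ : Finset ℕ} (h : IsBad D H W σ) :
    σ.card ≤ 6 := by
  obtain ⟨h, -, -, ⟨-, rfl⟩ | ⟨-, x, hx, rfl⟩⟩ := h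
  · exact (headSet_card_le h).trans (by norm_num)
  · have := Finset.card_union_le (headSet h) x
    have := headSet_card_le h
    have := hx.card_le
    omega

lemma IsBad.subset_range {D n : ℕ} {H : Finset (ℕ × ℕ × ℕ)}
    (hH : ∀ h ∈ H, h.1 + h.2.1 + h.2.2 = n) {W σ : Finset ℕ} (h : IsBad D H W σ) :
    σ ⊆ Finset.range (n + 1) := by
  obtain ⟨h, hh, -, hσ⟩ := h
  have h1 := hH h hh
  intro y hy
  rw [Finset.mem_range]
  have key : y ∈ headSet h → y < n + 1 := by
    intro hy
    simp only [headSet, Finset.mem_insert, Finset.mem_singleton] at hy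
    omega
  rcases hσ with ⟨-, rfl⟩ | ⟨-, x, hx, rfl⟩
  · exact key hy
  · rcases Finset.mem_union.1 hy with hy | hy
    · exact key hy
    · have := hx.lt y hy
      omega

lemma IsBad.mono {D : ℕ} {H : Finset (ℕ × ℕ × ℕ)} {W σ e : Finset ℕ} (h : IsBad D H W σ)
    (he : Disjoint σ e) : IsBad D H (W ∪ e) σ := by
  have key : ∀ V x y : Finset ℕ, x = y \ V → Disjoint x e → x = y \ (V ∪ e) := by
    rintro V x y rfl hd
    ext u
    have : u ∈ y \ V → u ∉ e := fun h1 => Finset.disjoint_left.1 hd h1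
    simp only [Finset.mem_sdiff, Finset.mem_union] at this ⊢
    tauto
  obtain ⟨h, hh, hW, hσ⟩ := h
  have hr : h.1 ∈ σ := by
    rcases hσ with ⟨-, rfl⟩ | ⟨-, x, hx, rfl⟩ <;> simp [headSet]
  refine ⟨h, hh, by simpa [hW] using Finset.disjoint_left.1 he hr, ?_⟩
  rcases hσ with ⟨h1, rfl⟩ | ⟨h1, x, hx, rfl⟩
  · exact .inl ⟨by simp only [Finset.mem_union]; tauto, rfl⟩
  · rw [Finset.disjoint_union_left] at he
    refine .inr ⟨Finset.disjoint_union_right.2 ⟨h1, he.1⟩, x, ?_, rfl⟩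
    rw [Finset.union_right_comm]
    rcases hx with ⟨z, h1, h2, h3⟩ | ⟨a, z, z', h1, h2, h3, h4, h5, h6, h7, h8, h9⟩
    · exact .inl ⟨z, h1, h2, key _ _ _ h3 he.2⟩
    · exact .inr ⟨a, z, z', h1, h2, h3, h4, h5, h6, h7, key _ _ _ h8 he.2,
        fun h => h9 (Finset.disjoint_union_right.1 h).1⟩

section Cost

variable {p : ℕ → ℝ} {D : ℕ} {ε : ℝ}

open Classical in
lemma sum_conf_le (hp : ∀ x, 0 ≤ p x) (hp1 : ∀ x, p x ≤ 1) {r : ℕ} (hDr : D ≤ r) (hε : 0 ≤ ε)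
    (hclose : ∑ z ∈ (Finset.range r).filter (fun z => r < z + D), p z ≤ ε)
    (hpair : ∀ a < r, pairSum p (r + a) ≤ ε) (hdiff : ∀ d, 0 < d → d < r → diffSum p D r d ≤ ε)
    (hbig : ∀ z, D ≤ z → p z ≤ ε) (V : Finset ℕ) (X : Finset (Finset ℕ))
    (hX : ∀ x ∈ X, Conf D r V x) :
    ∑ x ∈ X, weight p x ≤ 4 * (V.card + 1) ^ 2 * ε +
      if Lin D r V then 1 + (V.card : ℝ) ^ 2 else 0 := by
  have hw := weight_nonneg hp
  set I1 := ((Finset.range r).filter (fun z => r < z + D)).image fun z => ({z} : Finset ℕ)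
  set I2 := ((V.filter (· < r)).biUnion fun a =>
    (Finset.range ((r + a) / 2 + 1)).image fun z => ({z, r + a - z} : Finset ℕ))
  set I3 := ((V.filter (fun z => 0 < z ∧ z < r)).biUnion fun z =>
    ((Finset.range r).filter (fun a => D ≤ a + (r - z))).image fun a =>
      ({a, a + (r - z)} : Finset ℕ))
  set I4 := ((V ×ˢ V).filter (fun u => D ≤ r + u.1 - u.2)).image
    fun u => ({r + u.1 - u.2} : Finset ℕ)
  set I5 := ((V ×ˢ V).filter (fun u => D ≤ u.1 + u.2 - r)).image
    fun u => ({u.1 + u.2 - r} : Finset ℕ)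
  set I6 := if Lin D r V then {∅} ∪ (V ×ˢ V).image fun u => ({u.1 + u.2 - r} : Finset ℕ) else ∅
  have hsub : X ⊆ I1 ∪ I2 ∪ I3 ∪ I4 ∪ I5 ∪ I6 := by
    intro x hx
    simp only [Finset.mem_union]
    rcases hX x hx with ⟨z, h1, h2, rfl⟩ | ⟨a, z, z', h1, h2, h3, h4, h5, h6, h7, rfl, h9⟩
    · by_cases hz : z ∈ V
      · right
        have hL : Lin D r V := ⟨0, z, r - z, by simp, by simp [hz],
          Finset.mem_union_right _ (Finset.mem_range.2 (by omega)), by omega, by omega, by omega⟩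
        simp [I6, hL, hz]
      · refine .inl (.inl (.inl (.inl (.inl ?_))))
        simp only [I1, Finset.mem_image, Finset.mem_filter, Finset.mem_range]
        exact ⟨z, ⟨h1, h2⟩, by rw [Finset.sdiff_eq_self_of_disjoint]; simpa using hz⟩
    · have third : ∀ a z z', a < z → a < z' → z < r → z' < r → r + a = z + z' → D ≤ z → D ≤ z' →
          z ∈ V → a ∉ V → z' ∉ V → ({a, z, z'} \ V : Finset ℕ) ∈ I3 := by
        intro a z z' h1 h2 h3 h4 h5 h6 h7 hz ha hz'
        simp only [I3, Finset.mem_biUnion, Finset.mem_image, Finset.mem_filter, Finset.mem_range]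
        refine ⟨z, ⟨hz, by omega, h3⟩, a, ⟨by omega, by omega⟩, ?_⟩
        have : a + (r - z) = z' := by omega
        rw [this]
        ext u
        simp only [Finset.mem_insert, Finset.mem_singleton, Finset.mem_sdiff]
        grind
      have fourth : ∀ a z z', a < z → a < z' → z < r → z' < r → r + a = z + z' → D ≤ z → D ≤ z' →
          z ∈ V → a ∈ V → z' ∉ V → ({a, z, z'} \ V : Finset ℕ) ∈ I4 := by
        intro a z z' h1 h2 h3 h4 h5 h6 h7 hz ha hz'
        simp only [I4, Finset.mem_image, Finset.mem_filter, Finset.mem_product]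
        have : r + a - z = z' := by omega
        refine ⟨(a, z), ⟨⟨ha, hz⟩, by omega⟩, ?_⟩
        rw [this]
        ext u
        simp only [Finset.mem_insert, Finset.mem_singleton, Finset.mem_sdiff]
        grind
      have comm : ({a, z, z'} : Finset ℕ) = {a, z', z} := by
        ext; simp only [Finset.mem_insert, Finset.mem_singleton]; tauto
      by_cases ha : a ∈ V <;> by_cases hz : z ∈ V <;> by_cases hz' : z' ∈ V
      · right
        have hL : Lin D r V := ⟨a, z, z', by simp [ha], by simp [hz], by simp [hz'], by omega,
          by omega, by omega⟩
        have : ({a, z, z'} \ V : Finset ℕ) = ∅ := by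
          rw [Finset.sdiff_eq_empty_iff_subset]
          intro u hu
          simp only [Finset.mem_insert, Finset.mem_singleton] at hu
          rcases hu with rfl | rfl | rfl <;> assumption
        simp [I6, hL, this]
      · exact .inl (.inl (.inr (fourth a z z' h1 h2 h3 h4 h5 h6 h7 hz ha hz')))
      · rw [comm]
        exact .inl (.inl (.inr (fourth a z' z h2 h1 h4 h3 (by omega) h7 h6 hz' ha hz)))
      · refine .inl (.inl (.inl (.inl (.inr ?_))))
        have key : ∀ z z', z ∉ V → z' ∉ V → r + a = z + z' → z ≤ z' →
            ({a, z, z'} \ V : Finset ℕ) ∈ I2 := by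
          intro z z' hz hz' h5 hle
          simp only [I2, Finset.mem_biUnion, Finset.mem_image, Finset.mem_filter,
            Finset.mem_range]
          refine ⟨a, ⟨ha, by omega⟩, z, by omega, ?_⟩
          have : r + a - z = z' := by omega
          rw [this]
          ext u
          simp only [Finset.mem_insert, Finset.mem_singleton, Finset.mem_sdiff]
          grind
        rcases le_total z z' with hle | hle
        · exact key z z' hz hz' h5 hle
        · rw [comm]
          exact key z' z hz' hz (by omega) hle
      · have hx : ({a, z, z'} \ V : Finset ℕ) = {z + z' - r} := by
          have : z + z' - r = a := by omega
          rw [this]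
          ext u
          simp only [Finset.mem_insert, Finset.mem_singleton, Finset.mem_sdiff]
          grind
        by_cases haD : D ≤ a
        · refine .inl (.inr ?_)
          rw [hx]
          simp only [I5, Finset.mem_image, Finset.mem_filter, Finset.mem_product]
          exact ⟨(z, z'), ⟨⟨hz, hz'⟩, by omega⟩, rfl⟩
        · right
          have hL : Lin D r V := ⟨a, z, z', by simp; omega, by simp [hz], by simp [hz'], by omega,
            by omega, by omega⟩
          rw [hx]
          simp only [I6, hL, if_true, Finset.mem_union, Finset.mem_image, Finset.mem_product]
          exact .inr ⟨(z, z'), ⟨hz, hz'⟩, rfl⟩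
      · exact .inl (.inl (.inl (.inr (third a z z' h1 h2 h3 h4 h5 h6 h7 hz ha hz'))))
      · rw [comm]
        exact .inl (.inl (.inl (.inr (third a z' z h2 h1 h4 h3 (by omega) h7 h6 hz' ha hz))))
      · exact absurd (by simp [ha, hz, hz']) h9
  have hVV : ((V ×ˢ V).card : ℝ) = (V.card : ℝ) ^ 2 := by
    rw [Finset.card_product]; push_cast; ring
  have hcardmul : ∀ (F : Finset ℕ) (f : ℕ → ℝ), F ⊆ V → (∀ a ∈ F, f a ≤ ε) →
      ∑ a ∈ F, f a ≤ V.card * ε := by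
    intro F f hF hf
    calc _ ≤ ∑ a ∈ F, ε := Finset.sum_le_sum hf
      _ = F.card * ε := by simp
      _ ≤ _ := by gcongr
  have b1 : ∑ x ∈ I1, weight p x ≤ ε :=
    (Finset.sum_image_le_of_nonneg fun s _ => hw s).trans (by simpa [weight] using hclose)
  have b2 : ∑ x ∈ I2, weight p x ≤ V.card * ε := by
    refine (sum_biUnion_le hw _ _).trans
      (hcardmul _ _ (Finset.filter_subset _ _) fun a ha => ?_)
    exact (Finset.sum_image_le_of_nonneg fun s _ => hw s).trans
      (hpair a (Finset.mem_filter.1 ha).2)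
  have b3 : ∑ x ∈ I3, weight p x ≤ V.card * ε := by
    refine (sum_biUnion_le hw _ _).trans
      (hcardmul _ _ (Finset.filter_subset _ _) fun z hz => ?_)
    have hz := (Finset.mem_filter.1 hz).2
    refine (Finset.sum_image_le_of_nonneg fun s _ => hw s).trans
      (le_trans (le_of_eq (Finset.sum_congr rfl fun a _ => ?_)) (hdiff (r - z) (by omega)
        (by omega)))
    exact Finset.prod_pair (by omega)
  have b4 : ∑ x ∈ I4, weight p x ≤ (V.card : ℝ) ^ 2 * ε := by
    refine (Finset.sum_image_le_of_nonneg fun s _ => hw s).trans ?_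
    calc _ ≤ ∑ u ∈ (V ×ˢ V).filter (fun u => D ≤ r + u.1 - u.2), ε :=
          Finset.sum_le_sum fun u hu => by
            simpa [weight] using hbig _ (Finset.mem_filter.1 hu).2
      _ = ((V ×ˢ V).filter (fun u => D ≤ r + u.1 - u.2)).card * ε := by simp
      _ ≤ _ := by rw [← hVV]; gcongr; exact Finset.filter_subset _ _
  have b5 : ∑ x ∈ I5, weight p x ≤ (V.card : ℝ) ^ 2 * ε := by
    refine (Finset.sum_image_le_of_nonneg fun s _ => hw s).trans ?_
    calc _ ≤ ∑ u ∈ (V ×ˢ V).filter (fun u => D ≤ u.1 + u.2 - r), ε :=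
          Finset.sum_le_sum fun u hu => by
            simpa [weight] using hbig _ (Finset.mem_filter.1 hu).2
      _ = ((V ×ˢ V).filter (fun u => D ≤ u.1 + u.2 - r)).card * ε := by simp
      _ ≤ _ := by rw [← hVV]; gcongr; exact Finset.filter_subset _ _
  have b6 : ∑ x ∈ I6, weight p x ≤ if Lin D r V then 1 + (V.card : ℝ) ^ 2 else 0 := by
    simp only [I6]
    split_ifs
    · refine (sum_union_le hw _ _).trans (add_le_add (by simp [weight]) ?_)
      refine (Finset.sum_image_le_of_nonneg fun s _ => hw s).trans ?_
      rw [← hVV]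
      calc _ ≤ ∑ u ∈ V ×ˢ V, (1 : ℝ) := Finset.sum_le_sum fun u _ => by
            simpa [weight] using hp1 _
        _ = _ := by simp
    · simp
  have := Finset.sum_le_sum_of_subset_of_nonneg hsub fun s _ _ => hw s
  have u1 := sum_union_le hw (I1 ∪ I2 ∪ I3 ∪ I4 ∪ I5) I6
  have u2 := sum_union_le hw (I1 ∪ I2 ∪ I3 ∪ I4) I5
  have u3 := sum_union_le hw (I1 ∪ I2 ∪ I3) I4
  have u4 := sum_union_le hw (I1 ∪ I2) I3
  have u5 := sum_union_le hw I1 I2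
  have hc : (0 : ℝ) ≤ V.card * ε := by positivity
  have hc2 : (0 : ℝ) ≤ (V.card : ℝ) ^ 2 * ε := by positivity
  nlinarith

end Cost

/-- The value of a symbol standing for a constant or for one of two variables. -/
def letterVal : ℕ ⊕ Bool → ℕ → ℕ → ℕ
  | .inl x, _, _ => x
  | .inr true, b, _ => b
  | .inr false, _, c => c

open Classical in
lemma card_lin_le {D n : ℕ} {H : Finset (ℕ × ℕ × ℕ)} (hH : ∀ h ∈ H, h.1 + h.2.1 + h.2.2 = n)
    (W : Finset ℕ) :
    (H.filter fun h => Lin D h.1 (W ∪ {h.2.1, h.2.2})).card ≤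
      (W.card + D + 3) ^ 3 * (n + 1) := by
  set L : Finset (ℕ ⊕ Bool) := (W ∪ Finset.range (D + 1)).disjSum Finset.univ
  have hL : L.card ≤ W.card + D + 3 := by
    rw [Finset.card_disjSum]
    have := Finset.card_union_le W (Finset.range (D + 1))
    simp at this ⊢
    omega
  have hcode : ∀ b c y, y ∈ W ∪ {b, c} ∪ Finset.range (D + 1) → ∃ e ∈ L, letterVal e b c = y := by
    intro b c y hy
    simp only [Finset.mem_union, Finset.mem_insert, Finset.mem_singleton] at hy
    have hc : y ∈ W ∪ Finset.range (D + 1) → ∃ e ∈ L, letterVal e b c = y :=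
      fun h => ⟨.inl y, by simpa [L] using h, rfl⟩
    rcases hy with (hy | rfl | rfl) | hy
    · exact hc (by simp [hy])
    · exact ⟨.inr true, by simp [L], rfl⟩
    · exact ⟨.inr false, by simp [L], rfl⟩
    · exact hc (Finset.mem_union_right _ hy)
  have hex : ∀ h ∈ H.filter (fun h => Lin D h.1 (W ∪ {h.2.1, h.2.2})),
      ∃ k ∈ (L ×ˢ L ×ˢ L) ×ˢ Finset.range (n + 1),
        (letterVal k.1.1 h.2.1 h.2.2 ≠ letterVal k.1.2.1 h.2.1 h.2.2) ∧
        (letterVal k.1.1 h.2.1 h.2.2 ≠ letterVal k.1.2.2 h.2.1 h.2.2) ∧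
        n + letterVal k.1.1 h.2.1 h.2.2 =
          letterVal k.1.2.1 h.2.1 h.2.2 + letterVal k.1.2.2 h.2.1 h.2.2 + h.2.1 + h.2.2 ∧
        k.2 = if k.1.1 = .inr true then h.2.1 else h.2.2 := by
    intro h hh
    obtain ⟨hh, a, z, z', ha, hz, hz', h1, h2, h3⟩ := Finset.mem_filter.1 hh
    have hn := hH h hh
    obtain ⟨ea, hea, rfl⟩ := hcode _ _ _ ha
    obtain ⟨ez, hez, rfl⟩ := hcode _ _ _ hz
    obtain ⟨ez', hez', rfl⟩ := hcode _ _ _ hz'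
    refine ⟨((ea, ez, ez'), if ea = .inr true then h.2.1 else h.2.2), ?_, h1, h2, by simp only; omega,
      rfl⟩
    simp only [Finset.mem_product, Finset.mem_range]
    refine ⟨⟨hea, hez, hez'⟩, ?_⟩
    split_ifs <;> omega
  choose! code hmem h1 h2 h3 h4 using hex
  calc _ ≤ ((L ×ˢ L ×ˢ L) ×ˢ Finset.range (n + 1)).card := by
        refine Finset.card_le_card_of_injOn code hmem ?_
        rintro ⟨r, b, c⟩ hh ⟨r', b', c'⟩ hh' heq
        have e1 := h1 _ hh
        have e2 := h2 _ hh
        have e3 := h3 _ hh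
        have e4 := h4 _ hh
        have e3' := h3 _ hh'
        have e4' := h4 _ hh'
        have e5 := hH _ (Finset.mem_filter.1 hh).1
        have e5' := hH _ (Finset.mem_filter.1 hh').1
        rw [← heq] at e3' e4'
        generalize code (r, b, c) = k at *
        obtain ⟨⟨ka, kz, kz'⟩, u⟩ := k
        simp only at e1 e2 e3 e4 e5 e3' e4' e5'
        have : b = b' ∧ c = c' := by
          clear heq hh hh' h1 h2 h3 h4 hmem
          rcases ka with a | (_ | _) <;> rcases kz with z | (_ | _) <;>
          rcases kz' with z' | (_ | _) <;>
          simp [letterVal] at e1 e2 e3 e4 e3' e4' <;> omega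
        obtain ⟨rfl, rfl⟩ := this
        have : r = r' := by omega
        rw [this]
    _ = L.card ^ 3 * (n + 1) := by simp [Finset.card_product]; ring
    _ ≤ _ := by gcongr

section Cost

variable {p : ℕ → ℝ} {D n : ℕ} {ε ξ μ : ℝ} {H : Finset (ℕ × ℕ × ℕ)}

lemma weight_headSet (h : ℕ × ℕ × ℕ) (h1 : h.1 ≠ h.2.1)
    (h2 : h.1 ≠ h.2.2) (h3 : h.2.1 ≠ h.2.2) :
    weight p (headSet h) = p h.1 * p h.2.1 * p h.2.2 := by
  rw [weight, headSet, Finset.prod_insert (by simp [h1, h2]), Finset.prod_pair h3, mul_assoc]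

open Classical in
lemma sum_isBad_le (hp : ∀ x, 0 ≤ p x) (hp1 : ∀ x, p x ≤ 1) (hε : 0 ≤ ε) (hξ : 0 ≤ ξ)
    (hH : ∀ h ∈ H, h.1 + h.2.1 + h.2.2 = n)
    (hne : ∀ h ∈ H, h.1 ≠ h.2.1 ∧ h.1 ≠ h.2.2 ∧ h.2.1 ≠ h.2.2)
    (hDr : ∀ h ∈ H, D ≤ h.1)
    (hclose : ∀ h ∈ H, ∑ z ∈ (Finset.range h.1).filter (fun z => h.1 < z + D), p z ≤ ε)
    (hpair : ∀ h ∈ H, ∀ a < h.1, pairSum p (h.1 + a) ≤ ε)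
    (hdiff : ∀ h ∈ H, ∀ d, 0 < d → d < h.1 → diffSum p D h.1 d ≤ ε)
    (hbig : ∀ z, D ≤ z → p z ≤ ε)
    (hb : ∀ w, ∑ h ∈ H with h.2.1 = w, p h.1 * p h.2.2 ≤ ε)
    (hc : ∀ w, ∑ h ∈ H with h.2.2 = w, p h.1 * p h.2.1 ≤ ε)
    (hμ : ∑ h ∈ H, p h.1 * p h.2.1 * p h.2.2 ≤ μ)
    (hξH : ∀ h ∈ H, p h.1 * p h.2.1 * p h.2.2 ≤ ξ)
    (𝓕 : Finset (Finset ℕ)) (W : Finset ℕ) :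
    ∑ σ ∈ 𝓕 with IsBad D H W σ, weight p (σ \ W) ≤
      4 * (W.card + 3) ^ 2 * ε * (1 + μ) +
        (W.card + 3) ^ 2 * ((W.card + D + 3) ^ 3 * (n + 1)) * ξ := by
  have hw : ∀ σ : Finset ℕ, 0 ≤ weight p (σ \ W) := fun σ => weight_nonneg hp _
  set H0 := H.filter fun h => h.1 ∉ W
  set I1 := (W.biUnion fun w => (H0.filter (fun h => h.2.1 = w ∧ h.2.2 ∉ W)).image headSet)
  set I2 := (W.biUnion fun w => (H0.filter (fun h => h.2.2 = w ∧ h.2.1 ∉ W)).image headSet)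
  set I3 := (H0.filter (fun h => h.2.1 ∈ W ∧ h.2.2 ∈ W)).image headSet
  set H1 := H.filter fun h => Disjoint (headSet h) W
  set X : ℕ × ℕ × ℕ → Finset (Finset ℕ) := fun h =>
    (Finset.range h.1).powerset.filter fun x => Conf D h.1 (W ∪ {h.2.1, h.2.2}) x
  set I4 := H1.biUnion fun h => (X h).image fun x => headSet h ∪ x
  have hsub : 𝓕.filter (fun σ => IsBad D H W σ) ⊆ I1 ∪ I2 ∪ I3 ∪ I4 := by
    intro σ hσ
    obtain ⟨h, hh, hr, hσ⟩ := (Finset.mem_filter.1 hσ).2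
    have hh0 : h ∈ H0 := Finset.mem_filter.2 ⟨hh, hr⟩
    simp only [Finset.mem_union]
    rcases hσ with ⟨h1, rfl⟩ | ⟨h1, x, hx, rfl⟩
    · refine .inl ?_
      by_cases hb : h.2.1 ∈ W <;> by_cases hc : h.2.2 ∈ W
      · exact .inr (Finset.mem_image_of_mem _ (Finset.mem_filter.2 ⟨hh0, hb, hc⟩))
      · exact .inl (.inl (Finset.mem_biUnion.2 ⟨h.2.1, hb,
          Finset.mem_image_of_mem _ (Finset.mem_filter.2 ⟨hh0, rfl, hc⟩)⟩))
      · exact .inl (.inr (Finset.mem_biUnion.2 ⟨h.2.2, hc,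
          Finset.mem_image_of_mem _ (Finset.mem_filter.2 ⟨hh0, rfl, hb⟩)⟩))
      · tauto
    · refine .inr (Finset.mem_biUnion.2 ⟨h, Finset.mem_filter.2 ⟨hh, h1⟩,
        Finset.mem_image_of_mem _ (Finset.mem_filter.2 ⟨?_, hx⟩)⟩)
      exact Finset.mem_powerset.2 fun y hy => Finset.mem_range.2 (hx.lt y hy)
  have hWε : ∀ f : ℕ → ℝ, (∀ w ∈ W, f w ≤ ε) → ∑ w ∈ W, f w ≤ W.card * ε := fun f hf => by
    simpa using Finset.sum_le_sum hf
  have b1 : ∑ σ ∈ I1, weight p (σ \ W) ≤ W.card * ε := by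
    refine (sum_biUnion_le hw _ _).trans (hWε _ fun w hwW => ?_)
    refine (Finset.sum_image_le_of_nonneg fun s _ => hw s).trans (le_trans ?_ (hb w))
    calc _ = ∑ h ∈ H0 with h.2.1 = w ∧ h.2.2 ∉ W, p h.1 * p h.2.2 := by
          refine Finset.sum_congr rfl fun h hh => ?_
          simp only [H0, Finset.mem_filter] at hh
          have : headSet h \ W = {h.1, h.2.2} := by
            ext u
            simp only [headSet, Finset.mem_sdiff, Finset.mem_insert, Finset.mem_singleton]
            grind
          rw [this, weight, Finset.prod_pair (hne h hh.1.1).2.1]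
      _ ≤ _ := Finset.sum_le_sum_of_subset_of_nonneg
          (fun h hh => by simp only [H0, Finset.mem_filter] at hh ⊢; tauto)
          fun h _ _ => mul_nonneg (hp _) (hp _)
  have b2 : ∑ σ ∈ I2, weight p (σ \ W) ≤ W.card * ε := by
    refine (sum_biUnion_le hw _ _).trans (hWε _ fun w hwW => ?_)
    refine (Finset.sum_image_le_of_nonneg fun s _ => hw s).trans (le_trans ?_ (hc w))
    calc _ = ∑ h ∈ H0 with h.2.2 = w ∧ h.2.1 ∉ W, p h.1 * p h.2.1 := by
          refine Finset.sum_congr rfl fun h hh => ?_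
          simp only [H0, Finset.mem_filter] at hh
          have : headSet h \ W = {h.1, h.2.1} := by
            ext u
            simp only [headSet, Finset.mem_sdiff, Finset.mem_insert, Finset.mem_singleton]
            grind
          rw [this, weight, Finset.prod_pair (hne h hh.1.1).1]
      _ ≤ _ := Finset.sum_le_sum_of_subset_of_nonneg
          (fun h hh => by simp only [H0, Finset.mem_filter] at hh ⊢; tauto)
          fun h _ _ => mul_nonneg (hp _) (hp _)
  have b3 : ∑ σ ∈ I3, weight p (σ \ W) ≤ (W.card : ℝ) ^ 2 * ε := by
    refine (Finset.sum_image_le_of_nonneg fun s _ => hw s).trans ?_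
    calc _ ≤ ∑ h ∈ H0 with h.2.1 ∈ W ∧ h.2.2 ∈ W, ε := by
          refine Finset.sum_le_sum fun h hh => ?_
          simp only [H0, Finset.mem_filter] at hh
          have : headSet h \ W = {h.1} := by
            ext u
            simp only [headSet, Finset.mem_sdiff, Finset.mem_insert, Finset.mem_singleton]
            grind
          simpa [this, weight] using hbig _ (hDr h hh.1.1)
      _ = (H0.filter (fun h => h.2.1 ∈ W ∧ h.2.2 ∈ W)).card * ε := by simp
      _ ≤ (W.card : ℝ) ^ 2 * ε := by
          gcongr
          have : (H0.filter (fun h => h.2.1 ∈ W ∧ h.2.2 ∈ W)).card ≤ (W ×ˢ W).card := by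
            refine Finset.card_le_card_of_injOn (fun h => h.2) (fun h hh => ?_) ?_
            · simp only [Finset.coe_filter, Set.mem_ofPred_eq] at hh
              simpa using hh.2
            · intro h hh h' hh' heq
              have e := hH h (Finset.mem_filter.1 (Finset.mem_filter.1 hh).1).1
              have e' := hH h' (Finset.mem_filter.1 (Finset.mem_filter.1 hh').1).1
              simp only at heq
              rw [← heq] at e'
              exact Prod.ext (by omega) heq
          rw [Finset.card_product] at this
          rw [sq]
          exact_mod_cast this
  have hVc : ∀ h : ℕ × ℕ × ℕ, ((W ∪ {h.2.1, h.2.2}).card : ℝ) ≤ W.card + 2 := by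
    intro h
    have h1 := Finset.card_union_le W {h.2.1, h.2.2}
    have h2 : ({h.2.1, h.2.2} : Finset ℕ).card ≤ 2 := Finset.card_le_two
    exact_mod_cast (by omega : (W ∪ {h.2.1, h.2.2}).card ≤ W.card + 2)
  have hπ : ∀ h : ℕ × ℕ × ℕ, 0 ≤ p h.1 * p h.2.1 * p h.2.2 := fun h =>
    mul_nonneg (mul_nonneg (hp _) (hp _)) (hp _)
  have b4 : ∑ σ ∈ I4, weight p (σ \ W) ≤ 4 * (W.card + 3) ^ 2 * ε * μ +
        (W.card + 3) ^ 2 * ((W.card + D + 3) ^ 3 * (n + 1)) * ξ := by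
    refine (sum_biUnion_le hw _ _).trans ?_
    calc _ ≤ ∑ h ∈ H1, (p h.1 * p h.2.1 * p h.2.2) * (4 * (W.card + 3) ^ 2 * ε +
          if Lin D h.1 (W ∪ {h.2.1, h.2.2}) then ((W.card : ℝ) + 3) ^ 2 else 0) := by
          refine Finset.sum_le_sum fun h hh => ?_
          obtain ⟨hh, hd⟩ := Finset.mem_filter.1 hh
          obtain ⟨n1, n2, n3⟩ := hne h hh
          refine (Finset.sum_image_le_of_nonneg fun s _ => hw s).trans ?_
          calc _ = ∑ x ∈ X h, (p h.1 * p h.2.1 * p h.2.2) * weight p x := by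
                refine Finset.sum_congr rfl fun x hx => ?_
                have hx := (Finset.mem_filter.1 hx).2
                have hxV := Finset.disjoint_union_right.1 hx.disjoint
                have hdx : Disjoint (headSet h) x := by
                  rw [Finset.disjoint_left]
                  intro u hu hux
                  have h1 := hx.lt u hux
                  have h2 := Finset.disjoint_left.1 hxV.2 hux
                  simp only [headSet, Finset.mem_insert, Finset.mem_singleton] at hu h2
                  omega
                have : (headSet h ∪ x) \ W = headSet h ∪ x :=
                  Finset.sdiff_eq_self_of_disjoint (Finset.disjoint_union_left.2 ⟨hd, hxV.1⟩)
                rw [this, weight_union hdx, weight_headSet h n1 n2 n3]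
            _ ≤ _ := by
                rw [← Finset.mul_sum]
                refine mul_le_mul_of_nonneg_left ?_ (hπ h)
                refine (sum_conf_le hp hp1 (hDr h hh) hε (hclose h hh) (hpair h hh) (hdiff h hh)
                  hbig _ (X h) fun x hx => (Finset.mem_filter.1 hx).2).trans ?_
                have hv := hVc h
                refine add_le_add ?_ ?_
                · gcongr 4 * ?_ ^ 2 * ε
                  linarith
                · split_ifs
                  · have : (0 : ℝ) ≤ (W ∪ {h.2.1, h.2.2}).card := by positivity
                    nlinarith
                  · exact le_rfl
      _ ≤ ∑ h ∈ H, (p h.1 * p h.2.1 * p h.2.2) * (4 * (W.card + 3) ^ 2 * ε +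
          if Lin D h.1 (W ∪ {h.2.1, h.2.2}) then ((W.card : ℝ) + 3) ^ 2 else 0) := by
          refine Finset.sum_le_sum_of_subset_of_nonneg (Finset.filter_subset _ _) fun h _ _ =>
            mul_nonneg (hπ h) (add_nonneg (by positivity) ?_)
          split_ifs <;> positivity
      _ = 4 * (W.card + 3) ^ 2 * ε * ∑ h ∈ H, p h.1 * p h.2.1 * p h.2.2 +
          ∑ h ∈ H with Lin D h.1 (W ∪ {h.2.1, h.2.2}),
            (p h.1 * p h.2.1 * p h.2.2) * ((W.card : ℝ) + 3) ^ 2 := by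
          rw [Finset.sum_filter, Finset.mul_sum, ← Finset.sum_add_distrib]
          refine Finset.sum_congr rfl fun h _ => ?_
          split_ifs <;> ring
      _ ≤ _ := by
          gcongr
          calc _ ≤ ∑ h ∈ H with Lin D h.1 (W ∪ {h.2.1, h.2.2}), ξ * ((W.card : ℝ) + 3) ^ 2 := by
                refine Finset.sum_le_sum fun h hh => ?_
                gcongr
                exact hξH h (Finset.mem_filter.1 hh).1
            _ = (H.filter fun h => Lin D h.1 (W ∪ {h.2.1, h.2.2})).card *
                  (ξ * ((W.card : ℝ) + 3) ^ 2) := by simp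
            _ ≤ ((W.card + D + 3) ^ 3 * (n + 1)) * (ξ * ((W.card : ℝ) + 3) ^ 2) := by
                gcongr
                exact_mod_cast card_lin_le hH W
            _ = _ := by ring
  have := Finset.sum_le_sum_of_subset_of_nonneg hsub fun s _ _ => hw s
  have u1 := sum_union_le hw (I1 ∪ I2 ∪ I3) I4
  have u2 := sum_union_le hw (I1 ∪ I2) I3
  have u3 := sum_union_le hw I1 I2
  have hc : (0 : ℝ) ≤ W.card * ε := by positivity
  have hc2 : (0 : ℝ) ≤ (W.card : ℝ) ^ 2 * ε := by positivity
  nlinarith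

end Cost

/-- The union of a list of finite sets. -/
def listUnion (l : List (Finset ℕ)) : Finset ℕ := l.foldr (· ∪ ·) ∅

lemma listUnion_cons (σ : Finset ℕ) (l : List (Finset ℕ)) :
    listUnion (σ :: l) = σ ∪ listUnion l := rfl

lemma mem_listUnion {l : List (Finset ℕ)} {y : ℕ} : y ∈ listUnion l ↔ ∃ σ ∈ l, y ∈ σ := by
  induction l with
  | nil => simp [listUnion]
  | cons σ l ih => simp [listUnion_cons, ih]

lemma badChain_append_singleton {Bad : Finset ℕ → Finset ℕ → Prop} (l : List (Finset ℕ))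
    (W σ : Finset ℕ) (hl : BadChain Bad W l) (hσ : Bad (W ∪ listUnion l) σ) :
    BadChain Bad W (l ++ [σ]) := by
  induction l generalizing W with
  | nil => exact ⟨by simpa [listUnion] using hσ, trivial⟩
  | cons τ l ih =>
    refine ⟨hl.1, ih _ hl.2 ?_⟩
    rwa [Finset.union_assoc, ← listUnion_cons]

lemma BadChain.take {Bad : Finset ℕ → Finset ℕ → Prop} (k : ℕ) (l : List (Finset ℕ))
    (W : Finset ℕ) (hl : BadChain Bad W l) : BadChain Bad W (l.take k) := by
  induction l generalizing W k with
  | nil => simpa using hl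
  | cons τ l ih =>
    cases k with
    | zero => trivial
    | succ k => exact ⟨hl.1, ih _ _ hl.2⟩

lemma BadChain.union_of_disjoint {Bad : Finset ℕ → Finset ℕ → Prop}
    (hmono : ∀ W σ e, Bad W σ → Disjoint σ e → Bad (W ∪ e) σ) (l : List (Finset ℕ))
    (W e : Finset ℕ) (hl : BadChain Bad W l) (he : Disjoint (listUnion l) e) :
    BadChain Bad (W ∪ e) l := by
  induction l generalizing W with
  | nil => trivial
  | cons τ l ih =>
    rw [listUnion_cons, Finset.disjoint_union_left] at he
    refine ⟨hmono _ _ _ hl.1 he.1, ?_⟩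
    rw [Finset.union_right_comm]
    exact ih _ hl.2 he.2

/-- A set made of an element `a` and the entries of `g` different pairs of sum `r + a` lying
between `a` and `r`. -/
def IsTail (g r a : ℕ) (t : Finset ℕ) : Prop :=
  a < r ∧ ∃ f : Fin g → ℕ, Function.Injective f ∧ (∀ i, a < f i ∧ 2 * f i ≤ r + a) ∧
    t = {a} ∪ (Finset.univ.image f ∪ Finset.univ.image fun i => r + a - f i)

lemma IsTail.self_mem {g r a : ℕ} {t : Finset ℕ} (h : IsTail g r a t) : a ∈ t := by
  obtain ⟨-, f, -, -, rfl⟩ := h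
  simp

lemma IsTail.lt {g r a : ℕ} {t : Finset ℕ} (h : IsTail g r a t) : ∀ y ∈ t, y < r := by
  obtain ⟨h0, f, -, hf, rfl⟩ := h
  intro y hy
  simp only [Finset.mem_union, Finset.mem_singleton, Finset.mem_image, Finset.mem_univ,
    true_and] at hy
  rcases hy with rfl | ⟨i, rfl⟩ | ⟨i, rfl⟩
  · exact h0
  · have := hf i
    omega
  · have := hf i
    omega

lemma IsTail.card_le {g r a : ℕ} {t : Finset ℕ} (h : IsTail g r a t) : t.card ≤ 2 * g + 1 := by
  obtain ⟨-, f, -, -, rfl⟩ := h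
  have h1 := Finset.card_union_le {a} (Finset.univ.image f ∪ Finset.univ.image fun i => r + a - f i)
  have h2 := Finset.card_union_le (Finset.univ.image f) (Finset.univ.image fun i => r + a - f i)
  have h3 : (Finset.univ.image f).card ≤ g := Finset.card_image_le.trans (by simp)
  have h4 : (Finset.univ.image fun i => r + a - f i).card ≤ g :=
    Finset.card_image_le.trans (by simp)
  simp only [Finset.card_singleton] at h1
  omega

lemma IsTail.exists_pair {g r a : ℕ} {t : Finset ℕ} (h : IsTail g r a t) {y : ℕ} (hy : y ∈ t)
    (hya : y ≠ a) : ∃ z' ∈ t, r + a = y + z' ∧ a < y ∧ a < z' ∧ y < r ∧ z' < r := by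
  obtain ⟨h0, f, -, hf, rfl⟩ := h
  simp only [Finset.mem_union, Finset.mem_singleton, Finset.mem_image, Finset.mem_univ,
    true_and] at hy
  rcases hy with rfl | ⟨i, rfl⟩ | ⟨i, rfl⟩
  · exact absurd rfl hya
  · have := hf i
    exact ⟨r + a - f i, by simp, by omega, by omega, by omega, by omega, by omega⟩
  · have := hf i
    exact ⟨f i, by simp, by omega, by omega, by omega, by omega, by omega⟩

lemma IsTail.exists_pair_of_pos {g r a : ℕ} (hg : 0 < g) {t : Finset ℕ} (h : IsTail g r a t) :
    ∃ z ∈ t, z ≠ a := by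
  obtain ⟨h0, f, -, hf, rfl⟩ := h
  have := hf ⟨0, hg⟩
  exact ⟨f ⟨0, hg⟩, by simp, by omega⟩

open Classical in
/-- The smallest elements of the tails at `r` contained in `A`. -/
def tailMins (g r : ℕ) (A : Set ℕ) : Finset ℕ :=
  (Finset.range r).filter fun a => ∃ t : Finset ℕ, (t : Set ℕ) ⊆ A ∧ IsTail g r a t

open Classical in
lemma card_tailMins_le {g r D K L : ℕ} {A : Set ℕ} (S : Finset (Finset ℕ))
    (hS : ∀ t ∈ S, (t : Set ℕ) ⊆ A ∧ ∃ a, IsTail g r a t)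
    (hmax : ∀ (t : Finset ℕ) (a : ℕ), (t : Set ℕ) ⊆ A → IsTail g r a t → ∃ t' ∈ S, ¬ Disjoint t t')
    (hK : ∀ d, 0 < d → d < r →
      ((Finset.range r).filter fun a => a ∈ A ∧ a + d ∈ A ∧ D ≤ a + d).card ≤ K)
    (hL : ∀ d, 0 < d → d < r → ((Finset.range r).filter fun a => a ∈ A ∧ a + d ∈ A).card ≤ L)
    (h0 : 0 ∉ A) :
    (tailMins g r A).card ≤ (2 * g + 1) * S.card * (1 + K) +
      ((Finset.range r).filter fun z => r < z + D ∧ z ∈ A).card * (1 + L) := by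
  set Y := S.biUnion id
  set Z := (Finset.range r).filter fun z => r < z + D ∧ z ∈ A
  have hY : Y.card ≤ (2 * g + 1) * S.card := by
    rw [mul_comm]
    refine Finset.card_biUnion_le_card_mul _ _ _ fun t ht => ?_
    obtain ⟨-, a, ha⟩ := hS t ht
    exact ha.card_le
  have hYlt : ∀ y ∈ Y, y ∈ A ∧ y < r := by
    intro y hy
    obtain ⟨t, ht, hyt⟩ := Finset.mem_biUnion.1 hy
    obtain ⟨h1, a, ha⟩ := hS t ht
    exact ⟨h1 hyt, ha.lt y hyt⟩
  set X1 := (Y.filter (0 < ·)).biUnion fun y => {y} ∪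
    (Finset.range r).filter fun a => a ∈ A ∧ a + (r - y) ∈ A ∧ D ≤ a + (r - y)
  set X2 := (Z.filter (0 < ·)).biUnion fun y => {y} ∪
    (Finset.range r).filter fun a => a ∈ A ∧ a + (r - y) ∈ A
  have hsub : tailMins g r A ⊆ X1 ∪ X2 := by
    intro a ha
    obtain ⟨har, t, htA, ht⟩ := Finset.mem_filter.1 ha
    obtain ⟨t', ht', hd⟩ := hmax t a htA ht
    obtain ⟨y, hyt, hyt'⟩ := Finset.not_disjoint_iff.1 hd
    have hyY : y ∈ Y := Finset.mem_biUnion.2 ⟨t', ht', hyt'⟩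
    have hy0 : 0 < y := Nat.pos_of_ne_zero fun h => h0 (h ▸ htA hyt)
    have hyr := ht.lt y hyt
    by_cases hya : y = a
    · refine Finset.mem_union_left _ (Finset.mem_biUnion.2 ⟨y, Finset.mem_filter.2 ⟨hyY, hy0⟩, ?_⟩)
      simp [hya]
    · obtain ⟨z', hz', h1, h2, h3, h4, h5⟩ := ht.exists_pair hyt hya
      have hz'' : a + (r - y) = z' := by omega
      have haA := htA ht.self_mem
      have hzA := htA hz'
      by_cases hD : D ≤ z'
      · refine Finset.mem_union_left _ (Finset.mem_biUnion.2 ⟨y, Finset.mem_filter.2 ⟨hyY, hy0⟩,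
          Finset.mem_union_right _ (Finset.mem_filter.2 ⟨har, haA, ?_⟩)⟩)
        rw [hz'']
        exact ⟨hzA, hD⟩
      · refine Finset.mem_union_right _ (Finset.mem_biUnion.2 ⟨y, Finset.mem_filter.2 ⟨?_, hy0⟩,
          Finset.mem_union_right _ (Finset.mem_filter.2 ⟨har, haA, ?_⟩)⟩)
        · exact Finset.mem_filter.2 ⟨Finset.mem_range.2 hyr, by omega, htA hyt⟩
        · rw [hz'']
          exact hzA
  calc _ ≤ X1.card + X2.card := (Finset.card_le_card hsub).trans (Finset.card_union_le _ _)
    _ ≤ (Y.filter (0 < ·)).card * (1 + K) + (Z.filter (0 < ·)).card * (1 + L) := by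
        refine add_le_add (Finset.card_biUnion_le_card_mul _ _ _ fun y hy => ?_)
          (Finset.card_biUnion_le_card_mul _ _ _ fun y hy => ?_)
        · obtain ⟨hy, hy0⟩ := Finset.mem_filter.1 hy
          have := (hYlt y hy).2
          refine (Finset.card_union_le _ _).trans (add_le_add (by simp) (hK _ ?_ ?_)) <;> omega
        · obtain ⟨hy, hy0⟩ := Finset.mem_filter.1 hy
          have := Finset.mem_range.1 (Finset.mem_filter.1 hy).1
          refine (Finset.card_union_le _ _).trans (add_le_add (by simp) (hL _ ?_ ?_)) <;> omega
    _ ≤ Y.card * (1 + K) + Z.card * (1 + L) := by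
        gcongr <;> exact Finset.filter_subset _ _
    _ ≤ _ := by gcongr

/-- The elements involved at the root `r`. -/
def block (h : ℕ × ℕ × ℕ) (S : Finset (Finset ℕ)) : Finset ℕ := headSet h ∪ S.biUnion id

open Classical in
lemma exists_greedy {g D : ℕ} (hg : 0 < g) {H : Finset (ℕ × ℕ × ℕ)} {A : Set ℕ} (b c : ℕ → ℕ)
    (S : ℕ → Finset (Finset ℕ)) (hpart : ∀ h ∈ H, ∀ h' ∈ H, h'.1 ≠ h.2.1 ∧ h'.1 ≠ h.2.2)
    (ρ : Finset ℕ)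
    (hmem : ∀ r ∈ ρ, (r, b r, c r) ∈ H ∧ (headSet (r, b r, c r) : Set ℕ) ⊆ A)
    (hS : ∀ r ∈ ρ, ∀ t ∈ S r, (t : Set ℕ) ⊆ A ∧ ∃ a, IsTail g r a t) :
    ∃ Gd ⊆ ρ, (Gd : Set ℕ).PairwiseDisjoint (fun r => block (r, b r, c r) (S r)) ∧
      (∀ r ∈ Gd, (∀ z ∈ A, z < r → z + D ≤ r) ∧ ∀ t ∈ S r, Disjoint t (headSet (r, b r, c r))) ∧
      ∃ l : List (Finset ℕ), l.length = (ρ \ Gd).card ∧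
        BadChain (IsBad D H) (Gd.biUnion fun r => block (r, b r, c r) (S r)) l ∧
        (∀ σ ∈ l, (σ : Set ℕ) ⊆ A) ∧
        ∀ y ∈ (Gd.biUnion fun r => block (r, b r, c r) (S r)) ∪ listUnion l,
          (∃ r ∈ ρ, y ≤ r) ∨ ∃ h ∈ H, y = h.2.1 ∨ y = h.2.2 := by
  induction ρ using Finset.induction_on_max with
  | empty => exact ⟨∅, by simp, by simp, by simp, [], by simp, trivial, by simp, by simp [listUnion]⟩
  | insert r ρ hr ih =>
    obtain ⟨Gd, hGd, hdis, hgood, l, hlen, hchain, hlA, hinv⟩ :=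
      ih (fun r hr => hmem r (Finset.mem_insert_of_mem hr))
        fun r hr => hS r (Finset.mem_insert_of_mem hr)
    obtain ⟨hH, hhA⟩ := hmem r (Finset.mem_insert_self _ _)
    have hSr := hS r (Finset.mem_insert_self _ _)
    have hrρ : r ∉ ρ := fun h => lt_irrefl _ (hr r h)
    have hrGd : r ∉ Gd := fun h => hrρ (hGd h)
    set e := fun r => block (r, b r, c r) (S r) with he
    set W := Gd.biUnion e ∪ listUnion l with hW
    have hrW : r ∉ W := by
      intro h
      rcases hinv r h with ⟨r', h1, h2⟩ | ⟨h, h1, h2⟩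
      · have := hr r' h1
        omega
      · have := hpart h h1 _ hH
        simp only at this
        tauto
    have hsplit : (∃ σ, IsBad D H W σ ∧ (σ : Set ℕ) ⊆ A ∧ ∀ y ∈ σ, y ≤ r ∨ y = b r ∨ y = c r) ∨
        (Disjoint (e r) W ∧ (∀ z ∈ A, z < r → z + D ≤ r) ∧
          ∀ t ∈ S r, Disjoint t (headSet (r, b r, c r))) := by
      have hhead : ∀ y ∈ headSet (r, b r, c r), y ≤ r ∨ y = b r ∨ y = c r := by
        intro y hy
        simp only [headSet, Finset.mem_insert, Finset.mem_singleton] at hy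
        omega
      by_cases hbc : b r ∈ W ∨ c r ∈ W
      · exact .inl ⟨headSet (r, b r, c r), ⟨_, hH, hrW, .inl ⟨hbc, rfl⟩⟩, hhA, hhead⟩
      have hdW : Disjoint (headSet (r, b r, c r)) W := by
        rw [Finset.disjoint_left]
        intro y hy
        simp only [headSet, Finset.mem_insert, Finset.mem_singleton] at hy
        rcases hy with rfl | rfl | rfl <;> tauto
      set V : Finset ℕ := W ∪ {b r, c r} with hV
      have hbad : ∀ x y : Finset ℕ, x = y \ V → (y : Set ℕ) ⊆ A → Conf D r V x →
          ∃ σ, IsBad D H W σ ∧ (σ : Set ℕ) ⊆ A ∧ ∀ y ∈ σ, y ≤ r ∨ y = b r ∨ y = c r := by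
        rintro x y rfl hyA hx
        refine ⟨headSet (r, b r, c r) ∪ y \ V, ⟨_, hH, hrW, .inr ⟨hdW, _, hx, rfl⟩⟩, ?_, ?_⟩
        · rw [Finset.coe_union]
          exact Set.union_subset hhA
            ((Finset.coe_subset.2 Finset.sdiff_subset).trans hyA)
        · intro u hu
          rcases Finset.mem_union.1 hu with hu | hu
          · exact hhead u hu
          · exact .inl (hx.lt u hu).le
      by_cases hcl : ∀ z ∈ A, z < r → z + D ≤ r
      swap
      · push Not at hcl
        obtain ⟨z, hzA, hzr, hzD⟩ := hcl
        exact .inl (hbad _ {z} rfl (by simpa using hzA) (.inl ⟨z, hzr, hzD, rfl⟩))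
      by_cases hdisj : ∀ t ∈ S r, Disjoint t V
      · refine .inr ⟨?_, hcl, fun t ht => ?_⟩
        · simp only [he, block]
          rw [Finset.disjoint_union_left]
          refine ⟨hdW, (Finset.disjoint_biUnion_left _ _ _).2 fun t ht => ?_⟩
          exact (Finset.disjoint_union_right.1 (hdisj t ht)).1
        · obtain ⟨-, a, ha⟩ := hSr t ht
          rw [Finset.disjoint_left]
          intro y hy hyh
          have h1 := ha.lt y hy
          have h2 := Finset.disjoint_left.1 (hdisj t ht) hy
          simp only [headSet, Finset.mem_insert, Finset.mem_singleton] at hyh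
          simp only [hV, Finset.mem_union, Finset.mem_insert, Finset.mem_singleton] at h2
          rcases hyh with h | h | h
          · omega
          · tauto
          · tauto
      · push Not at hdisj
        obtain ⟨t, ht, hd⟩ := hdisj
        obtain ⟨htA, a, hta⟩ := hSr t ht
        obtain ⟨y, hyt, hyV⟩ := Finset.not_disjoint_iff.1 hd
        obtain ⟨z, hzt, hza, hzy⟩ : ∃ z ∈ t, z ≠ a ∧ (y = a ∨ y = z) := by
          by_cases hya : y = a
          · obtain ⟨z, hz, hza⟩ := hta.exists_pair_of_pos hg
            exact ⟨z, hz, hza, .inl hya⟩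
          · exact ⟨y, hyt, hya, .inr rfl⟩
        obtain ⟨z', hz't, h1, h2, h3, h4, h5⟩ := hta.exists_pair hzt hza
        have hz := hcl z (htA hzt) h4
        have hz' := hcl z' (htA hz't) h5
        refine .inl (hbad _ {a, z, z'} rfl ?_ (.inr ⟨a, z, z', h2, h3, h4, h5, h1, by omega,
          by omega, rfl, ?_⟩))
        · intro u hu
          simp only [Finset.coe_insert, Finset.coe_singleton, Set.mem_insert_iff,
            Set.mem_singleton_iff] at hu
          rcases hu with rfl | rfl | rfl
          · exact htA hta.self_mem
          · exact htA hzt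
          · exact htA hz't
        · rw [Finset.not_disjoint_iff]
          exact ⟨y, by simp; tauto, hyV⟩
    rcases hsplit with ⟨σ, hσ, hσA, hσr⟩ | ⟨hd, hcl, hdh⟩
    · refine ⟨Gd, hGd.trans (Finset.subset_insert _ _), hdis, hgood, l ++ [σ], ?_,
        badChain_append_singleton _ _ _ hchain hσ, ?_, ?_⟩
      · rw [List.length_append, hlen, Finset.insert_sdiff_of_notMem _ hrGd,
          Finset.card_insert_of_notMem (by simp [hrρ])]
        rfl
      · intro τ hτ
        rcases List.mem_append.1 hτ with h | h
        · exact hlA τ h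
        · rw [List.mem_singleton.1 h]
          exact hσA
      · intro y hy
        have hy' : y ∈ W ∨ y ∈ σ := by
          simp only [hW, Finset.mem_union, mem_listUnion, List.mem_append, List.mem_singleton] at hy ⊢
          grind
        rcases hy' with hy | hy
        · rcases hinv y hy with ⟨r', h1, h2⟩ | h
          · exact .inl ⟨r', Finset.mem_insert_of_mem h1, h2⟩
          · exact .inr h
        · rcases hσr y hy with h | h
          · exact .inl ⟨r, Finset.mem_insert_self _ _, h⟩
          · exact .inr ⟨_, hH, h⟩
    · have hd' := Finset.disjoint_union_right.1 hd
      refine ⟨insert r Gd, Finset.insert_subset_insert _ hGd, ?_, ?_, l, ?_, ?_, hlA, ?_⟩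
      · rw [Finset.coe_insert]
        refine (Set.pairwiseDisjoint_insert_of_notMem (by simpa using hrGd)).2 ⟨hdis, ?_⟩
        intro r' hr'
        exact (Finset.disjoint_biUnion_right _ _ _).1 hd'.1 r' hr'
      · intro r' hr'
        rcases Finset.mem_insert.1 hr' with rfl | hr'
        · exact ⟨hcl, hdh⟩
        · exact hgood r' hr'
      · rw [hlen]
        congr 1
        ext u
        simp only [Finset.mem_sdiff, Finset.mem_insert]
        constructor
        · rintro ⟨h1, h2⟩
          exact ⟨.inr h1, by rintro (rfl | h) <;> tauto⟩
        · tauto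
      · rw [Finset.biUnion_insert, Finset.union_comm]
        exact BadChain.union_of_disjoint (fun W σ e h => h.mono) l _ _ hchain hd'.2.symm
      · intro y hy
        have hy' : y ∈ W ∨ y ∈ e r := by
          rw [Finset.biUnion_insert] at hy
          simp only [hW, Finset.mem_union] at hy ⊢
          tauto
        rcases hy' with hy | hy
        · rcases hinv y hy with ⟨r', h1, h2⟩ | h
          · exact .inl ⟨r', Finset.mem_insert_of_mem h1, h2⟩
          · exact .inr h
        · simp only [he, block, headSet, Finset.mem_union, Finset.mem_insert,
            Finset.mem_singleton, Finset.mem_biUnion, id] at hy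
          rcases hy with (h | h) | ⟨t, ht, hyt⟩
          · exact .inl ⟨r, Finset.mem_insert_self _ _, h.le⟩
          · exact .inr ⟨_, hH, h⟩
          · obtain ⟨-, a, ha⟩ := hSr t ht
            exact .inl ⟨r, Finset.mem_insert_self _ _, (ha.lt y hyt).le⟩

open Classical in
/-- The triples of `R_n` with the distinguished entry number `τ` moved to the front. -/
def heads (g M : ℕ) (lam : ℝ) (s : ℕ → Fin 3 → ZMod M) (n : ℕ) (τ : Fin 3) :
    Finset (ℕ × ℕ × ℕ) :=
  (Finset.range (n + 1) ×ˢ Finset.range (n + 1) ×ˢ Finset.range (n + 1)).filter fun h =>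
    (τ = 0 ∧ Rtrip g M lam s n h.1 h.2.1 h.2.2) ∨ (τ = 1 ∧ Rtrip g M lam s n h.2.1 h.1 h.2.2) ∨
      (τ = 2 ∧ Rtrip g M lam s n h.2.1 h.2.2 h.1)

open Classical in
/-- The distinguished entries of the triples contained in `A`. -/
def roots (g M : ℕ) (lam : ℝ) (s : ℕ → Fin 3 → ZMod M) (n : ℕ) (A : Set ℕ) (τ : Fin 3) :
    Finset ℕ :=
  ((heads g M lam s n τ).filter fun h => (headSet h : Set ℕ) ⊆ A).image Prod.fst

section

variable {g M : ℕ} {lam : ℝ} {s : ℕ → Fin 3 → ZMod M} {n : ℕ} {CM : Set (ZMod M)}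

lemma mem_heads_iff {τ : Fin 3} {h : ℕ × ℕ × ℕ} : h ∈ heads g M lam s n τ ↔
    (τ = 0 ∧ Rtrip g M lam s n h.1 h.2.1 h.2.2) ∨ (τ = 1 ∧ Rtrip g M lam s n h.2.1 h.1 h.2.2) ∨
      (τ = 2 ∧ Rtrip g M lam s n h.2.1 h.2.2 h.1) := by
  classical
  rw [heads, Finset.mem_filter, and_iff_right_iff_imp]
  intro hh
  simp only [Finset.mem_product, Finset.mem_range]
  rcases hh with ⟨-, -, -, -, h, -⟩ | ⟨-, -, -, -, h, -⟩ | ⟨-, -, -, -, h, -⟩ <;> omega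

lemma sum_of_mem_heads {τ : Fin 3} {h : ℕ × ℕ × ℕ} (hh : h ∈ heads g M lam s n τ) :
    h.1 + h.2.1 + h.2.2 = n := by
  rcases mem_heads_iff.1 hh with ⟨-, -, -, -, h, -⟩ | ⟨-, -, -, -, h, -⟩ | ⟨-, -, -, -, h, -⟩ <;>
  omega

lemma rtrip_ne (hs : GoodS M CM s) {x y z : ℕ} (h : Rtrip g M lam s n x y z) :
    x ≠ y ∧ x ≠ z ∧ y ≠ z := by
  obtain ⟨-, -, -, -, -, -, -, -, -, -, h1, h2, h3⟩ := h
  obtain ⟨-, n1, n2, n3, -⟩ := hs n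
  refine ⟨?_, ?_, ?_⟩ <;> rintro rfl
  · exact n1 (h1.symm.trans h2)
  · exact n2 (h1.symm.trans h3)
  · exact n3 (h2.symm.trans h3)

lemma ne_of_mem_heads (hs : GoodS M CM s) {τ : Fin 3} {h : ℕ × ℕ × ℕ}
    (hh : h ∈ heads g M lam s n τ) : h.1 ≠ h.2.1 ∧ h.1 ≠ h.2.2 ∧ h.2.1 ≠ h.2.2 := by
  rcases mem_heads_iff.1 hh with ⟨-, h⟩ | ⟨-, h⟩ | ⟨-, h⟩ <;>
  · have := rtrip_ne hs h
    grind

lemma root_ne_partner (hs : GoodS M CM s) {τ : Fin 3} {h h' : ℕ × ℕ × ℕ}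
    (hh : h ∈ heads g M lam s n τ) (hh' : h' ∈ heads g M lam s n τ) :
    h'.1 ≠ h.2.1 ∧ h'.1 ≠ h.2.2 := by
  obtain ⟨-, n1, n2, n3, -⟩ := hs n
  rcases mem_heads_iff.1 hh with ⟨rfl, h⟩ | ⟨rfl, h⟩ | ⟨rfl, h⟩ <;>
  rcases mem_heads_iff.1 hh' with ⟨h0, h'⟩ | ⟨h0, h'⟩ | ⟨h0, h'⟩ <;> simp at h0 <;>
  obtain ⟨-, -, -, -, -, -, -, -, -, -, h1, h2, h3⟩ := h <;>
  obtain ⟨-, -, -, -, -, -, -, -, -, -, h1', h2', h3'⟩ := h' <;>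
  constructor <;> intro heq <;> simp_all

lemma mem_roots_of_firstThree (hs : GoodS M CM s) {A : Set ℕ} {u v w : ℕ}
    (h : ({u, v, w} : Finset ℕ) ∈ Rn g M lam s n) (hA : u ∈ A ∧ v ∈ A ∧ w ∈ A) :
    u + v + w = n ∧ ∃ τ, u ∈ roots g M lam s n A τ := by
  classical
  obtain ⟨x, y, z, heq, hR⟩ := h
  have hne := rtrip_ne hs hR
  have hsum := hR.2.2.2.1
  have hx : x = u ∨ x = v ∨ x = w := by
    have : x ∈ ({u, v, w} : Finset ℕ) := by rw [heq]; simp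
    simpa using this
  have hy : y = u ∨ y = v ∨ y = w := by
    have : y ∈ ({u, v, w} : Finset ℕ) := by rw [heq]; simp
    simpa using this
  have hz : z = u ∨ z = v ∨ z = w := by
    have : z ∈ ({u, v, w} : Finset ℕ) := by rw [heq]; simp
    simpa using this
  obtain ⟨hu, hv, hw⟩ := hA
  refine ⟨by omega, ?_⟩
  have hhA : ∀ h : ℕ × ℕ × ℕ, h.1 ∈ A → h.2.1 ∈ A → h.2.2 ∈ A → (headSet h : Set ℕ) ⊆ A := by
    intro h h1 h2 h3 y hy
    simp only [headSet, Finset.coe_insert, Finset.coe_singleton, Set.mem_insert_iff,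
      Set.mem_singleton_iff] at hy
    rcases hy with rfl | rfl | rfl <;> assumption
  have hxA : x ∈ A := by rcases hx with rfl | rfl | rfl <;> assumption
  have hyA : y ∈ A := by rcases hy with rfl | rfl | rfl <;> assumption
  have hzA : z ∈ A := by rcases hz with rfl | rfl | rfl <;> assumption
  have : u = x ∨ u = y ∨ u = z := by omega
  rcases this with rfl | rfl | rfl
  · exact ⟨0, Finset.mem_image.2 ⟨(u, y, z), Finset.mem_filter.2
      ⟨mem_heads_iff.2 (.inl ⟨rfl, hR⟩), hhA _ hxA hyA hzA⟩, rfl⟩⟩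
  · exact ⟨1, Finset.mem_image.2 ⟨(u, x, z), Finset.mem_filter.2
      ⟨mem_heads_iff.2 (.inr (.inl ⟨rfl, hR⟩)), hhA _ hyA hxA hzA⟩, rfl⟩⟩
  · exact ⟨2, Finset.mem_image.2 ⟨(u, x, y), Finset.mem_filter.2
      ⟨mem_heads_iff.2 (.inr (.inr ⟨rfl, hR⟩)), hhA _ hzA hxA hyA⟩, rfl⟩⟩

lemma fourth_mem_tailMins (hg : 0 < g) {A : Set ℕ} {x : Fin (2 * g + 4) → ℕ}
    (hx : x ∈ Tn g M lam s n) (hA : ∀ i, x i ∈ A) :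
    x ⟨3, by omega⟩ ∈ tailMins g (x ⟨0, by omega⟩) A := by
  classical
  obtain ⟨hpos, -, hsum, hle, -, hpair⟩ := hx
  set r := x ⟨0, by omega⟩
  set a := x ⟨3, by omega⟩
  have hs : ∀ i : Fin g, r + a = x ⟨2 * i + 4, by omega⟩ + x ⟨2 * i + 5, by omega⟩ := fun i =>
    hsum (i + 2) (by omega) (by omega)
  have hl1 : ∀ i : Fin g, x ⟨2 * i + 4, by omega⟩ ≤ r := fun i => hle _ (by simp)
  have hl2 : ∀ i : Fin g, x ⟨2 * i + 5, by omega⟩ ≤ r := fun i => hle _ (by simp)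
  have hp0 : pairOf g x 0 = {r, a} := by simp [pairOf, r, a]
  have hp : ∀ i : Fin g, pairOf g x (i + 1) =
      {x ⟨2 * i + 4, by omega⟩, x ⟨2 * i + 5, by omega⟩} := by
    intro i
    have : (i : ℕ) + 1 ≤ g := by omega
    simp only [pairOf, Nat.succ_ne_zero, if_false, this, dif_pos]
    rfl
  have hne0 : ∀ i : Fin g, ({r, a} : Finset ℕ) ≠
      {x ⟨2 * i + 4, by omega⟩, x ⟨2 * i + 5, by omega⟩} := by
    intro i
    rw [← hp0, ← hp i]
    exact hpair _ _ (by omega) (by omega) (by omega)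
  have hgt : ∀ i : Fin g, a < x ⟨2 * i + 4, by omega⟩ ∧ a < x ⟨2 * i + 5, by omega⟩ := by
    intro i
    have h1 := hs i
    have h2 := hl1 i
    have h3 := hl2 i
    have h4 := hne0 i
    generalize x ⟨2 * i + 4, by omega⟩ = u at *
    generalize x ⟨2 * i + 5, by omega⟩ = v at *
    refine ⟨lt_of_le_of_ne (by omega) ?_, lt_of_le_of_ne (by omega) ?_⟩
    · intro h
      refine h4 ?_
      rw [← h, show v = r by omega, Finset.pair_comm]
    · intro h
      refine h4 ?_
      rw [← h, show u = r by omega]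
  have har : a < r := by
    have h1 := hgt ⟨0, hg⟩
    have h2 := hl1 ⟨0, hg⟩
    omega
  refine Finset.mem_filter.2 ⟨Finset.mem_range.2 har, _, ?_, har,
    fun i => min (x ⟨2 * i + 4, by omega⟩) (x ⟨2 * i + 5, by omega⟩), ?_, ?_, rfl⟩
  · intro y hy
    simp only [Finset.coe_union, Finset.coe_image, Finset.coe_univ, Set.image_univ, Set.mem_union,
      Finset.coe_singleton, Set.mem_singleton_iff, Set.mem_range] at hy
    rcases hy with rfl | ⟨i, rfl⟩ | ⟨i, rfl⟩
    · exact hA _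
    · rcases min_choice (x ⟨2 * i + 4, by omega⟩) (x ⟨2 * i + 5, by omega⟩) with h | h <;>
        rw [h] <;> exact hA _
    · have h1 := hs i
      rcases le_total (x ⟨2 * i + 4, by omega⟩) (x ⟨2 * i + 5, by omega⟩) with h | h
      · rw [min_eq_left h, h1, Nat.add_sub_cancel_left]
        exact hA _
      · rw [min_eq_right h, h1, Nat.add_sub_cancel]
        exact hA _
  · intro i j hij
    by_contra hne
    refine hpair (i + 1) (j + 1) (by omega) (by omega)
      (fun h => hne (Fin.ext (by omega))) ?_
    rw [hp, hp]
    have h1 := hs i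
    have h2 := hs j
    simp only at hij
    generalize x ⟨2 * i + 4, by omega⟩ = u at *
    generalize x ⟨2 * i + 5, by omega⟩ = v at *
    generalize x ⟨2 * j + 4, by omega⟩ = u' at *
    generalize x ⟨2 * j + 5, by omega⟩ = v' at *
    have : (u = u' ∧ v = v') ∨ (u = v' ∧ v = u') := by omega
    rcases this with ⟨rfl, rfl⟩ | ⟨rfl, rfl⟩
    · rfl
    · rw [Finset.pair_comm]
  · intro i
    have h1 := hs i
    have h2 := hgt i
    simp only
    omega

open Classical in
lemma ncard_tuples_le (hg : 0 < g) (hs : GoodS M CM s) {A : Set ℕ} {K R0 : ℕ}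
    (hR : ∀ x y z, Rtrip g M lam s n x y z → R0 ≤ x ∧ R0 ≤ y ∧ R0 ≤ z)
    (hrep : ∀ m, R0 ≤ m → m ≤ 2 * n →
      ((Finset.range (m + 1)).filter fun z => z ∈ A ∧ m - z ∈ A).card ≤ K) :
    Set.ncard {x ∈ Tn g M lam s n | ((imgF x : Finset ℕ) : Set ℕ) ⊆ A} ≤
      K ^ (g + 1) * ∑ τ, ∑ r ∈ roots g M lam s n A τ, (tailMins g r A).card := by
  set rep : ℕ → Finset ℕ := fun m => (Finset.range (m + 1)).filter fun z => z ∈ A ∧ m - z ∈ A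
  set ρ := Finset.univ.biUnion (roots g M lam s n A)
  have hroot : ∀ r ∈ ρ, R0 ≤ r ∧ r ≤ n ∧ R0 ≤ n - r := by
    intro r hr
    obtain ⟨τ, -, hr⟩ := Finset.mem_biUnion.1 hr
    obtain ⟨h, hh, rfl⟩ := Finset.mem_image.1 hr
    have hh := (Finset.mem_filter.1 hh).1
    have h1 := sum_of_mem_heads hh
    rcases mem_heads_iff.1 hh with ⟨-, h⟩ | ⟨-, h⟩ | ⟨-, h⟩ <;>
    · have := hR _ _ _ h
      omega
  set F : Finset (Σ _ : (Σ _ : ℕ, ℕ), Fin (g + 1) → ℕ) :=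
    (ρ.sigma fun r => tailMins g r A).sigma fun u =>
      Fintype.piFinset fun i : Fin (g + 1) => if i = 0 then rep (n - u.1) else rep (u.1 + u.2)
  have hcard : F.card ≤ K ^ (g + 1) * ∑ r ∈ ρ, (tailMins g r A).card := by
    rw [← Finset.card_sigma, mul_comm, ← smul_eq_mul, Finset.card_sigma]
    refine Finset.sum_le_card_nsmul _ _ _ fun u hu => ?_
    obtain ⟨hu1, hu2⟩ := Finset.mem_sigma.1 hu
    have h1 := hroot _ hu1
    have h2 := Finset.mem_range.1 (Finset.mem_filter.1 hu2).1
    rw [Fintype.card_piFinset]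
    calc _ ≤ ∏ _i : Fin (g + 1), K := by
          refine Finset.prod_le_prod' fun i _ => ?_
          split_ifs
          · exact hrep _ h1.2.2 (by omega)
          · exact hrep _ (by omega) (by omega)
      _ = _ := by simp
  have hρ : ∑ r ∈ ρ, (tailMins g r A).card ≤
      ∑ τ, ∑ r ∈ roots g M lam s n A τ, (tailMins g r A).card := by
    have := sum_biUnion_le (f := fun r => ((tailMins g r A).card : ℝ)) (fun _ => by positivity)
      Finset.univ (roots g M lam s n A)
    exact_mod_cast this
  refine le_trans ?_ (hcard.trans (Nat.mul_le_mul_left _ hρ))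
  rw [← Set.ncard_coe_finset]
  refine Set.ncard_le_ncard_of_injOn (fun x => ⟨⟨x ⟨0, by omega⟩, x ⟨3, by omega⟩⟩,
    fun i => x ⟨2 * i + 2, by omega⟩⟩) ?_ ?_ (Finset.finite_toSet _)
  · rintro x ⟨hx, hxA⟩
    have hA : ∀ i, x i ∈ A := fun i => hxA (by simp [imgF])
    obtain ⟨hsum, τ, hτ⟩ := mem_roots_of_firstThree hs hx.2.1 ⟨hA _, hA _, hA _⟩
    simp only [F, Finset.mem_coe, Finset.mem_sigma, Fintype.mem_piFinset]
    refine ⟨⟨Finset.mem_biUnion.2 ⟨τ, Finset.mem_univ _, hτ⟩, fourth_mem_tailMins hg hx hA⟩,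
      fun i => ?_⟩
    split_ifs with hi
    · subst hi
      refine Finset.mem_filter.2 ⟨Finset.mem_range.2 ?_, hA _, ?_⟩
      · simp only [Fin.val_zero, mul_zero, zero_add]
        omega
      · have : n - x ⟨0, by omega⟩ - x ⟨2, by omega⟩ = x ⟨1, by omega⟩ := by omega
        exact this ▸ hA _
    · have hi' : 0 < (i : ℕ) := Nat.pos_of_ne_zero fun h => hi (Fin.ext h)
      have h1 := hx.2.2.1 (i + 1) (by omega) (by omega)
      refine Finset.mem_filter.2 ⟨Finset.mem_range.2 ?_, hA _, ?_⟩
      · have h1 : _ = x ⟨2 * i + 2, by omega⟩ + _ := h1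
        omega
      · have h2 : x ⟨0, by omega⟩ + x ⟨3, by omega⟩ - x ⟨2 * i + 2, by omega⟩ =
            x ⟨2 * (i + 1) + 1, by omega⟩ := by
          have h1 : _ = x ⟨2 * i + 2, by omega⟩ + _ := h1
          omega
        rw [h2]
        exact hA _
  · rintro x ⟨hx, hxA⟩ y ⟨hy, hyA⟩ heq
    have hsx := (mem_roots_of_firstThree hs hx.2.1 ⟨hxA (by simp [imgF]), hxA (by simp [imgF]),
      hxA (by simp [imgF])⟩).1
    have hsy := (mem_roots_of_firstThree hs hy.2.1 ⟨hyA (by simp [imgF]), hyA (by simp [imgF]),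
      hyA (by simp [imgF])⟩).1
    simp only [Sigma.mk.injEq, heq_eq_eq] at heq
    obtain ⟨⟨h0, h3⟩, hf⟩ := heq
    have hev : ∀ i : ℕ, ∀ hi : i < g + 1, x ⟨2 * i + 2, by omega⟩ = y ⟨2 * i + 2, by omega⟩ :=
      fun i hi => congrFun hf ⟨i, hi⟩
    have h2 := hev 0 (by omega)
    simp only [mul_zero, zero_add] at h2
    funext ⟨k, hk⟩
    by_cases hk4 : k < 4
    · interval_cases k
      · exact h0
      · omega
      · exact h2
      · exact h3
    · obtain ⟨j, rfl | rfl⟩ : ∃ j, k = 2 * (j + 1) + 2 ∨ k = 2 * (j + 2) + 1 :=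
        ⟨k / 2 - 2, by omega⟩
      · exact hev (j + 1) (by omega)
      · have h1 := hx.2.2.1 (j + 2) (by omega) (by omega)
        have h1' := hy.2.2.1 (j + 2) (by omega) (by omega)
        have h4 : x ⟨2 * (j + 2), by omega⟩ = y ⟨2 * (j + 2), by omega⟩ := hev (j + 1) (by omega)
        omega

end

open Classical in
/-- All tails at `r`. -/
def tails (g r : ℕ) : Finset (Finset ℕ) :=
  (Finset.range r).powerset.filter fun t => ∃ a, IsTail g r a t

lemma mem_tails {g r : ℕ} {t : Finset ℕ} : t ∈ tails g r ↔ ∃ a, IsTail g r a t := by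
  classical
  rw [tails, Finset.mem_filter, and_iff_right_iff_imp]
  rintro ⟨a, ha⟩
  exact Finset.mem_powerset.2 fun y hy => Finset.mem_range.2 (ha.lt y hy)

lemma IsTail.weight_eq {p : ℕ → ℝ} {g r a : ℕ} {f : Fin g → ℕ}
    (hf : Function.Injective f) (hfa : ∀ i, a < f i ∧ 2 * f i ≤ r + a) :
    weight p ({a} ∪ (Finset.univ.image f ∪ Finset.univ.image fun i => r + a - f i)) =
      p a * ∏ i, weight p {f i, r + a - f i} := by
  have h1 : Finset.univ.image f ∪ Finset.univ.image (fun i => r + a - f i) =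
      Finset.univ.biUnion fun i => {f i, r + a - f i} := by
    ext y
    simp only [Finset.mem_union, Finset.mem_image, Finset.mem_univ, true_and, Finset.mem_biUnion,
      Finset.mem_insert, Finset.mem_singleton]
    constructor
    · rintro (⟨i, rfl⟩ | ⟨i, rfl⟩) <;> exact ⟨i, by simp⟩
    · rintro ⟨i, rfl | rfl⟩
      · exact .inl ⟨i, rfl⟩
      · exact .inr ⟨i, rfl⟩
  rw [h1, weight_union, weight_biUnion]
  · simp [weight]
  · intro i _ j _ hij
    simp only [Function.onFun]
    have h2 := hfa i
    have h3 := hfa j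
    have h4 : f i ≠ f j := fun h => hij (hf h)
    rw [Finset.disjoint_left]
    intro y hy hy'
    simp only [Finset.mem_insert, Finset.mem_singleton] at hy hy'
    omega
  · rw [Finset.disjoint_singleton_left]
    simp only [Finset.mem_biUnion, Finset.mem_univ, true_and, Finset.mem_insert,
      Finset.mem_singleton, not_exists]
    intro i
    have := hfa i
    omega

open Classical in
lemma sum_tails_le {p : ℕ → ℝ} (hp : ∀ x, 0 ≤ p x) (g r : ℕ) :
    ∑ t ∈ tails g r, weight p t ≤ ∑ a ∈ Finset.range r, p a * pairSum p (r + a) ^ g := by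
  set T : ℕ → (Fin g → ℕ) → Finset ℕ := fun a f =>
    {a} ∪ (Finset.univ.image f ∪ Finset.univ.image fun i => r + a - f i)
  set F : ℕ → Finset (Fin g → ℕ) := fun a =>
    (Fintype.piFinset fun _ => Finset.range ((r + a) / 2 + 1)).filter fun f =>
      Function.Injective f ∧ ∀ i, a < f i ∧ 2 * f i ≤ r + a
  have hw := weight_nonneg hp
  have hsub : tails g r ⊆ (Finset.range r).biUnion fun a => (F a).image (T a) := by
    intro t ht
    obtain ⟨a, har, f, hf, hfa, rfl⟩ := mem_tails.1 ht
    refine Finset.mem_biUnion.2 ⟨a, Finset.mem_range.2 har, Finset.mem_image.2 ⟨f,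
      Finset.mem_filter.2 ⟨?_, hf, hfa⟩, rfl⟩⟩
    rw [Fintype.mem_piFinset]
    intro i
    have := hfa i
    rw [Finset.mem_range]
    omega
  refine (Finset.sum_le_sum_of_subset_of_nonneg hsub fun s _ _ => hw s).trans
    ((sum_biUnion_le hw _ _).trans (Finset.sum_le_sum fun a ha => ?_))
  refine (Finset.sum_image_le_of_nonneg fun s _ => hw s).trans ?_
  calc _ = ∑ f ∈ F a, p a * ∏ i, weight p {f i, r + a - f i} := by
        refine Finset.sum_congr rfl fun f hf => ?_
        obtain ⟨-, h1, h2⟩ := Finset.mem_filter.1 hf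
        exact IsTail.weight_eq h1 h2
    _ ≤ ∑ f ∈ Fintype.piFinset fun _ => Finset.range ((r + a) / 2 + 1),
          p a * ∏ i : Fin g, weight p {f i, r + a - f i} :=
        Finset.sum_le_sum_of_subset_of_nonneg (Finset.filter_subset _ _) fun f _ _ =>
          mul_nonneg (hp a) (Finset.prod_nonneg fun i _ => hw _)
    _ = _ := by
        rw [← Finset.mul_sum, ← Finset.prod_univ_sum (fun _ => Finset.range ((r + a) / 2 + 1))
          fun _ z => weight p {z, r + a - z}]
        simp [pairSum]

open Classical in
/-- Blocks: a head together with a nonempty pairwise disjoint family of tails at its root. -/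
def blocks (g : ℕ) (H : Finset (ℕ × ℕ × ℕ)) : Finset (Σ _ : ℕ × ℕ × ℕ, Finset (Finset ℕ)) :=
  H.sigma fun h => (tails g h.1).powerset.filter fun S : Finset (Finset ℕ) => S.Nonempty ∧
    (S : Set (Finset ℕ)).PairwiseDisjoint id ∧ ∀ t ∈ S, Disjoint t (headSet h)

open Classical in
lemma sum_blocks_le {p : ℕ → ℝ} (hp : ∀ x, 0 ≤ p x) {g : ℕ} {H : Finset (ℕ × ℕ × ℕ)}
    {μR μV θ : ℝ} (hθ : 0 ≤ θ)
    (hne : ∀ h ∈ H, h.1 ≠ h.2.1 ∧ h.1 ≠ h.2.2 ∧ h.2.1 ≠ h.2.2)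
    (hμR : ∑ h ∈ H, p h.1 * p h.2.1 * p h.2.2 ≤ μR) (hμV0 : 0 ≤ μV)
    (hμV : ∀ h ∈ H, ∑ t ∈ tails g h.1, weight p t ≤ μV) :
    ∑ i ∈ blocks g H, θ ^ i.2.card * weight p (block i.1 i.2) ≤
      μR * (Real.exp (θ * μV) - 1) := by
  have hw := weight_nonneg hp
  have hexp : 0 ≤ Real.exp (θ * μV) - 1 := by
    have := Real.one_le_exp (mul_nonneg hθ hμV0)
    linarith
  rw [blocks, Finset.sum_sigma]
  calc _ ≤ ∑ h ∈ H, p h.1 * p h.2.1 * p h.2.2 * (Real.exp (θ * μV) - 1) := by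
        refine Finset.sum_le_sum fun h hh => ?_
        obtain ⟨n1, n2, n3⟩ := hne h hh
        have hπ : 0 ≤ p h.1 * p h.2.1 * p h.2.2 :=
          mul_nonneg (mul_nonneg (hp _) (hp _)) (hp _)
        set f : Finset (Finset ℕ) → ℝ := fun S => ∏ t ∈ S, (θ * weight p t)
        have hf : ∀ S, 0 ≤ f S := fun S => Finset.prod_nonneg fun t _ => mul_nonneg hθ (hw t)
        calc _ = ∑ S ∈ (tails g h.1).powerset.filter (fun S : Finset (Finset ℕ) => S.Nonempty ∧
                (S : Set (Finset ℕ)).PairwiseDisjoint id ∧ ∀ t ∈ S, Disjoint t (headSet h)),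
                p h.1 * p h.2.1 * p h.2.2 * f S := by
              refine Finset.sum_congr rfl fun S hS => ?_
              obtain ⟨-, -, h1, h2⟩ := Finset.mem_filter.1 hS
              simp only [block, f]
              rw [weight_union, weight_headSet h n1 n2 n3, weight_biUnion p h1,
                Finset.prod_mul_distrib, Finset.prod_const]
              · simp only [id]
                ring
              · exact (Finset.disjoint_biUnion_right _ _ _).2 fun t ht => (h2 t ht).symm
          _ ≤ ∑ S ∈ (tails g h.1).powerset.erase ∅, p h.1 * p h.2.1 * p h.2.2 * f S := by
              refine Finset.sum_le_sum_of_subset_of_nonneg (fun S hS => ?_)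
                fun S _ _ => mul_nonneg hπ (hf S)
              obtain ⟨h0, h1, -⟩ := Finset.mem_filter.1 hS
              exact Finset.mem_erase.2 ⟨h1.ne_empty, h0⟩
          _ = p h.1 * p h.2.1 * p h.2.2 * (∏ t ∈ tails g h.1, (1 + θ * weight p t) - 1) := by
              rw [← Finset.mul_sum, Finset.prod_one_add, eq_sub_of_add_eq
                (Finset.sum_erase_add (tails g h.1).powerset f (Finset.empty_mem_powerset _))]
              simp [f]
          _ ≤ _ := by
              gcongr
              calc _ ≤ ∏ t ∈ tails g h.1, Real.exp (θ * weight p t) :=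
                    Finset.prod_le_prod (fun t _ => by have := hw t; positivity) fun t _ => by
                      have := Real.add_one_le_exp (θ * weight p t)
                      linarith
                _ = Real.exp (θ * ∑ t ∈ tails g h.1, weight p t) := by
                    rw [← Real.exp_sum, Finset.mul_sum]
                _ ≤ _ := by
                    gcongr
                    exact hμV h hh
    _ ≤ _ := by
        rw [← Finset.sum_mul]
        gcongr

open Classical in
lemma exists_maximal_disjoint (V : Finset (Finset ℕ)) (hV : ∀ t ∈ V, t.Nonempty) :
    ∃ S ⊆ V, (S : Set (Finset ℕ)).PairwiseDisjoint id ∧ ∀ t ∈ V, ∃ t' ∈ S, ¬ Disjoint t t' := by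
  obtain ⟨S, hS, hmax⟩ := Finset.exists_max_image
    (V.powerset.filter fun S : Finset (Finset ℕ) => (S : Set (Finset ℕ)).PairwiseDisjoint id)
    Finset.card ⟨∅, by simp⟩
  obtain ⟨h1, h2⟩ := Finset.mem_filter.1 hS
  refine ⟨S, Finset.mem_powerset.1 h1, h2, fun t ht => ?_⟩
  by_contra! hcon
  have htS : t ∉ S := fun h => (hV t ht).ne_empty (disjoint_self.1 (hcon t h))
  have := hmax (insert t S) (Finset.mem_filter.2 ⟨?_, ?_⟩)
  · rw [Finset.card_insert_of_notMem htS] at this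
    omega
  · exact Finset.mem_powerset.2 (Finset.insert_subset ht (Finset.mem_powerset.1 h1))
  · rw [Finset.coe_insert]
    exact (Set.pairwiseDisjoint_insert_of_notMem (by simpa using htS)).2 ⟨h2, fun j hj => hcon j hj⟩

open Classical in
lemma sum_tailMins_le {g D K K' L L' k B w : ℕ} (hg : 0 < g) {H : Finset (ℕ × ℕ × ℕ)} {A : Set ℕ}
    (hpart : ∀ h ∈ H, ∀ h' ∈ H, h'.1 ≠ h.2.1 ∧ h'.1 ≠ h.2.2) (h0 : 0 ∉ A)
    (hfam : ∀ h ∈ H, ∀ S ⊆ tails g h.1, (S : Set (Finset ℕ)).PairwiseDisjoint id →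
      (∀ t ∈ S, (t : Set ℕ) ⊆ A) → S.card ≤ L)
    (hK' : ∀ h ∈ H, ∀ d, 0 < d → d < h.1 →
      ((Finset.range h.1).filter fun a => a ∈ A ∧ a + d ∈ A ∧ D ≤ a + d).card ≤ K')
    (hL' : ∀ h ∈ H, ∀ d, 0 < d → d < h.1 →
      ((Finset.range h.1).filter fun a => a ∈ A ∧ a + d ∈ A).card ≤ L')
    (hK : ∀ h ∈ H, ((Finset.range h.1).filter fun z => h.1 < z + D ∧ z ∈ A).card ≤ K)
    (hI : ¬ ∃ J ⊆ blocks g H,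
      (J : Set (Σ _ : ℕ × ℕ × ℕ, Finset (Finset ℕ))).PairwiseDisjoint (fun i => block i.1 i.2) ∧
      (∀ j ∈ J, (block j.1 j.2 : Set ℕ) ⊆ A) ∧ (k : ℝ) ≤ ∑ j ∈ J, (j.2.card : ℝ))
    (hII : ¬ ∃ J ⊆ blocks g H,
      (J : Set (Σ _ : ℕ × ℕ × ℕ, Finset (Finset ℕ))).PairwiseDisjoint (fun i => block i.1 i.2) ∧
      (∀ j ∈ J, (block j.1 j.2 : Set ℕ) ⊆ A) ∧ (J.biUnion fun i => block i.1 i.2).card + 6 * B ≤ w ∧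
      ∃ l : List (Finset ℕ), l.length = B ∧ BadChain (IsBad D H) (J.biUnion fun i => block i.1 i.2) l ∧
        ∀ σ ∈ l, (σ : Set ℕ) ⊆ A)
    (hw : (2 * g + 4) * k + 6 * B ≤ w) :
    ∑ r ∈ (H.filter fun h => (headSet h : Set ℕ) ⊆ A).image Prod.fst, (tailMins g r A).card ≤
      (2 * g + 1) * (1 + K') * k + B * ((2 * g + 1) * L * (1 + K') + K * (1 + L')) := by
  set ρ0 := (H.filter fun h => (headSet h : Set ℕ) ⊆ A).image Prod.fst
  set ρ := ρ0.filter fun r => (tailMins g r A).Nonempty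
  have hex : ∀ r, ∃ bc : ℕ × ℕ, r ∈ ρ → (r, bc) ∈ H ∧ (headSet (r, bc) : Set ℕ) ⊆ A := by
    intro r
    by_cases hr : r ∈ ρ
    · obtain ⟨⟨r', bc⟩, hh, rfl⟩ := Finset.mem_image.1 (Finset.mem_filter.1 hr).1
      exact ⟨bc, fun _ => Finset.mem_filter.1 hh⟩
    · exact ⟨0, fun h => absurd h hr⟩
  choose bc hbc using hex
  have hSex : ∀ r, ∃ S ⊆ (tails g r).filter (fun t : Finset ℕ => (t : Set ℕ) ⊆ A),
      (S : Set (Finset ℕ)).PairwiseDisjoint id ∧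
      ∀ t ∈ (tails g r).filter (fun t : Finset ℕ => (t : Set ℕ) ⊆ A), ∃ t' ∈ S, ¬ Disjoint t t' := by
    intro r
    refine exists_maximal_disjoint _ fun t ht => ?_
    obtain ⟨a, ha⟩ := mem_tails.1 (Finset.mem_filter.1 ht).1
    exact ⟨a, ha.self_mem⟩
  choose S hSsub hSd hSmax using hSex
  have hS1 : ∀ r, ∀ t ∈ S r, (t : Set ℕ) ⊆ A ∧ ∃ a, IsTail g r a t := fun r t ht =>
    ⟨(Finset.mem_filter.1 (hSsub r ht)).2, mem_tails.1 (Finset.mem_filter.1 (hSsub r ht)).1⟩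
  have hS2 : ∀ r, ∀ (t : Finset ℕ) (a : ℕ), (t : Set ℕ) ⊆ A → IsTail g r a t →
      ∃ t' ∈ S r, ¬ Disjoint t t' := fun r t a h1 h2 =>
    hSmax r t (Finset.mem_filter.2 ⟨mem_tails.2 ⟨a, h2⟩, h1⟩)
  have hS3 : ∀ r ∈ ρ, (S r).Nonempty := by
    intro r hr
    obtain ⟨a, ha⟩ := (Finset.mem_filter.1 hr).2
    obtain ⟨-, t, h1, h2⟩ := Finset.mem_filter.1 ha
    obtain ⟨t', ht', -⟩ := hS2 r t a h1 h2
    exact ⟨t', ht'⟩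
  obtain ⟨Gd, hGd, hdis, hgood, l, hlen, hchain, hlA, -⟩ := exists_greedy (D := D) hg
    (fun r => (bc r).1) (fun r => (bc r).2) S hpart ρ (fun r hr => hbc r hr) fun r _ => hS1 r
  set toBlock : ℕ → Σ _ : ℕ × ℕ × ℕ, Finset (Finset ℕ) := fun r => ⟨(r, bc r), S r⟩
  have hinj : Function.Injective toBlock := fun r r' h => by
    have := congrArg (fun i => i.1.1) h
    exact this
  set J := Gd.image toBlock
  have hJsub : J ⊆ blocks g H := by
    intro j hj
    obtain ⟨r, hr, rfl⟩ := Finset.mem_image.1 hj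
    exact Finset.mem_sigma.2 ⟨(hbc r (hGd hr)).1, Finset.mem_filter.2 ⟨Finset.mem_powerset.2
      ((hSsub r).trans (Finset.filter_subset _ _)), hS3 r (hGd hr), hSd r, (hgood r hr).2⟩⟩
  have hJd : (J : Set (Σ _ : ℕ × ℕ × ℕ, Finset (Finset ℕ))).PairwiseDisjoint
      (fun i => block i.1 i.2) := by
    rintro _ hj _ hj' hne
    obtain ⟨r, hr, rfl⟩ := Finset.mem_image.1 hj
    obtain ⟨r', hr', rfl⟩ := Finset.mem_image.1 hj'
    exact hdis hr hr' fun h => hne (h ▸ rfl)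
  have hJA : ∀ j ∈ J, (block j.1 j.2 : Set ℕ) ⊆ A := by
    intro j hj
    obtain ⟨r, hr, rfl⟩ := Finset.mem_image.1 hj
    simp only [block, Finset.coe_union, Finset.coe_biUnion, toBlock]
    refine Set.union_subset (hbc r (hGd hr)).2 (Set.iUnion₂_subset fun t ht => (hS1 r t ht).1)
  have hsumS : ∑ r ∈ Gd, (S r).card < k := by
    by_contra! h
    refine hI ⟨J, hJsub, hJd, hJA, ?_⟩
    rw [Finset.sum_image fun _ _ _ _ h => hinj h]
    exact_mod_cast h
  have hJU : (J.biUnion fun i => block i.1 i.2) = Gd.biUnion fun r => block (r, bc r) (S r) :=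
    Finset.image_biUnion
  have hcardU : (J.biUnion fun i => block i.1 i.2).card ≤ (2 * g + 4) * k := by
    rw [hJU]
    calc _ ≤ ∑ r ∈ Gd, (2 * g + 4) * (S r).card := by
          refine Finset.card_biUnion_le.trans (Finset.sum_le_sum fun r hr => ?_)
          have h1 : (block (r, bc r) (S r)).card ≤ _ := Finset.card_union_le _ _
          have h2 := headSet_card_le (r, bc r)
          have h3 : ((S r).biUnion id).card ≤ (S r).card * (2 * g + 1) :=
            Finset.card_biUnion_le_card_mul _ _ _ fun t ht => by
              obtain ⟨-, a, ha⟩ := hS1 r t ht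
              exact ha.card_le
          have h4 := (hS3 r (hGd hr)).card_pos
          nlinarith
      _ ≤ _ := by
          rw [← Finset.mul_sum]
          gcongr
  have hBd : (ρ \ Gd).card < B := by
    by_contra! h
    refine hII ⟨J, hJsub, hJd, hJA, by omega, l.take B, ?_, ?_, fun σ hσ =>
      hlA σ (List.mem_of_mem_take hσ)⟩
    · rw [List.length_take, hlen]
      exact min_eq_left h
    · rw [hJU]
      exact hchain.take B
  have hHr : ∀ r ∈ ρ, (r, bc r) ∈ H := fun r hr => (hbc r hr).1
  have hbound : ∀ r ∈ ρ, (tailMins g r A).card ≤ (2 * g + 1) * (S r).card * (1 + K') +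
      ((Finset.range r).filter fun z => r < z + D ∧ z ∈ A).card * (1 + L') := fun r hr =>
    card_tailMins_le (S r) (hS1 r) (hS2 r) (hK' _ (hHr r hr)) (hL' _ (hHr r hr)) h0
  have e1 : ∑ r ∈ ρ0, (tailMins g r A).card = ∑ r ∈ ρ, (tailMins g r A).card := by
    refine (Finset.sum_subset (Finset.filter_subset _ _) fun r h1 h2 => ?_).symm
    rw [Finset.card_eq_zero, ← Finset.not_nonempty_iff_eq_empty]
    exact fun h => h2 (Finset.mem_filter.2 ⟨h1, h⟩)
  rw [e1, ← Finset.sum_sdiff hGd, add_comm]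
  refine add_le_add ?_ ?_
  · calc _ ≤ ∑ r ∈ Gd, (2 * g + 1) * (1 + K') * (S r).card := by
          refine Finset.sum_le_sum fun r hr => (hbound r (hGd hr)).trans ?_
          have : (Finset.range r).filter (fun z => r < z + D ∧ z ∈ A) = ∅ := by
            rw [Finset.filter_eq_empty_iff]
            rintro z hz ⟨h1, h2⟩
            have := (hgood r hr).1 z h2 (Finset.mem_range.1 hz)
            omega
          rw [this, Finset.card_empty, zero_mul, add_zero]
          exact le_of_eq (by ring)
      _ ≤ _ := by
          rw [← Finset.mul_sum]
          gcongr
  · calc _ ≤ (ρ \ Gd).card • ((2 * g + 1) * L * (1 + K') + K * (1 + L')) := by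
          refine Finset.sum_le_card_nsmul _ _ _ fun r hr => ?_
          have hr := (Finset.mem_sdiff.1 hr).1
          refine (hbound r hr).trans ?_
          have h1 : (S r).card ≤ L := hfam _ (hHr r hr) (S r)
            ((hSsub r).trans (Finset.filter_subset _ _)) (hSd r) fun t ht => (hS1 r t ht).1
          have h2 := hK _ (hHr r hr)
          gcongr
      _ ≤ _ := by
          rw [smul_eq_mul]
          gcongr

/-- The density function `lam⁻¹ x ^ (-α)` of the random set. -/
def dens (g : ℕ) (lam : ℝ) (x : ℕ) : ℝ := lam⁻¹ * (x : ℝ) ^ (-alph g)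

/-- The exponent `2α - 1 = 1 / (2g + 1)`. -/
def eta (g : ℕ) : ℝ := (2 * (g : ℝ) + 1)⁻¹

lemma eta_pos (g : ℕ) : 0 < eta g := by
  unfold eta
  positivity

lemma alph_eq (g : ℕ) : alph g = (1 + eta g) / 2 := by
  unfold alph eta
  field_simp
  ring

lemma mul_eta (g : ℕ) : g * eta g = (1 - eta g) / 2 := by
  unfold eta
  field_simp
  ring

lemma one_sub_alph (g : ℕ) : 1 - alph g = g * eta g := by
  rw [mul_eta, alph_eq]
  ring

lemma eta_le {g : ℕ} (hg : 2 ≤ g) : eta g ≤ 1 / 5 := by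
  have : (2 : ℝ) ≤ g := by exact_mod_cast hg
  unfold eta
  rw [inv_le_comm₀ (by positivity) (by norm_num)]
  linarith

lemma alph_pos (g : ℕ) : 0 < alph g := by
  rw [alph_eq]
  linarith [eta_pos g]

lemma half_lt_alph (g : ℕ) : 1 / 2 < alph g := by
  rw [alph_eq]
  linarith [eta_pos g]

lemma alph_le {g : ℕ} (hg : 2 ≤ g) : alph g ≤ 3 / 5 := by
  rw [alph_eq]
  linarith [eta_le hg]

section

variable {g : ℕ} {lam : ℝ}

lemma dens_zero : dens g lam 0 = 0 := by
  have := (alph_pos g).ne'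
  simp [dens, Real.zero_rpow (neg_ne_zero.2 this)]

lemma dens_nonneg (hl : 0 ≤ lam) (x : ℕ) : 0 ≤ dens g lam x := by
  unfold dens
  positivity

lemma dens_le_of_le (hl : 0 ≤ lam) {y : ℝ} (hy : 0 < y) {x : ℕ} (hyx : y ≤ x) :
    dens g lam x ≤ lam⁻¹ * y ^ (-alph g) :=
  mul_le_mul_of_nonneg_left (Real.rpow_le_rpow_of_nonpos hy hyx (by linarith [alph_pos g]))
    (inv_nonneg.2 hl)

lemma dens_le_rpow (hl : 1 ≤ lam) (x : ℕ) : dens g lam x ≤ (x : ℝ) ^ (-alph g) :=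
  mul_le_of_le_one_left (by positivity) (inv_le_one_of_one_le₀ hl)

lemma dens_le_one (hl : 1 ≤ lam) (x : ℕ) : dens g lam x ≤ 1 := by
  rcases Nat.eq_zero_or_pos x with rfl | hx
  · rw [dens_zero]
    exact zero_le_one
  · refine (dens_le_rpow hl x).trans (Real.rpow_le_one_of_one_le_of_nonpos (by exact_mod_cast hx) ?_)
    linarith [alph_pos g]

lemma sum_rpow_neg_le {a : ℝ} (ha : 0 < a) (ha1 : a < 1) (N : ℕ) :
    ∑ x ∈ Finset.range (N + 1), (x : ℝ) ^ (-a) ≤ (N : ℝ) ^ (1 - a) / (1 - a) := by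
  have h1a : 0 < 1 - a := by linarith
  induction N with
  | zero =>
    simp [Real.zero_rpow (neg_ne_zero.2 ha.ne'), Real.zero_rpow h1a.ne']
  | succ N ih =>
    rw [Finset.sum_range_succ]
    have hN : (0 : ℝ) < (N : ℝ) + 1 := by positivity
    have hb := rpow_one_add_le_one_add_mul_self (s := -((N : ℝ) + 1)⁻¹) (p := 1 - a)
      (by
        have : ((N : ℝ) + 1)⁻¹ ≤ 1 := inv_le_one_of_one_le₀ (by linarith [N.cast_nonneg (α := ℝ)])
        linarith) h1a.le (by linarith)
    have h2 : 1 + -((N : ℝ) + 1)⁻¹ = N / (N + 1) := by field_simp; ring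
    rw [h2, Real.div_rpow N.cast_nonneg hN.le, div_le_iff₀ (by positivity)] at hb
    have h3 : ((N : ℝ) + 1) ^ (-a) = ((N : ℝ) + 1) ^ (1 - a) * ((N : ℝ) + 1)⁻¹ := by
      rw [← Real.rpow_neg_one, ← Real.rpow_add hN]
      congr 1
      ring
    push_cast
    rw [h3]
    rw [le_div_iff₀ h1a] at ih ⊢
    nlinarith

lemma sum_dens_le (hg : 2 ≤ g) (hl : 0 ≤ lam) (N : ℕ) :
    ∑ x ∈ Finset.range (N + 1), dens g lam x ≤ 3 * lam⁻¹ * (N : ℝ) ^ (g * eta g) := by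
  have h1 := alph_le hg
  unfold dens
  rw [← Finset.mul_sum, ← one_sub_alph, mul_comm 3, mul_assoc]
  refine mul_le_mul_of_nonneg_left ?_ (inv_nonneg.2 hl)
  refine (sum_rpow_neg_le (alph_pos g) (by linarith) N).trans ?_
  rw [div_le_iff₀ (by linarith)]
  have := Real.rpow_nonneg (N.cast_nonneg (α := ℝ)) (1 - alph g)
  nlinarith

lemma half_rpow_le (hg : 2 ≤ g) {y : ℝ} (hy : 0 ≤ y) :
    (y / 2) ^ (-alph g) ≤ 2 * y ^ (-alph g) := by
  rw [Real.div_rpow hy zero_le_two, div_eq_mul_inv, mul_comm, ← Real.rpow_neg zero_le_two, neg_neg]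
  refine mul_le_mul_of_nonneg_right ?_ (by positivity)
  calc (2 : ℝ) ^ alph g ≤ 2 ^ (1 : ℝ) :=
        Real.rpow_le_rpow_of_exponent_le one_le_two (by linarith [alph_le hg])
    _ = 2 := Real.rpow_one 2

lemma pairSum_dens_le (hg : 2 ≤ g) (hl : 1 ≤ lam) {m : ℕ} (hm : 0 < m)
    (hlm : lam ≤ (m : ℝ) ^ (g * eta g)) :
    pairSum (dens g lam) m ≤ 8 * (lam⁻¹) ^ 2 * (m : ℝ) ^ (-eta g) := by
  have hl0 : 0 < lam := by linarith
  have hm0 : (0 : ℝ) < m := by exact_mod_cast hm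
  set c := lam⁻¹ * (2 * (m : ℝ) ^ (-alph g))
  have hc0 : 0 ≤ c := by positivity
  have hd := fun x => dens_nonneg (g := g) hl0.le x
  have key : ∀ x : ℕ, m ≤ 2 * x → dens g lam x ≤ c := fun x hx => by
    refine (dens_le_of_le hl0.le (half_pos hm0) ?_).trans
      (mul_le_mul_of_nonneg_left (half_rpow_le hg hm0.le) (inv_nonneg.2 hl0.le))
    rw [div_le_iff₀ two_pos, mul_comm]
    exact_mod_cast hx
  have hterm : ∀ z ∈ Finset.range (m / 2 + 1), weight (dens g lam) {z, m - z} ≤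
      c * dens g lam z + if z = m / 2 then c else 0 := by
    intro z hz
    have hz := Finset.mem_range.1 hz
    by_cases h : 2 * z = m
    · have e : m - z = z := by omega
      rw [e, Finset.pair_eq_singleton, if_pos (by omega)]
      simp only [weight, Finset.prod_singleton]
      have := key z (by omega)
      have := mul_nonneg hc0 (hd z)
      linarith
    · have e : z ≠ m - z := by omega
      simp only [weight, Finset.prod_pair e]
      have h1 := mul_le_mul_of_nonneg_left (key (m - z) (by omega)) (hd z)
      have h2 : (0 : ℝ) ≤ if z = m / 2 then c else 0 := by split_ifs <;> simp [hc0]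
      linarith
  have hsum : pairSum (dens g lam) m ≤
      c * ∑ z ∈ Finset.range (m / 2 + 1), dens g lam z + c := by
    refine (Finset.sum_le_sum hterm).trans ?_
    rw [Finset.sum_add_distrib, ← Finset.mul_sum, Finset.sum_ite_eq']
    simp
  have h1 := sum_dens_le hg hl0.le (m / 2)
  have h2 : ((m / 2 : ℕ) : ℝ) ^ (g * eta g) ≤ (m : ℝ) ^ (g * eta g) := by
    have := eta_pos g
    refine Real.rpow_le_rpow (by positivity) ?_ (by positivity)
    exact_mod_cast Nat.div_le_self m 2
  have h3 : (m : ℝ) ^ (-alph g) * (m : ℝ) ^ (g * eta g) = (m : ℝ) ^ (-eta g) := by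
    rw [← Real.rpow_add hm0, mul_eta, alph_eq]
    congr 1
    ring
  have h4 : 1 ≤ lam⁻¹ * (m : ℝ) ^ (g * eta g) := by
    rw [inv_mul_eq_div, one_le_div hl0]
    exact hlm
  calc _ ≤ c * (3 * lam⁻¹ * (m : ℝ) ^ (g * eta g)) + c * (lam⁻¹ * (m : ℝ) ^ (g * eta g)) := by
        refine hsum.trans (add_le_add (mul_le_mul_of_nonneg_left (h1.trans ?_) hc0)
          (le_mul_of_one_le_right hc0 h4))
        gcongr
    _ = 8 * (lam⁻¹) ^ 2 * ((m : ℝ) ^ (-alph g) * (m : ℝ) ^ (g * eta g)) := by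
        simp only [c]
        ring
    _ = _ := by rw [h3]

lemma sum_tails_dens_le (hg : 2 ≤ g) (hl : 1 ≤ lam) {r : ℕ} (hr : 0 < r)
    (hlr : lam ≤ (r : ℝ) ^ (g * eta g)) :
    ∑ t ∈ tails g r, weight (dens g lam) t ≤ 3 * 8 ^ g * (lam⁻¹) ^ (2 * g + 1) := by
  have hl0 : 0 < lam := by linarith
  have hr0 : (0 : ℝ) < r := by exact_mod_cast hr
  have heta := eta_pos g
  have hd := fun x => dens_nonneg (g := g) hl0.le x
  refine (sum_tails_le hd g r).trans ?_
  have h1 : ∀ a ∈ Finset.range r, dens g lam a * pairSum (dens g lam) (r + a) ^ g ≤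
      dens g lam a * (8 * (lam⁻¹) ^ 2 * (r : ℝ) ^ (-eta g)) ^ g := by
    intro a _
    have hra : (r : ℝ) ≤ ((r + a : ℕ) : ℝ) := by exact_mod_cast Nat.le_add_right r a
    refine mul_le_mul_of_nonneg_left (pow_le_pow_left₀ (Finset.sum_nonneg fun z _ =>
      weight_nonneg hd _) ?_ g) (hd a)
    refine (pairSum_dens_le hg hl (by omega)
      (hlr.trans (Real.rpow_le_rpow hr0.le hra (by positivity)))).trans ?_
    refine mul_le_mul_of_nonneg_left ?_ (by positivity)
    exact Real.rpow_le_rpow_of_nonpos hr0 hra (by linarith)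
  refine (Finset.sum_le_sum h1).trans ?_
  rw [← Finset.sum_mul]
  have h2 : ∑ a ∈ Finset.range r, dens g lam a ≤ 3 * lam⁻¹ * (r : ℝ) ^ (g * eta g) :=
    (Finset.sum_le_sum_of_subset_of_nonneg (Finset.range_subset_range.2 r.le_succ)
      fun a _ _ => hd a).trans (sum_dens_le hg hl0.le r)
  have h3 : (r : ℝ) ^ (g * eta g) * ((r : ℝ) ^ (-eta g)) ^ g = 1 := by
    rw [← Real.rpow_natCast, ← Real.rpow_mul hr0.le, ← Real.rpow_add hr0]
    rw [show (g : ℝ) * eta g + -eta g * g = 0 by ring, Real.rpow_zero]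
  calc _ ≤ 3 * lam⁻¹ * (r : ℝ) ^ (g * eta g) * (8 * (lam⁻¹) ^ 2 * (r : ℝ) ^ (-eta g)) ^ g := by
        gcongr
    _ = 3 * 8 ^ g * (lam⁻¹) ^ (2 * g + 1) *
          ((r : ℝ) ^ (g * eta g) * ((r : ℝ) ^ (-eta g)) ^ g) := by
        rw [mul_pow, mul_pow, ← pow_mul]
        ring
    _ = _ := by rw [h3, mul_one]

lemma sum_dens_diff_le (g : ℕ) : ∃ C : ℝ, 0 < C ∧ ∀ lam : ℝ, 1 ≤ lam →
    ∀ (D : ℕ) (d : ℕ) (s : Finset ℕ), 0 < D → (∀ a ∈ s, D ≤ a + d) →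
      ∑ a ∈ s, dens g lam a * dens g lam (a + d) ≤ C * (D : ℝ) ^ (-(eta g / 2)) := by
  have heta := eta_pos g
  have hsum : Summable fun a : ℕ => (a : ℝ) ^ (-(1 + eta g / 2)) :=
    Real.summable_nat_rpow.2 (by linarith)
  refine ⟨∑' a : ℕ, (a : ℝ) ^ (-(1 + eta g / 2)) + 1, ?_, fun lam hl D d s hD hs => ?_⟩
  · have : 0 ≤ ∑' a : ℕ, (a : ℝ) ^ (-(1 + eta g / 2)) := tsum_nonneg fun a => by positivity
    linarith
  have hD0 : (0 : ℝ) < D := by exact_mod_cast hD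
  have hterm : ∀ a ∈ s, dens g lam a * dens g lam (a + d) ≤
      (a : ℝ) ^ (-(1 + eta g / 2)) * (D : ℝ) ^ (-(eta g / 2)) := by
    intro a ha
    rcases Nat.eq_zero_or_pos a with rfl | ha0
    · rw [dens_zero, zero_mul]
      positivity
    have ha1 : (0 : ℝ) < a := by exact_mod_cast ha0
    have hl0 : 0 ≤ lam := by linarith
    have h1 : ((a + d : ℕ) : ℝ) ^ (-alph g) ≤
        (a : ℝ) ^ (-(1 / 2 : ℝ)) * (D : ℝ) ^ (-(eta g / 2)) := by
      have hpos : (0 : ℝ) < ((a + d : ℕ) : ℝ) := by exact_mod_cast (by omega : 0 < a + d)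
      rw [show -alph g = -(1 / 2 : ℝ) + -(eta g / 2) by rw [alph_eq]; ring, Real.rpow_add hpos]
      refine mul_le_mul (Real.rpow_le_rpow_of_nonpos ha1 (by exact_mod_cast Nat.le_add_right a d)
        (by norm_num)) (Real.rpow_le_rpow_of_nonpos hD0 (by exact_mod_cast hs a ha) (by linarith))
        (by positivity) (by positivity)
    calc _ ≤ (a : ℝ) ^ (-alph g) * ((a : ℝ) ^ (-(1 / 2 : ℝ)) * (D : ℝ) ^ (-(eta g / 2))) :=
          mul_le_mul (dens_le_rpow hl a) ((dens_le_rpow hl _).trans h1) (dens_nonneg hl0 _)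
            (by positivity)
      _ = _ := by
          rw [← mul_assoc, ← Real.rpow_add ha1]
          congr 2
          rw [alph_eq]
          ring
  refine (Finset.sum_le_sum hterm).trans ?_
  rw [← Finset.sum_mul]
  refine mul_le_mul_of_nonneg_right ?_ (by positivity)
  have := hsum.sum_le_tsum s fun a _ => by positivity
  linarith

lemma sum_dens_close_le (hg : 2 ≤ g) (hl : 1 ≤ lam) {r D : ℕ} (hr : 0 < r) (hrD : 2 * D ≤ r) :
    ∑ z ∈ Finset.range r with r < z + D, dens g lam z ≤ 2 * D * (r : ℝ) ^ (-alph g) := by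
  have hr0 : (0 : ℝ) < r := by exact_mod_cast hr
  have h1 : ∀ z ∈ (Finset.range r).filter (fun z => r < z + D),
      dens g lam z ≤ 2 * (r : ℝ) ^ (-alph g) := by
    intro z hz
    obtain ⟨-, h2⟩ := Finset.mem_filter.1 hz
    refine (dens_le_of_le (by linarith) (half_pos hr0) ?_).trans ((mul_le_of_le_one_left
      (by positivity) (inv_le_one_of_one_le₀ hl)).trans (half_rpow_le hg hr0.le))
    rw [div_le_iff₀ two_pos]
    exact_mod_cast (by omega : r ≤ z * 2)
  have h2 : ((Finset.range r).filter (fun z => r < z + D)).card ≤ D := by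
    have : (Finset.range r).filter (fun z => r < z + D) ⊆ Finset.Ico (r - D) r := fun z hz => by
      obtain ⟨h2, h3⟩ := Finset.mem_filter.1 hz
      have := Finset.mem_range.1 h2
      exact Finset.mem_Ico.2 ⟨by omega, by omega⟩
    refine (Finset.card_le_card this).trans ?_
    rw [Nat.card_Ico]
    omega
  refine (Finset.sum_le_card_nsmul _ _ _ h1).trans ?_
  rw [nsmul_eq_mul]
  have h3 : (((Finset.range r).filter (fun z => r < z + D)).card : ℝ) ≤ D := by exact_mod_cast h2
  calc _ ≤ (D : ℝ) * (2 * (r : ℝ) ^ (-alph g)) := by gcongr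
    _ = _ := by ring

end

lemma sum_le_sum_of_maps_of_injOn {ι κ : Type*} {F : Finset ι} {S : Finset κ} {u : ι → ℝ}
    {v : κ → ℝ} {φ : ι → κ} (hv : ∀ k, 0 ≤ v k) (hmaps : ∀ i ∈ F, φ i ∈ S)
    (hinj : Set.InjOn φ F) (hle : ∀ i ∈ F, u i ≤ v (φ i)) : ∑ i ∈ F, u i ≤ ∑ k ∈ S, v k := by
  classical
  calc ∑ i ∈ F, u i ≤ ∑ i ∈ F, v (φ i) := Finset.sum_le_sum hle
    _ = ∑ k ∈ F.image φ, v k := (Finset.sum_image hinj).symm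
    _ ≤ _ := Finset.sum_le_sum_of_subset_of_nonneg (Finset.image_subset_iff.2 hmaps)
        fun k _ _ => hv k

section

variable {g M : ℕ} {lam : ℝ} {s : ℕ → Fin 3 → ZMod M} {n : ℕ}

lemma glam_rpow (hg : 2 ≤ g) (hl : 0 ≤ lam) (hn : 1 ≤ n) :
    glam g lam n ^ (g * eta g) = lam ^ (2 * g + 5) * (n : ℝ) ^ eta g * Real.log n := by
  have hn0 : (0 : ℝ) ≤ n := n.cast_nonneg
  have hlog : 0 ≤ Real.log n := Real.log_nonneg (by exact_mod_cast hn)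
  have hg0 : (g : ℝ) ≠ 0 := by
    have : g ≠ 0 := by omega
    exact_mod_cast this
  have hge : (g : ℝ) * eta g ≠ 0 := mul_ne_zero hg0 (eta_pos g).ne'
  rw [glam, one_sub_alph, Real.mul_rpow (by positivity) (by positivity),
    Real.mul_rpow (by positivity) (by positivity), ← Real.rpow_mul hl, ← Real.rpow_mul hn0,
    ← Real.rpow_mul hlog, div_mul_cancel₀ _ hge, div_mul_cancel₀ _ hge, Real.rpow_one,
    ← mul_assoc, one_div, inv_mul_cancel₀ hg0, one_mul]
  congr 2
  rw [← Real.rpow_natCast]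
  push_cast
  rfl

lemma sum_dens_floor_glam_le (hg : 2 ≤ g) (hl : 1 ≤ lam) (hn : 1 ≤ n) :
    ∑ x ∈ Finset.range (⌊glam g lam n⌋₊ + 1), dens g lam x ≤
      3 * lam ^ (2 * g + 4) * (n : ℝ) ^ eta g * Real.log n := by
  have hl0 : 0 < lam := by linarith
  have hlog : 0 ≤ Real.log n := Real.log_nonneg (by exact_mod_cast hn)
  have heta := eta_pos g
  have hG : 0 ≤ glam g lam n := by
    unfold glam
    positivity
  refine (sum_dens_le hg hl0.le _).trans ?_
  calc _ ≤ 3 * lam⁻¹ * glam g lam n ^ (g * eta g) := by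
        gcongr
        exact Nat.floor_le hG
    _ = _ := by
        rw [glam_rpow hg hl0.le hn, pow_succ lam (2 * g + 4)]
        field_simp

lemma dens_le_of_quarter_le (hg : 2 ≤ g) (hl : 1 ≤ lam) (hn : 1 ≤ n) {y : ℕ}
    (hy : (n : ℝ) / 4 ≤ y) : dens g lam y ≤ 4 * lam⁻¹ * (n : ℝ) ^ (-alph g) := by
  have hn0 : (0 : ℝ) < n := by exact_mod_cast hn
  have hl0 : 0 < lam := by linarith
  have e : (n : ℝ) / 4 = n / 2 / 2 := by ring
  refine (dens_le_of_le hl0.le (by positivity) hy).trans ?_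
  rw [mul_comm 4, mul_assoc, e]
  refine mul_le_mul_of_nonneg_left ?_ (by positivity)
  have h1 := half_rpow_le hg (y := (n : ℝ) / 2) (by positivity)
  have h2 := half_rpow_le hg hn0.le
  linarith

lemma rtrip_le_floor {x y z : ℕ} (h : Rtrip g M lam s n x y z) : x ≤ ⌊glam g lam n⌋₊ :=
  Nat.le_floor h.2.2.2.2.2.1

lemma dens_snd_le (hg : 2 ≤ g) (hl : 1 ≤ lam) (hn : 1 ≤ n) {x y z : ℕ}
    (h : Rtrip g M lam s n x y z) : dens g lam y ≤ 4 * lam⁻¹ * (n : ℝ) ^ (-alph g) :=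
  dens_le_of_quarter_le hg hl hn h.2.2.2.2.2.2.1

lemma dens_trd_le (hg : 2 ≤ g) (hl : 1 ≤ lam) (hn : 1 ≤ n) {x y z : ℕ}
    (h : Rtrip g M lam s n x y z) : dens g lam z ≤ 4 * lam⁻¹ * (n : ℝ) ^ (-alph g) :=
  dens_le_of_quarter_le hg hl hn h.2.2.2.2.2.2.2.2.1

lemma rpow_neg_alph_sq (hn : 1 ≤ n) : (n : ℝ) ^ (-alph g) * (n : ℝ) ^ (-alph g) =
    (n : ℝ) ^ (-(1 + eta g)) := by
  have hn0 : (0 : ℝ) < n := by exact_mod_cast hn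
  rw [← Real.rpow_add hn0, alph_eq]
  congr 1
  ring

lemma n_mul_rpow (hn : 1 ≤ n) : (n : ℝ) * (n : ℝ) ^ (-(1 + eta g)) = (n : ℝ) ^ (-eta g) := by
  have hn0 : (0 : ℝ) < n := by exact_mod_cast hn
  rw [neg_add, Real.rpow_add hn0, Real.rpow_neg_one, ← mul_assoc, mul_inv_cancel₀ hn0.ne', one_mul]

lemma heads_weight_le (hg : 2 ≤ g) (hl : 1 ≤ lam) (hn : 1 ≤ n) {τ : Fin 3} {h : ℕ × ℕ × ℕ}
    (hh : h ∈ heads g M lam s n τ) :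
    dens g lam h.1 * dens g lam h.2.1 * dens g lam h.2.2 ≤ 16 * (n : ℝ) ^ (-(1 + eta g)) := by
  have hl0 : 0 < lam := by linarith
  have hd := fun x => dens_nonneg (g := g) hl0.le x
  have hd1 := fun x => dens_le_one (g := g) hl x
  have aux : ∀ x y z : ℕ, Rtrip g M lam s n x y z →
      dens g lam x * (dens g lam y * dens g lam z) ≤ 16 * (n : ℝ) ^ (-(1 + eta g)) := by
    intro x y z hR
    have hc : 4 * lam⁻¹ * (n : ℝ) ^ (-alph g) ≤ 4 * (n : ℝ) ^ (-alph g) := by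
      refine mul_le_mul_of_nonneg_right ?_ (by positivity)
      have := inv_le_one_of_one_le₀ hl
      linarith
    refine (mul_le_of_le_one_left (mul_nonneg (hd y) (hd z)) (hd1 x)).trans ?_
    refine (mul_le_mul ((dens_snd_le hg hl hn hR).trans hc) ((dens_trd_le hg hl hn hR).trans hc)
      (hd z) (by positivity)).trans (le_of_eq ?_)
    rw [← rpow_neg_alph_sq hn]
    ring
  rcases mem_heads_iff.1 hh with ⟨-, hR⟩ | ⟨-, hR⟩ | ⟨-, hR⟩
  · exact le_trans (le_of_eq (by ring)) (aux _ _ _ hR)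
  · exact le_trans (le_of_eq (by ring)) (aux _ _ _ hR)
  · exact le_trans (le_of_eq (by ring)) (aux _ _ _ hR)

lemma sum_heads_le (hg : 2 ≤ g) (hl : 1 ≤ lam) (hn : 1 ≤ n) (τ : Fin 3) :
    ∑ h ∈ heads g M lam s n τ, dens g lam h.1 * dens g lam h.2.1 * dens g lam h.2.2 ≤
      96 * lam ^ (2 * g + 2) * Real.log n := by
  have hl0 : 0 < lam := by linarith
  have hd := fun x => dens_nonneg (g := g) hl0.le x
  set c := 4 * lam⁻¹ * (n : ℝ) ^ (-alph g)
  have hc : 0 ≤ c := by positivity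
  have hn1 : (1 : ℝ) ≤ n := by exact_mod_cast hn
  have hlog : 0 ≤ Real.log n := Real.log_nonneg hn1
  set X := ⌊glam g lam n⌋₊
  set φ : ℕ × ℕ × ℕ → ℕ × ℕ := fun h => (if τ = 0 then h.1 else h.2.1, h.2.2)
  have aux : ∀ x y z : ℕ, Rtrip g M lam s n x y z →
      dens g lam x * (dens g lam y * dens g lam z) ≤ dens g lam x * (c * c) := by
    intro x y z hR
    exact mul_le_mul_of_nonneg_left (mul_le_mul (dens_snd_le hg hl hn hR) (dens_trd_le hg hl hn hR)
      (hd z) hc) (hd x)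
  have key : ∑ h ∈ heads g M lam s n τ, dens g lam h.1 * dens g lam h.2.1 * dens g lam h.2.2 ≤
      ∑ k ∈ Finset.range (X + 1) ×ˢ Finset.range (n + 1), dens g lam k.1 * (c * c) := by
    refine sum_le_sum_of_maps_of_injOn (φ := φ) (fun k => mul_nonneg (hd _) (mul_nonneg hc hc))
      (fun h hh => ?_) (fun h hh h' hh' heq => ?_) fun h hh => ?_
    · have hsum := sum_of_mem_heads hh
      simp only [Finset.mem_product, Finset.mem_range, φ]
      rcases mem_heads_iff.1 hh with ⟨rfl, hR⟩ | ⟨rfl, hR⟩ | ⟨rfl, hR⟩ <;>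
      · have := rtrip_le_floor hR
        refine ⟨?_, by omega⟩
        simp only [reduceIte, Fin.reduceEq, one_ne_zero]
        omega
    · have hsum := sum_of_mem_heads hh
      have hsum' := sum_of_mem_heads hh'
      simp only [φ, Prod.mk.injEq] at heq
      obtain ⟨h1, h2⟩ := heq
      split_ifs at h1 <;> ext <;> omega
    · rcases mem_heads_iff.1 hh with ⟨rfl, hR⟩ | ⟨rfl, hR⟩ | ⟨rfl, hR⟩
      · exact le_trans (le_of_eq (by ring))
          ((aux _ _ _ hR).trans (le_of_eq (by simp [φ])))
      · exact le_trans (le_of_eq (by ring))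
          ((aux _ _ _ hR).trans (le_of_eq (by simp [φ])))
      · exact le_trans (le_of_eq (by ring))
          ((aux _ _ _ hR).trans (le_of_eq (by simp [φ])))
  refine key.trans ?_
  rw [Finset.sum_product]
  simp only [Finset.sum_const, Finset.card_range, nsmul_eq_mul]
  rw [← Finset.mul_sum, ← Finset.sum_mul]
  have h1 := sum_dens_floor_glam_le hg hl hn
  have h2 : (((n + 1 : ℕ)) : ℝ) ≤ 2 * n := by
    push_cast
    linarith
  have hr : (n : ℝ) * ((n : ℝ) ^ (-alph g) * (n : ℝ) ^ (-alph g)) * (n : ℝ) ^ eta g = 1 := by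
    rw [rpow_neg_alph_sq hn, n_mul_rpow hn, ← Real.rpow_add (by linarith)]
    simp
  have h3 : 0 ≤ ∑ i ∈ Finset.range (X + 1), dens g lam i := Finset.sum_nonneg fun x _ => hd x
  calc _ ≤ 2 * (n : ℝ) * (3 * lam ^ (2 * g + 4) * (n : ℝ) ^ eta g * Real.log n * (c * c)) := by
        gcongr
    _ = 96 * lam ^ (2 * g + 2) * Real.log n *
          ((n : ℝ) * ((n : ℝ) ^ (-alph g) * (n : ℝ) ^ (-alph g)) * (n : ℝ) ^ eta g) := by
        simp only [c]
        rw [show 2 * g + 4 = 2 * g + 2 + 2 by ring, pow_add lam (2 * g + 2) 2]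
        field_simp
        ring
    _ = _ := by rw [hr, mul_one]

/-- The bound for the sums over heads with one entry fixed. -/
def headErr (g : ℕ) (lam : ℝ) (n : ℕ) : ℝ :=
  32 * (n : ℝ) ^ (-eta g) + 12 * lam ^ (2 * g + 4) * ((n : ℝ) ^ (-(g * eta g)) * Real.log n)

lemma sum_small_large_le (hg : 2 ≤ g) (hl : 1 ≤ lam) (hn : 1 ≤ n) {F : Finset (ℕ × ℕ × ℕ)}
    {u : ℕ × ℕ × ℕ → ℝ} {φ : ℕ × ℕ × ℕ → ℕ} (hinj : Set.InjOn φ F)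
    (h : ∀ h ∈ F, φ h ≤ ⌊glam g lam n⌋₊ ∧
      u h ≤ dens g lam (φ h) * (4 * lam⁻¹ * (n : ℝ) ^ (-alph g))) :
    ∑ h ∈ F, u h ≤ headErr g lam n := by
  have hl0 : 0 < lam := by linarith
  have hn0 : (0 : ℝ) < n := by exact_mod_cast hn
  have hlog : 0 ≤ Real.log n := Real.log_nonneg (by exact_mod_cast hn)
  have hr : (n : ℝ) ^ eta g * (n : ℝ) ^ (-alph g) = (n : ℝ) ^ (-(g * eta g)) := by
    rw [← Real.rpow_add hn0, mul_eta, alph_eq]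
    congr 1
    ring
  refine (sum_le_sum_of_maps_of_injOn (S := Finset.range (⌊glam g lam n⌋₊ + 1))
    (v := fun x => dens g lam x * (4 * lam⁻¹ * (n : ℝ) ^ (-alph g)))
    (fun k => mul_nonneg (dens_nonneg hl0.le k) (by positivity))
    (fun i hi => Finset.mem_range.2 (Nat.lt_succ_of_le (h i hi).1)) hinj
    fun i hi => (h i hi).2).trans ?_
  rw [← Finset.sum_mul]
  have h1 := sum_dens_floor_glam_le hg hl hn
  have hl1 := inv_le_one_of_one_le₀ hl
  calc _ ≤ 3 * lam ^ (2 * g + 4) * (n : ℝ) ^ eta g * Real.log n *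
          (4 * 1 * (n : ℝ) ^ (-alph g)) := by gcongr
    _ = 12 * lam ^ (2 * g + 4) * ((n : ℝ) ^ eta g * (n : ℝ) ^ (-alph g) * Real.log n) := by ring
    _ ≤ _ := by
        rw [hr, headErr]
        have : 0 ≤ 32 * (n : ℝ) ^ (-eta g) := by positivity
        linarith

lemma sum_large_large_le (hl : 1 ≤ lam) (hn : 1 ≤ n) {F : Finset (ℕ × ℕ × ℕ)}
    {u : ℕ × ℕ × ℕ → ℝ} {φ : ℕ × ℕ × ℕ → ℕ} (hinj : Set.InjOn φ F)
    (h : ∀ h ∈ F, φ h ≤ n ∧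
      u h ≤ (4 * lam⁻¹ * (n : ℝ) ^ (-alph g)) * (4 * lam⁻¹ * (n : ℝ) ^ (-alph g))) :
    ∑ h ∈ F, u h ≤ headErr g lam n := by
  have hl0 : 0 < lam := by linarith
  have hn1 : (1 : ℝ) ≤ n := by exact_mod_cast hn
  have hlog : 0 ≤ Real.log n := Real.log_nonneg hn1
  refine (sum_le_sum_of_maps_of_injOn (S := Finset.range (n + 1))
    (v := fun _ => (4 * lam⁻¹ * (n : ℝ) ^ (-alph g)) * (4 * lam⁻¹ * (n : ℝ) ^ (-alph g)))
    (fun k => by positivity)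
    (fun i hi => Finset.mem_range.2 (Nat.lt_succ_of_le (h i hi).1)) hinj
    fun i hi => (h i hi).2).trans ?_
  rw [Finset.sum_const, Finset.card_range, nsmul_eq_mul]
  have h2 : (((n + 1 : ℕ)) : ℝ) ≤ 2 * n := by
    push_cast
    linarith
  have hl1 := inv_le_one_of_one_le₀ hl
  calc _ ≤ 2 * (n : ℝ) * ((4 * 1 * (n : ℝ) ^ (-alph g)) * (4 * 1 * (n : ℝ) ^ (-alph g))) := by
        gcongr
    _ = 32 * ((n : ℝ) * ((n : ℝ) ^ (-alph g) * (n : ℝ) ^ (-alph g))) := by ring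
    _ ≤ _ := by
        rw [rpow_neg_alph_sq hn, n_mul_rpow hn, headErr]
        have : 0 ≤ 12 * lam ^ (2 * g + 4) * ((n : ℝ) ^ (-(g * eta g)) * Real.log n) := by positivity
        linarith

lemma sum_heads_snd_le (hg : 2 ≤ g) (hl : 1 ≤ lam) (hn : 1 ≤ n) (τ : Fin 3) (w : ℕ) :
    ∑ h ∈ heads g M lam s n τ with h.2.1 = w, dens g lam h.1 * dens g lam h.2.2 ≤
      headErr g lam n := by
  have hl0 : 0 < lam := by linarith
  have hd := fun x => dens_nonneg (g := g) hl0.le x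
  have hinj : Set.InjOn Prod.fst (((heads g M lam s n τ).filter fun h => h.2.1 = w : Finset _) :
      Set (ℕ × ℕ × ℕ)) := by
    intro h hh h' hh' heq
    obtain ⟨h1, h2⟩ := Finset.mem_filter.1 hh
    obtain ⟨h1', h2'⟩ := Finset.mem_filter.1 hh'
    have hsum := sum_of_mem_heads h1
    have hsum' := sum_of_mem_heads h1'
    ext <;> omega
  by_cases hτ : τ = 0
  · refine sum_small_large_le hg hl hn hinj fun h hh => ?_
    rcases mem_heads_iff.1 (Finset.mem_filter.1 hh).1 with ⟨-, hR⟩ | ⟨h0, hR⟩ | ⟨h0, hR⟩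
    · exact ⟨rtrip_le_floor hR, mul_le_mul_of_nonneg_left (dens_trd_le hg hl hn hR) (hd _)⟩
    all_goals simp [h0] at hτ
  · refine sum_large_large_le hl hn hinj fun h hh => ?_
    have hsum := sum_of_mem_heads (Finset.mem_filter.1 hh).1
    refine ⟨by omega, ?_⟩
    rcases mem_heads_iff.1 (Finset.mem_filter.1 hh).1 with ⟨h0, hR⟩ | ⟨-, hR⟩ | ⟨-, hR⟩
    · exact absurd h0 hτ
    · exact mul_le_mul (dens_snd_le hg hl hn hR) (dens_trd_le hg hl hn hR) (hd _) (by positivity)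
    · exact mul_le_mul (dens_trd_le hg hl hn hR) (dens_snd_le hg hl hn hR) (hd _) (by positivity)

lemma sum_heads_trd_le (hg : 2 ≤ g) (hl : 1 ≤ lam) (hn : 1 ≤ n) (τ : Fin 3) (w : ℕ) :
    ∑ h ∈ heads g M lam s n τ with h.2.2 = w, dens g lam h.1 * dens g lam h.2.1 ≤
      headErr g lam n := by
  have hl0 : 0 < lam := by linarith
  have hd := fun x => dens_nonneg (g := g) hl0.le x
  refine sum_small_large_le hg hl hn (φ := fun h => if τ = 0 then h.1 else h.2.1) ?_ fun h hh => ?_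
  · intro h hh h' hh' heq
    obtain ⟨h1, h2⟩ := Finset.mem_filter.1 hh
    obtain ⟨h1', h2'⟩ := Finset.mem_filter.1 hh'
    have hsum := sum_of_mem_heads h1
    have hsum' := sum_of_mem_heads h1'
    simp only at heq
    split_ifs at heq <;> ext <;> omega
  · rcases mem_heads_iff.1 (Finset.mem_filter.1 hh).1 with ⟨rfl, hR⟩ | ⟨rfl, hR⟩ | ⟨rfl, hR⟩
    · exact ⟨rtrip_le_floor hR, mul_le_mul_of_nonneg_left (dens_snd_le hg hl hn hR) (hd _)⟩
    · simp only [reduceIte, one_ne_zero]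
      rw [mul_comm (dens g lam h.1)]
      exact ⟨rtrip_le_floor hR, mul_le_mul_of_nonneg_left (dens_snd_le hg hl hn hR) (hd _)⟩
    · simp only [reduceIte, Fin.reduceEq]
      rw [mul_comm (dens g lam h.1)]
      exact ⟨rtrip_le_floor hR, mul_le_mul_of_nonneg_left (dens_trd_le hg hl hn hR) (hd _)⟩

end

/-- `A` contains the members of a pairwise disjoint subfamily of size `K` of the family `e` on
`I`. -/
def Crowd {ι : Type*} (A : Set ℕ) (I : Finset ι) (e : ι → Finset ℕ) (K : ℕ) : Prop :=
  ∃ J : Finset ι, J ⊆ I ∧ (J : Set ι).PairwiseDisjoint e ∧ (∀ j ∈ J, (e j : Set ℕ) ⊆ A) ∧ K ≤ J.card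

lemma card_filter_lt_of_not_crowd {ι : Type*} {A : Set ℕ} {I : Finset ι} {e : ι → Finset ℕ} {K : ℕ}
    (he : (I : Set ι).PairwiseDisjoint e) (h : ¬ Crowd A I e K) {J : Finset ι} (hJ : J ⊆ I)
    (hJA : ∀ j ∈ J, (e j : Set ℕ) ⊆ A) : J.card < K := by
  by_contra! hcon
  exact h ⟨J, hJ, he.subset (by exact_mod_cast hJ), hJA, hcon⟩

open Classical in
lemma card_rep_le {A : Set ℕ} {m K : ℕ}
    (h : ¬ Crowd A (Finset.range (m / 2 + 1)) (fun z => {z, m - z}) K) :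
    ((Finset.range (m + 1)).filter fun z => z ∈ A ∧ m - z ∈ A).card ≤ 2 * K := by
  set J := (Finset.range (m / 2 + 1)).filter fun z => z ∈ A ∧ m - z ∈ A
  have hJ : J.card < K := by
    refine card_filter_lt_of_not_crowd (fun x hx y hy hxy => ?_) h (Finset.filter_subset _ _)
      fun j hj => ?_
    · have hx := Finset.mem_range.1 (Finset.mem_coe.1 hx)
      have hy := Finset.mem_range.1 (Finset.mem_coe.1 hy)
      simp only [Function.onFun, Finset.disjoint_left, Finset.mem_insert, Finset.mem_singleton]
      intro z hz hz'
      omega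
    · obtain ⟨-, h1, h2⟩ := Finset.mem_filter.1 hj
      simp [Set.insert_subset_iff, h1, h2]
  have hsub : (Finset.range (m + 1)).filter (fun z => z ∈ A ∧ m - z ∈ A) ⊆
      J ∪ J.image fun z => m - z := by
    intro z hz
    obtain ⟨h0, h1, h2⟩ := Finset.mem_filter.1 hz
    have h0 := Finset.mem_range.1 h0
    by_cases hzm : z < m / 2 + 1
    · exact Finset.mem_union_left _ (Finset.mem_filter.2 ⟨Finset.mem_range.2 hzm, h1, h2⟩)
    · refine Finset.mem_union_right _ (Finset.mem_image.2 ⟨m - z, Finset.mem_filter.2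
        ⟨Finset.mem_range.2 (by omega), h2, ?_⟩, by omega⟩)
      rwa [show m - (m - z) = z by omega]
  have h1 := Finset.card_le_card hsub
  have h2 := Finset.card_union_le J (J.image fun z => m - z)
  have h3 : (J.image fun z => m - z).card ≤ J.card := Finset.card_image_le
  omega

/-- The starting points `a ≤ n` of differences `d` with `a + d ≥ D`, in a fixed parity class. -/
def diffStarts (n D d j : ℕ) : Finset ℕ :=
  (Finset.range (n + 1)).filter fun a => D ≤ a + d ∧ a / d % 2 = j

open Classical in
lemma card_diff_le {A : Set ℕ} {n r D d K : ℕ} (hd : 0 < d) (hr : r ≤ n)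
    (h : ∀ j < 2, ¬ Crowd A (diffStarts n D d j) (fun a => {a, a + d}) K) :
    ((Finset.range r).filter fun a => a ∈ A ∧ a + d ∈ A ∧ D ≤ a + d).card ≤ 2 * K := by
  have hJ : ∀ j < 2, ((diffStarts n D d j).filter fun a => a ∈ A ∧ a + d ∈ A).card < K := by
    intro j hj
    refine card_filter_lt_of_not_crowd (fun x hx y hy hxy => ?_) (h j hj)
      (Finset.filter_subset _ _) fun a ha => ?_
    · obtain ⟨-, -, hx⟩ := Finset.mem_filter.1 (Finset.mem_coe.1 hx)
      obtain ⟨-, -, hy⟩ := Finset.mem_filter.1 (Finset.mem_coe.1 hy)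
      simp only [Function.onFun, Finset.disjoint_left, Finset.mem_insert, Finset.mem_singleton]
      have e1 := Nat.add_div_right x hd
      have e2 := Nat.add_div_right y hd
      have hx' : x ≠ y + d := by
        rintro rfl
        omega
      have hy' : y ≠ x + d := by
        rintro rfl
        omega
      intro z hz hz'
      omega
    · obtain ⟨-, h1, h2⟩ := Finset.mem_filter.1 ha
      simp [Set.insert_subset_iff, h1, h2]
  have hsub : (Finset.range r).filter (fun a => a ∈ A ∧ a + d ∈ A ∧ D ≤ a + d) ⊆
      (diffStarts n D d 0).filter (fun a => a ∈ A ∧ a + d ∈ A) ∪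
        (diffStarts n D d 1).filter fun a => a ∈ A ∧ a + d ∈ A := by
    intro a ha
    obtain ⟨h0, h1, h2, h3⟩ := Finset.mem_filter.1 ha
    have h0 := Finset.mem_range.1 h0
    simp only [diffStarts, Finset.mem_union, Finset.mem_filter, Finset.mem_range]
    rcases Nat.mod_two_eq_zero_or_one (a / d) with h4 | h4
    · exact .inl ⟨⟨by omega, h3, h4⟩, h1, h2⟩
    · exact .inr ⟨⟨by omega, h3, h4⟩, h1, h2⟩
  have h1 := (Finset.card_le_card hsub).trans (Finset.card_union_le _ _)
  have h2 := hJ 0 (by norm_num)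
  have h3 := hJ 1 (by norm_num)
  omega

open Classical in
lemma card_close_le {A : Set ℕ} {r D K : ℕ}
    (h : ¬ Crowd A ((Finset.range r).filter fun z => r < z + D) (fun z => {z}) K) :
    ((Finset.range r).filter fun z => r < z + D ∧ z ∈ A).card ≤ K := by
  refine (card_filter_lt_of_not_crowd (fun x _ y _ hxy => ?_) h (fun z hz => ?_)
    fun z hz => ?_).le
  · simpa [Function.onFun] using hxy
  · obtain ⟨h1, h2, -⟩ := Finset.mem_filter.1 hz
    exact Finset.mem_filter.2 ⟨h1, h2⟩
  · simpa using (Finset.mem_filter.1 hz).2.2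

lemma prob_crowd {Ω : Type*} [MeasurableSpace Ω] {P : Measure Ω} [IsProbabilityMeasure P]
    {A : Ω → Set ℕ} {p : ℕ → ℝ} (hp : ∀ x, 0 ≤ p x)
    (hP : ∀ F : Finset ℕ, P.real {ω | (F : Set ℕ) ⊆ A ω} ≤ weight p F) {ι : Type*}
    (I : Finset ι) (e : ι → Finset ℕ) {K : ℕ} {s ε : ℝ} (hs : 0 ≤ s)
    (hε : ∑ i ∈ I, weight p (e i) ≤ ε) :
    P.real {ω | Crowd (A ω) I e K} ≤ Real.exp (-(s * K) + Real.exp s * ε) := by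
  have h1 := prob_disjoint_family hp hP I e (fun _ => 1) s K hs
  simp only [Finset.sum_const, nsmul_eq_mul, mul_one, Nat.cast_le, ← Finset.mul_sum] at h1
  refine h1.trans (Real.exp_le_exp.2 ?_)
  gcongr

lemma prob_exists_le {Ω : Type*} [MeasurableSpace Ω] {P : Measure Ω} {ι : Type*} (I : Finset ι) {E : ι → Ω → Prop} {b : ℝ}
    (h : ∀ i ∈ I, P.real {ω | E i ω} ≤ b) : P.real {ω | ∃ i ∈ I, E i ω} ≤ I.card * b := by
  have e : {ω | ∃ i ∈ I, E i ω} = ⋃ i ∈ I, {ω | E i ω} := by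
    ext ω
    simp
  rw [e, ← nsmul_eq_mul]
  exact (measureReal_biUnion_finset_le I _).trans (Finset.sum_le_card_nsmul _ _ _ h)

open Filter in
lemma eventually_rpow_mul_log_pow_le (C : ℝ) (k : ℕ) {e e' : ℝ} (h : e' < e) :
    ∀ᶠ n : ℕ in atTop, C * ((n : ℝ) ^ (-e) * Real.log n ^ k) ≤ (n : ℝ) ^ (-e') := by
  have hlit := (isLittleO_log_rpow_rpow_atTop (k : ℝ) (sub_pos.2 h)).comp_tendsto
    (tendsto_natCast_atTop_atTop (R := ℝ))
  have h1 := hlit.bound (c := (|C| + 1)⁻¹) (by positivity)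
  filter_upwards [h1, eventually_ge_atTop 1] with n hn hn1
  have hn0 : (0 : ℝ) < n := by exact_mod_cast hn1
  have hlog : 0 ≤ Real.log n := Real.log_nonneg (by exact_mod_cast hn1)
  simp only [Function.comp_apply, Real.rpow_natCast, norm_pow, Real.norm_of_nonneg hlog,
    Real.norm_of_nonneg (Real.rpow_nonneg hn0.le (e - e'))] at hn
  rw [inv_mul_eq_div, le_div_iff₀ (by positivity)] at hn
  have h2 : Real.log n ^ k * C ≤ Real.log n ^ k * (|C| + 1) := by
    gcongr
    linarith [le_abs_self C]
  calc C * ((n : ℝ) ^ (-e) * Real.log n ^ k) = (n : ℝ) ^ (-e) * (Real.log n ^ k * C) := by ring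
    _ ≤ (n : ℝ) ^ (-e) * (n : ℝ) ^ (e - e') := by
        gcongr
        exact h2.trans hn
    _ = (n : ℝ) ^ (-e') := by
        rw [← Real.rpow_add hn0]
        congr 1
        ring

open Filter in
lemma eventually_rpow_le (C : ℝ) {e e' : ℝ} (h : e' < e) :
    ∀ᶠ n : ℕ in atTop, C * (n : ℝ) ^ (-e) ≤ (n : ℝ) ^ (-e') := by
  simpa using eventually_rpow_mul_log_pow_le C 0 h

/-- The closeness scale `n ^ (η / 8)`. -/
def closeScale (g n : ℕ) : ℕ := ⌈(n : ℝ) ^ (eta g / 8)⌉₊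

/-- A lower bound for the entries of triples of `R_n`. -/
def entryFloor (g n : ℕ) : ℕ := ⌈(n : ℝ) ^ (1 / (g : ℝ))⌉₊

/-- The generic small quantity `n ^ (-η² / 32)`. -/
def smallErr (g n : ℕ) : ℝ := (n : ℝ) ^ (-(eta g ^ 2 / 32))

/-- The estimates on sums of `dens` which hold for large `n`. -/
structure DensBounds (g : ℕ) (lam : ℝ) (n : ℕ) : Prop where
  two_le_log : 2 ≤ Real.log n
  closeScale_pos : 0 < closeScale g n
  two_mul_closeScale_le : 2 * closeScale g n ≤ entryFloor g n
  entryFloor_le_glam : (entryFloor g n : ℝ) ≤ glam g lam n / 2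
  entryFloor_le_quarter : (entryFloor g n : ℝ) ≤ n / 4
  pair : ∀ m, entryFloor g n ≤ m → pairSum (dens g lam) m ≤ smallErr g n
  tails : ∀ r, entryFloor g n ≤ r →
    ∑ t ∈ tails g r, weight (dens g lam) t ≤ 3 * 8 ^ g * (lam⁻¹) ^ (2 * g + 1)
  diff : ∀ (d : ℕ) (s : Finset ℕ), (∀ a ∈ s, closeScale g n ≤ a + d) →
    ∑ a ∈ s, dens g lam a * dens g lam (a + d) ≤ smallErr g n
  close : ∀ r, entryFloor g n ≤ r →
    ∑ z ∈ Finset.range r with r < z + closeScale g n, dens g lam z ≤ smallErr g n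
  big : ∀ z, closeScale g n ≤ z → dens g lam z ≤ smallErr g n
  headErr_le : headErr g lam n ≤ smallErr g n

lemma le_closeScale (g n : ℕ) : (n : ℝ) ^ (eta g / 8) ≤ closeScale g n := Nat.le_ceil _

lemma le_entryFloor (g n : ℕ) : (n : ℝ) ^ (1 / (g : ℝ)) ≤ entryFloor g n := Nat.le_ceil _

lemma closeScale_le {n : ℕ} (g : ℕ) (hn : 1 ≤ n) :
    (closeScale g n : ℝ) ≤ 2 * (n : ℝ) ^ (eta g / 8) := by
  have h1 : (1 : ℝ) ≤ (n : ℝ) ^ (eta g / 8) :=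
    Real.one_le_rpow (by exact_mod_cast hn) (by linarith [eta_pos g])
  have := (Nat.ceil_lt_add_one (zero_le_one.trans h1)).le
  unfold closeScale
  linarith

lemma entryFloor_le {n : ℕ} (g : ℕ) (hn : 1 ≤ n) :
    (entryFloor g n : ℝ) ≤ 2 * (n : ℝ) ^ (1 / (g : ℝ)) := by
  have h1 : (1 : ℝ) ≤ (n : ℝ) ^ (1 / (g : ℝ)) :=
    Real.one_le_rpow (by exact_mod_cast hn) (by positivity)
  have := (Nat.ceil_lt_add_one (zero_le_one.trans h1)).le
  unfold entryFloor
  linarith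

open Filter in
lemma eventually_densBounds {g : ℕ} (hg : 2 ≤ g) {lam : ℝ} (hl : 1 ≤ lam) :
    ∀ᶠ n : ℕ in atTop, DensBounds g lam n := by
  have heta := eta_pos g
  have heta5 := eta_le hg
  have hg2 : (2 : ℝ) ≤ g := by exact_mod_cast hg
  have hg0 : (0 : ℝ) < g := by linarith
  have hge := mul_eta g
  have hinv : eta g < 1 / (g : ℝ) := by
    rw [lt_div_iff₀ hg0, mul_comm, hge]
    linarith
  have hinv2 : 1 / (g : ℝ) ≤ 1 / 2 := one_div_le_one_div_of_le two_pos hg2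
  have hsq : eta g ^ 2 / 32 < eta g ^ 2 / 16 := by
    have : 0 < eta g ^ 2 := by positivity
    linarith
  have hsq' : eta g ^ 2 / 16 ≤ eta g / 80 := by nlinarith
  have hl0 : 0 < lam := by linarith
  obtain ⟨C, hC, hdiff⟩ := sum_dens_diff_le g
  have hlogt : Tendsto (fun n : ℕ => Real.log n) atTop atTop :=
    Real.tendsto_log_atTop.comp tendsto_natCast_atTop_atTop
  have e1 := eventually_rpow_le 8 (e := 1 / (g : ℝ) * eta g) (e' := eta g ^ 2 / 32) (by nlinarith)
  have e2 := eventually_rpow_le C (e := eta g ^ 2 / 16) hsq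
  have e3 := eventually_rpow_le 4 (e := 1 / (g : ℝ) * (1 / 2) - eta g / 8)
    (e' := eta g ^ 2 / 32) (by linarith)
  have e4 := eventually_rpow_le 64 (e := eta g) (e' := eta g ^ 2 / 32) (by linarith)
  have e5 := eventually_rpow_mul_log_pow_le (24 * lam ^ (2 * g + 4)) 1 (e := g * eta g)
    (e' := eta g ^ 2 / 32) (by rw [hge]; linarith)
  have e6 := eventually_rpow_le 4 (e := 0) (e' := -(1 / (g : ℝ) - eta g / 8)) (by linarith)
  have e7 := eventually_rpow_le 8 (e := -(1 / (g : ℝ))) (e' := -1) (by linarith)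
  have e8 := eventually_rpow_le lam (e := 0) (e' := -(1 / (g : ℝ) * (g * eta g)))
    (neg_neg_of_pos (by positivity))
  filter_upwards [hlogt.eventually_ge_atTop 4, eventually_ge_atTop 1, e1, e2, e3, e4, e5, e6, e7,
    e8] with n hlog hn1 e1 e2 e3 e4 e5 e6 e7 e8
  have hn0 : (0 : ℝ) < n := by exact_mod_cast hn1
  have hn1' : (1 : ℝ) ≤ n := by exact_mod_cast hn1
  have hD := closeScale_le g hn1
  have hD' := le_closeScale g n
  have hR := entryFloor_le g hn1
  have hR' := le_entryFloor g n
  have hDpos : (0 : ℝ) < closeScale g n := lt_of_lt_of_le (by positivity) hD'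
  have hRpos : (0 : ℝ) < entryFloor g n := lt_of_lt_of_le (by positivity) hR'
  have hDnat : 0 < closeScale g n := by exact_mod_cast hDpos
  have hRnat : 0 < entryFloor g n := by exact_mod_cast hRpos
  have hDe : ∀ a : ℝ, 0 ≤ a → (closeScale g n : ℝ) ^ (-a) ≤ (n : ℝ) ^ (-(eta g / 8 * a)) := by
    intro a ha
    refine (Real.rpow_le_rpow_of_nonpos (by positivity) hD' (by linarith)).trans (le_of_eq ?_)
    rw [← Real.rpow_mul hn0.le]
    congr 1
    ring
  have hRe : ∀ (r : ℕ) (a : ℝ), entryFloor g n ≤ r → 0 ≤ a →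
      (r : ℝ) ^ (-a) ≤ (n : ℝ) ^ (-(1 / (g : ℝ) * a)) := by
    intro r a hr ha
    refine (Real.rpow_le_rpow_of_nonpos (by positivity)
      (hR'.trans (by exact_mod_cast hr)) (by linarith)).trans (le_of_eq ?_)
    rw [← Real.rpow_mul hn0.le]
    congr 1
    ring
  have hlr : ∀ r : ℕ, entryFloor g n ≤ r → lam ≤ (r : ℝ) ^ (g * eta g) := by
    intro r hr
    rw [neg_zero, Real.rpow_zero, mul_one, neg_neg, Real.rpow_mul hn0.le] at e8
    refine e8.trans (Real.rpow_le_rpow (by positivity) (hR'.trans (by exact_mod_cast hr))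
      (by positivity))
  have h2D : 2 * closeScale g n ≤ entryFloor g n := by
    rw [neg_zero, Real.rpow_zero, mul_one, neg_neg] at e6
    have : (2 * closeScale g n : ℝ) ≤ entryFloor g n := by
      calc (2 * closeScale g n : ℝ) ≤ 4 * (n : ℝ) ^ (eta g / 8) := by linarith
        _ ≤ (n : ℝ) ^ (1 / (g : ℝ) - eta g / 8) * (n : ℝ) ^ (eta g / 8) := by gcongr
        _ = (n : ℝ) ^ (1 / (g : ℝ)) := by
            rw [← Real.rpow_add hn0]
            congr 1
            ring
        _ ≤ _ := hR'
    exact_mod_cast this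
  refine ⟨by linarith, hDnat, h2D, ?_, ?_, fun m hm => ?_, fun r hr => ?_, fun d s hs => ?_,
    fun r hr => ?_, fun z hz => ?_, ?_⟩
  · have ha : 0 < 1 - alph g := by linarith [alph_le hg]
    have h1 : 1 ≤ lam ^ ((2 * (g : ℝ) + 5) / (1 - alph g)) :=
      Real.one_le_rpow hl (by positivity)
    have h2 : 4 ≤ Real.log n ^ ((1 : ℝ) / (1 - alph g)) := by
      refine hlog.trans (Real.self_le_rpow_of_one_le (by linarith) ?_)
      rw [le_div_iff₀ ha]
      linarith [alph_pos g]
    have h3 : (1 : ℝ) * (n : ℝ) ^ ((1 : ℝ) / (g : ℝ)) * 4 ≤ glam g lam n := by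
      unfold glam
      gcongr
    linarith
  · rw [neg_neg, neg_neg, Real.rpow_one] at e7
    linarith
  · refine (pairSum_dens_le hg hl (hRnat.trans_le hm) (hlr m hm)).trans (le_trans ?_ e1)
    have h1 := hRe m (eta g) hm heta.le
    have hl1 := inv_le_one_of_one_le₀ hl
    calc _ ≤ 8 * 1 ^ 2 * (n : ℝ) ^ (-(1 / (g : ℝ) * eta g)) := by gcongr
      _ = _ := by ring
  · exact sum_tails_dens_le hg hl (hRnat.trans_le hr) (hlr r hr)
  · refine (hdiff lam hl _ d s hDnat hs).trans (le_trans ?_ e2)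
    have h1 := hDe (eta g / 2) (by linarith)
    rw [show eta g / 8 * (eta g / 2) = eta g ^ 2 / 16 by ring] at h1
    gcongr
  · refine (sum_dens_close_le hg hl (hRnat.trans_le hr) ?_).trans (le_trans ?_ e3)
    · exact h2D.trans hr
    · have hr1 : (1 : ℝ) ≤ r := by exact_mod_cast hRnat.trans_le hr
      have h1 : (r : ℝ) ^ (-alph g) ≤ (n : ℝ) ^ (-(1 / (g : ℝ) * (1 / 2))) :=
        (Real.rpow_le_rpow_of_exponent_le hr1 (by linarith [half_lt_alph g])).trans
          (hRe r (1 / 2) hr (by norm_num))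
      calc _ ≤ 2 * (2 * (n : ℝ) ^ (eta g / 8)) * (n : ℝ) ^ (-(1 / (g : ℝ) * (1 / 2))) := by gcongr
        _ = 4 * ((n : ℝ) ^ (eta g / 8) * (n : ℝ) ^ (-(1 / (g : ℝ) * (1 / 2)))) := by ring
        _ = _ := by
            rw [← Real.rpow_add hn0]
            congr 2
            ring
  · refine (dens_le_rpow hl z).trans ?_
    have hz' : (closeScale g n : ℝ) ≤ z := by exact_mod_cast hz
    refine (Real.rpow_le_rpow_of_nonpos hDpos hz' (by linarith [alph_pos g])).trans
      ((hDe (alph g) (alph_pos g).le).trans ?_)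
    refine Real.rpow_le_rpow_of_exponent_le hn1' ?_
    nlinarith [half_lt_alph g]
  · rw [pow_one] at e5
    unfold headErr smallErr
    nlinarith

section

variable {g M : ℕ} {lam : ℝ} {s : ℕ → Fin 3 → ZMod M} {n : ℕ}

open Filter in
lemma eventually_bad_cost_le (hg : 2 ≤ g) (hl : 0 ≤ lam) {C : ℝ} (hC : 0 ≤ C) :
    ∀ᶠ n : ℕ in atTop, ∀ x : ℝ, 0 ≤ x → x ≤ C * Real.log n →
      4 * (x + 3) ^ 2 * smallErr g n * (1 + 96 * lam ^ (2 * g + 2) * Real.log n) +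
        (x + 3) ^ 2 * ((x + closeScale g n + 3) ^ 3 * (n + 1)) * (16 * (n : ℝ) ^ (-(1 + eta g))) ≤
      (n : ℝ) ^ (-(eta g ^ 2 / 64)) := by
  have heta := eta_pos g
  have heta5 := eta_le hg
  have hsq : eta g ^ 2 / 64 < eta g ^ 2 / 32 := by
    have : 0 < eta g ^ 2 := by positivity
    linarith
  have e1 := eventually_rpow_mul_log_pow_le (2 * (4 * (C + 3) ^ 2 * (1 + 96 * lam ^ (2 * g + 2)))) 3
    hsq
  have e2 := eventually_rpow_mul_log_pow_le (2 * ((C + 3) ^ 2 * (C + 5) ^ 3 * 2 * 16)) 5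
    (e := 5 * eta g / 8) (e' := eta g ^ 2 / 64) (by nlinarith)
  have hlogt : Tendsto (fun n : ℕ => Real.log n) atTop atTop :=
    Real.tendsto_log_atTop.comp tendsto_natCast_atTop_atTop
  filter_upwards [hlogt.eventually_ge_atTop 1, eventually_ge_atTop 1, e1, e2]
    with n hlog hn1 e1 e2 x hx0 hx
  have hn0 : (0 : ℝ) < n := by exact_mod_cast hn1
  have hn1' : (1 : ℝ) ≤ n := by exact_mod_cast hn1
  have hD := closeScale_le g hn1
  have hpow : 1 ≤ (n : ℝ) ^ (eta g / 8) := Real.one_le_rpow hn1' (by linarith)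
  set ℓ := Real.log n
  have h1 : x + 3 ≤ (C + 3) * ℓ := by nlinarith
  have h2 : x + closeScale g n + 3 ≤ (C + 5) * (ℓ * (n : ℝ) ^ (eta g / 8)) := by
    have h3 : ℓ ≤ ℓ * (n : ℝ) ^ (eta g / 8) := le_mul_of_one_le_right (by linarith) hpow
    have h4 : (n : ℝ) ^ (eta g / 8) ≤ ℓ * (n : ℝ) ^ (eta g / 8) :=
      le_mul_of_one_le_left (by linarith) hlog
    have h5 : (C + 3) * ℓ ≤ (C + 3) * (ℓ * (n : ℝ) ^ (eta g / 8)) := by gcongr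
    linarith
  have h3 : 1 + 96 * lam ^ (2 * g + 2) * ℓ ≤ (1 + 96 * lam ^ (2 * g + 2)) * ℓ := by
    rw [add_mul]
    linarith
  have h4 : (n : ℝ) + 1 ≤ 2 * n := by linarith
  have hs : 0 ≤ smallErr g n := by
    unfold smallErr
    positivity
  have t1 : 4 * (x + 3) ^ 2 * smallErr g n * (1 + 96 * lam ^ (2 * g + 2) * ℓ) ≤
      4 * (C + 3) ^ 2 * (1 + 96 * lam ^ (2 * g + 2)) * (smallErr g n * ℓ ^ 3) := by
    calc _ ≤ 4 * ((C + 3) * ℓ) ^ 2 * smallErr g n * ((1 + 96 * lam ^ (2 * g + 2)) * ℓ) := by gcongr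
      _ = _ := by ring
  have hr : ((n : ℝ) ^ (eta g / 8)) ^ 3 * n * (n : ℝ) ^ (-(1 + eta g)) =
      (n : ℝ) ^ (-(5 * eta g / 8)) := by
    rw [mul_assoc, n_mul_rpow hn1, ← Real.rpow_natCast, ← Real.rpow_mul hn0.le,
      ← Real.rpow_add hn0]
    congr 1
    push_cast
    ring
  have t2 : (x + 3) ^ 2 * ((x + closeScale g n + 3) ^ 3 * (n + 1)) *
      (16 * (n : ℝ) ^ (-(1 + eta g))) ≤
      (C + 3) ^ 2 * (C + 5) ^ 3 * 2 * 16 * ((n : ℝ) ^ (-(5 * eta g / 8)) * ℓ ^ 5) := by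
    calc _ ≤ ((C + 3) * ℓ) ^ 2 * (((C + 5) * (ℓ * (n : ℝ) ^ (eta g / 8))) ^ 3 * (2 * n)) *
          (16 * (n : ℝ) ^ (-(1 + eta g))) := by gcongr
      _ = (C + 3) ^ 2 * (C + 5) ^ 3 * 2 * 16 *
          (((n : ℝ) ^ (eta g / 8)) ^ 3 * n * (n : ℝ) ^ (-(1 + eta g)) * ℓ ^ 5) := by ring
      _ = _ := by rw [hr]
  have e1' : 2 * (4 * (C + 3) ^ 2 * (1 + 96 * lam ^ (2 * g + 2)) * (smallErr g n * ℓ ^ 3)) ≤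
      (n : ℝ) ^ (-(eta g ^ 2 / 64)) := by
    unfold smallErr
    linarith
  linarith

open Classical in
lemma sum_isBad_heads_le (hg : 2 ≤ g) (hl : 1 ≤ lam) {CM : Set (ZMod M)} (hs : GoodS M CM s)
    (hn : 1 ≤ n) (hb : DensBounds g lam n)
    (hfl : ∀ τ, ∀ h ∈ heads g M lam s n τ, entryFloor g n ≤ h.1) (τ : Fin 3)
    (𝓕 : Finset (Finset ℕ)) (W : Finset ℕ) :
    ∑ σ ∈ 𝓕 with IsBad (closeScale g n) (heads g M lam s n τ) W σ, weight (dens g lam) (σ \ W) ≤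
      4 * ((W.card : ℝ) + 3) ^ 2 * smallErr g n * (1 + 96 * lam ^ (2 * g + 2) * Real.log n) +
        ((W.card : ℝ) + 3) ^ 2 * (((W.card : ℝ) + closeScale g n + 3) ^ 3 * (n + 1)) *
          (16 * (n : ℝ) ^ (-(1 + eta g))) := by
  have hsm : 0 ≤ smallErr g n := by
    unfold smallErr
    positivity
  have h2D := hb.two_mul_closeScale_le
  refine sum_isBad_le (dens_nonneg (by linarith)) (dens_le_one hl) hsm (by positivity)
    (fun h hh => sum_of_mem_heads hh) (fun h hh => ne_of_mem_heads hs hh)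
    (fun h hh => by have := hfl τ h hh; omega) (fun h hh => hb.close _ (hfl τ h hh))
    (fun h hh a _ => hb.pair _ ((hfl τ h hh).trans (Nat.le_add_right _ _)))
    (fun h hh d _ _ => hb.diff d _ fun a ha => (Finset.mem_filter.1 ha).2) hb.big
    (fun w => (sum_heads_snd_le hg hl hn τ w).trans hb.headErr_le)
    (fun w => (sum_heads_trd_le hg hl hn τ w).trans hb.headErr_le) (sum_heads_le hg hl hn τ)
    (fun h hh => heads_weight_le hg hl hn hh) 𝓕 W

lemma entryFloor_le_of_rtrip (hb : DensBounds g lam n) {x y z : ℕ}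
    (h : Rtrip g M lam s n x y z) :
    entryFloor g n ≤ x ∧ entryFloor g n ≤ y ∧ entryFloor g n ≤ z := by
  obtain ⟨-, -, -, -, h1, -, h2, -, h3, -⟩ := h
  have h4 := hb.entryFloor_le_glam
  have h5 := hb.entryFloor_le_quarter
  exact ⟨by exact_mod_cast h4.trans h1, by exact_mod_cast h5.trans h2,
    by exact_mod_cast h5.trans h3⟩

lemma entryFloor_le_of_mem_heads (hb : DensBounds g lam n) {τ : Fin 3} {h : ℕ × ℕ × ℕ}
    (hh : h ∈ heads g M lam s n τ) : entryFloor g n ≤ h.1 := by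
  rcases mem_heads_iff.1 hh with ⟨-, hR⟩ | ⟨-, hR⟩ | ⟨-, hR⟩
  · exact (entryFloor_le_of_rtrip hb hR).1
  · exact (entryFloor_le_of_rtrip hb hR).2.1
  · exact (entryFloor_le_of_rtrip hb hR).2.2

/-- The constant bounding the expected number of blocks, relative to `lam * log n`. -/
def blockConst (g : ℕ) : ℝ := 1728 * 8 ^ g

lemma sum_blocks_heads_le (hg : 2 ≤ g) (hl : 9 * 8 ^ g ≤ lam) {CM : Set (ZMod M)}
    (hs : GoodS M CM s) (hn : 1 ≤ n) (hb : DensBounds g lam n) (τ : Fin 3) {θ : ℝ} (hθ : 0 ≤ θ)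
    (hθ3 : θ ≤ 3) :
    ∑ i ∈ blocks g (heads g M lam s n τ), θ ^ i.2.card * weight (dens g lam) (block i.1 i.2) ≤
      blockConst g * lam * Real.log n := by
  have h8 : (1 : ℝ) ≤ 8 ^ g := one_le_pow₀ (by norm_num)
  have hl1 : 1 ≤ lam := by linarith
  have hl0 : 0 < lam := by linarith
  have hlog : 0 ≤ Real.log n := Real.log_nonneg (by exact_mod_cast hn)
  set μV := 3 * 8 ^ g * (lam⁻¹) ^ (2 * g + 1)
  have hμ0 : 0 ≤ μV := by positivity
  refine (sum_blocks_le (dens_nonneg hl0.le) hθ (fun h hh => ne_of_mem_heads hs hh)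
    (sum_heads_le hg hl1 hn τ) hμ0
    (fun h hh => hb.tails _ (entryFloor_le_of_mem_heads hb hh))).trans ?_
  have h1 : θ * μV ≤ 9 * 8 ^ g * (lam⁻¹) ^ (2 * g + 1) := by
    calc θ * μV ≤ 3 * μV := by gcongr
      _ = _ := by
          simp only [μV]
          ring
  have h2 : 9 * 8 ^ g * (lam⁻¹) ^ (2 * g + 1) ≤ 1 := by
    have h3 : (lam⁻¹) ^ (2 * g + 1) ≤ lam⁻¹ :=
      pow_le_of_le_one (by positivity) (inv_le_one_of_one_le₀ hl1) (by omega)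
    calc _ ≤ lam * lam⁻¹ := by gcongr
      _ = 1 := mul_inv_cancel₀ hl0.ne'
  have h0 : 0 ≤ θ * μV := by positivity
  have h3 := Real.abs_exp_sub_one_le (x := θ * μV) (by rw [abs_of_nonneg h0]; linarith)
  rw [abs_of_nonneg h0] at h3
  have h4 : Real.exp (θ * μV) - 1 ≤ 2 * (9 * 8 ^ g * (lam⁻¹) ^ (2 * g + 1)) := by
    linarith [le_abs_self (Real.exp (θ * μV) - 1)]
  calc _ ≤ 96 * lam ^ (2 * g + 2) * Real.log n * (2 * (9 * 8 ^ g * (lam⁻¹) ^ (2 * g + 1))) := by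
        gcongr
    _ = _ := by
        rw [blockConst, show 2 * g + 2 = 2 * g + 1 + 1 by ring, pow_succ lam, inv_pow]
        field_simp
        ring

end

/-- The size of a crowd which is unlikely in families of small total weight. -/
def crowdConst (g : ℕ) : ℕ := 128 * (2 * g + 1) ^ 2

/-- The size of a crowd which is unlikely in families of bounded total weight. -/
def crowdLog (n : ℕ) : ℕ := ⌈4 * Real.log n⌉₊

/-- The number of tails which is unlikely to be attained by disjoint blocks. -/
def blockBound (g : ℕ) (lam : ℝ) (n : ℕ) : ℕ := ⌈(blockConst g * lam + 4) * Real.log n⌉₊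

/-- The length of an unlikely chain of bad sets. -/
def chainBound (g : ℕ) (lam : ℝ) : ℕ := ⌈(blockConst g * lam + 4) * (64 * (2 * g + 1) ^ 2)⌉₊

/-- The size of the unions of blocks and bad sets under consideration. -/
def spread (g : ℕ) (lam : ℝ) (n : ℕ) : ℕ := (2 * g + 4) * blockBound g lam n + 6 * chainBound g lam

/-- Disjoint blocks in `A` over heads in `H` with `k` tails in total. -/
def HeavyBlocks (g k : ℕ) (H : Finset (ℕ × ℕ × ℕ)) (A : Set ℕ) : Prop :=
  ∃ J ⊆ blocks g H,
    (J : Set (Σ _ : ℕ × ℕ × ℕ, Finset (Finset ℕ))).PairwiseDisjoint (fun i => block i.1 i.2) ∧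
    (∀ j ∈ J, (block j.1 j.2 : Set ℕ) ⊆ A) ∧ (k : ℝ) ≤ ∑ j ∈ J, (j.2.card : ℝ)

open Classical in
/-- Disjoint blocks in `A` over heads in `H`, extended by a chain of `B` bad sets in `A`. -/
def LongChain (g D B w : ℕ) (H : Finset (ℕ × ℕ × ℕ)) (A : Set ℕ) : Prop :=
  ∃ J ⊆ blocks g H,
    (J : Set (Σ _ : ℕ × ℕ × ℕ, Finset (Finset ℕ))).PairwiseDisjoint (fun i => block i.1 i.2) ∧
    (∀ j ∈ J, (block j.1 j.2 : Set ℕ) ⊆ A) ∧ (J.biUnion fun i => block i.1 i.2).card + 6 * B ≤ w ∧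
    ∃ l : List (Finset ℕ), l.length = B ∧ BadChain (IsBad D H) (J.biUnion fun i => block i.1 i.2) l ∧
      ∀ σ ∈ l, (σ : Set ℕ) ⊆ A

/-- Some family of sets relevant for `n` is too crowded in `A`. -/
def Crowded (g n : ℕ) (A : Set ℕ) : Prop :=
  (∃ m ∈ (Finset.range (2 * n + 1)).filter (entryFloor g n ≤ ·),
    Crowd A (Finset.range (m / 2 + 1)) (fun z => {z, m - z}) (crowdConst g)) ∨
  (∃ i ∈ (Finset.range (n + 1)).filter (0 < ·) ×ˢ Finset.range 2,
    Crowd A (diffStarts n (closeScale g n) i.1 i.2) (fun a => {a, a + i.1}) (crowdConst g)) ∨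
  (∃ r ∈ (Finset.range (n + 1)).filter (entryFloor g n ≤ ·),
    Crowd A ((Finset.range r).filter fun z => r < z + closeScale g n) (fun z => {z})
      (crowdConst g)) ∨
  (∃ i ∈ (Finset.range (n + 1)).filter (0 < ·) ×ˢ Finset.range 2,
    Crowd A (diffStarts n 1 i.1 i.2) (fun a => {a, a + i.1}) (crowdLog n)) ∨
  ∃ r ∈ (Finset.range (n + 1)).filter (entryFloor g n ≤ ·), Crowd A (tails g r) id (crowdLog n)

/-- The exceptional event outside of which the tuples of `T_n` in `A` are few. -/
def Rough (g M : ℕ) (lam : ℝ) (s : ℕ → Fin 3 → ZMod M) (n : ℕ) (A : Set ℕ) : Prop :=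
  0 ∈ A ∨ Crowded g n A ∨
  (∃ τ ∈ Finset.univ, HeavyBlocks g (blockBound g lam n) (heads g M lam s n τ) A) ∨
  ∃ τ ∈ Finset.univ, LongChain g (closeScale g n) (chainBound g lam) (spread g lam n)
    (heads g M lam s n τ) A

section

variable {g M : ℕ} {lam : ℝ} {s : ℕ → Fin 3 → ZMod M} {n : ℕ} {CM : Set (ZMod M)}

lemma ncard_tuples_le_of_not_rough (hg : 0 < g) (hs : GoodS M CM s) (hb : DensBounds g lam n)
    {A : Set ℕ} (h : ¬ Rough g M lam s n A) :
    Set.ncard {x ∈ Tn g M lam s n | ((imgF x : Finset ℕ) : Set ℕ) ⊆ A} ≤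
      (2 * crowdConst g) ^ (g + 1) * (3 *
        ((2 * g + 1) * (1 + 2 * crowdConst g) * blockBound g lam n + chainBound g lam *
          ((2 * g + 1) * crowdLog n * (1 + 2 * crowdConst g) +
            crowdConst g * (1 + 2 * crowdLog n)))) := by
  classical
  simp only [Rough, Crowded, not_or, not_exists, not_and] at h
  obtain ⟨h0, ⟨hpair, hdiff, hclose, hdiff', htail⟩, hI, hII⟩ := h
  have hdiff2 : ∀ {D K}, (∀ i ∈ (Finset.range (n + 1)).filter (0 < ·) ×ˢ Finset.range 2,
      ¬ Crowd A (diffStarts n D i.1 i.2) (fun a => {a, a + i.1}) K) →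
      ∀ r ≤ n, ∀ d, 0 < d → d < r →
      ((Finset.range r).filter fun a => a ∈ A ∧ a + d ∈ A ∧ D ≤ a + d).card ≤ 2 * K := by
    intro D K hD r hr d hd hdr
    refine card_diff_le hd hr fun j hj => hD (d, j) ?_
    simp only [Finset.mem_product, Finset.mem_filter, Finset.mem_range]
    omega
  have hmem : ∀ τ, ∀ h ∈ heads g M lam s n τ, h.1 ≤ n ∧
      h.1 ∈ (Finset.range (n + 1)).filter (entryFloor g n ≤ ·) := by
    intro τ h hh
    have h1 := sum_of_mem_heads hh
    have h2 := entryFloor_le_of_mem_heads hb hh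
    simp only [Finset.mem_filter, Finset.mem_range]
    omega
  refine (ncard_tuples_le hg hs (fun x y z h => entryFloor_le_of_rtrip hb h)
    fun m hm hmn => card_rep_le (hpair m (by simp; omega))).trans ?_
  gcongr
  refine (Finset.sum_le_card_nsmul Finset.univ _ _ fun τ _ => ?_).trans_eq (smul_eq_mul _ _)
  refine sum_tailMins_le (D := closeScale g n) (w := spread g lam n) hg
    (fun h hh h' hh' => root_ne_partner hs hh hh') h0
    (fun h hh S hS hd hA => ?_) (fun h hh => hdiff2 hdiff _ (hmem τ h hh).1)
    (fun h hh d hd hdr => ?_) (fun h hh => card_close_le (hclose _ (hmem τ h hh).2))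
    (fun hc => hI τ (Finset.mem_univ τ) hc) (fun hc => hII τ (Finset.mem_univ τ) ?_) le_rfl
  · by_contra! hcon
    exact htail _ (hmem τ h hh).2 ⟨S, hS, hd, hA, hcon.le⟩
  · refine le_trans (Finset.card_le_card fun a ha => ?_)
      (hdiff2 hdiff' _ (hmem τ h hh).1 d hd hdr)
    obtain ⟨h1, h2, h3⟩ := Finset.mem_filter.1 ha
    exact Finset.mem_filter.2 ⟨h1, h2, h3, by omega⟩
  · unfold LongChain
    convert hc

variable (g) in
/-- The constant in the bound `countConst g * lam * log n` for the number of tuples. -/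
def countConst : ℝ :=
  (2 * crowdConst g) ^ (g + 1) * (3 *
    ((2 * g + 1) * (1 + 2 * crowdConst g) * (blockConst g + 5) +
      ((blockConst g + 4) * (64 * (2 * g + 1) ^ 2) + 1) *
        ((2 * g + 1) * 5 * (1 + 2 * crowdConst g) + crowdConst g * 11)))

lemma blockConst_nonneg : 0 ≤ blockConst g := by
  unfold blockConst
  positivity

lemma crowdLog_le (h : 2 ≤ Real.log n) : (crowdLog n : ℝ) ≤ 5 * Real.log n := by
  have := (Nat.ceil_lt_add_one (show 0 ≤ 4 * Real.log n by linarith)).le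
  unfold crowdLog
  linarith

lemma blockBound_le (hl : 1 ≤ lam) (h : 2 ≤ Real.log n) :
    (blockBound g lam n : ℝ) ≤ (blockConst g + 5) * lam * Real.log n := by
  have hC := blockConst_nonneg (g := g)
  have hlog : 0 ≤ Real.log n := by linarith
  have := (Nat.ceil_lt_add_one
    (show 0 ≤ (blockConst g * lam + 4) * Real.log n by positivity)).le
  unfold blockBound
  nlinarith

lemma chainBound_le (hl : 1 ≤ lam) :
    (chainBound g lam : ℝ) ≤ ((blockConst g + 4) * (64 * (2 * g + 1) ^ 2) + 1) * lam := by
  have hC := blockConst_nonneg (g := g)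
  have := (Nat.ceil_lt_add_one
    (show 0 ≤ (blockConst g * lam + 4) * (64 * (2 * (g : ℝ) + 1) ^ 2) by positivity)).le
  unfold chainBound
  nlinarith [mul_nonneg (sub_nonneg.2 hl) (sq_nonneg (2 * (g : ℝ) + 1))]

lemma ncard_tuples_le_countConst (hg : 0 < g) (hl : 1 ≤ lam) (hs : GoodS M CM s)
    (hb : DensBounds g lam n) {A : Set ℕ} (h : ¬ Rough g M lam s n A) :
    (Set.ncard {x ∈ Tn g M lam s n | ((imgF x : Finset ℕ) : Set ℕ) ⊆ A} : ℝ) ≤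
      countConst g * lam * Real.log n := by
  have h2 := hb.two_le_log
  have hC := blockConst_nonneg (g := g)
  have hL := crowdLog_le h2
  have hL' : (1 : ℝ) + 2 * crowdLog n ≤ 11 * Real.log n := by linarith
  have h1 : (Set.ncard {x ∈ Tn g M lam s n | ((imgF x : Finset ℕ) : Set ℕ) ⊆ A} : ℝ) ≤ _ :=
    Nat.cast_le.2 (ncard_tuples_le_of_not_rough hg hs hb h)
  refine h1.trans ?_
  push_cast
  calc _ ≤ (2 * (crowdConst g : ℝ)) ^ (g + 1) * (3 *
        ((2 * g + 1) * (1 + 2 * crowdConst g) * ((blockConst g + 5) * lam * Real.log n) +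
          (((blockConst g + 4) * (64 * (2 * g + 1) ^ 2) + 1) * lam) *
          ((2 * g + 1) * (5 * Real.log n) * (1 + 2 * crowdConst g) +
            crowdConst g * (11 * Real.log n)))) := by
        gcongr
        · exact blockBound_le hl h2
        · exact chainBound_le hl
    _ = _ := by
        unfold countConst
        ring

open Filter in
lemma eventually_spread_le (hl : 1 ≤ lam) : ∃ C : ℝ, 0 ≤ C ∧ ∀ᶠ n : ℕ in atTop,
    (spread g lam n : ℝ) ≤ C * Real.log n := by
  have hC := blockConst_nonneg (g := g)
  refine ⟨(2 * g + 4) * ((blockConst g + 5) * lam) + 6 * chainBound g lam, by positivity, ?_⟩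
  have hlogt : Tendsto (fun n : ℕ => Real.log n) atTop atTop :=
    Real.tendsto_log_atTop.comp tendsto_natCast_atTop_atTop
  filter_upwards [hlogt.eventually_ge_atTop 2] with n hn
  have h1 := blockBound_le (g := g) hl hn
  have h2 : (chainBound g lam : ℝ) ≤ chainBound g lam * Real.log n :=
    le_mul_of_one_le_right (by positivity) (by linarith)
  unfold spread
  push_cast
  calc _ ≤ (2 * g + 4) * ((blockConst g + 5) * lam * Real.log n) +
        6 * (chainBound g lam * Real.log n) := by gcongr
    _ = _ := by ring

end

lemma prob_or_le {Ω : Type*} [MeasurableSpace Ω] {P : Measure Ω} {E F : Ω → Prop} {a b : ℝ}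
    (hE : P.real {ω | E ω} ≤ a) (hF : P.real {ω | F ω} ≤ b) :
    P.real {ω | E ω ∨ F ω} ≤ a + b :=
  (measureReal_union_le _ _).trans (add_le_add hE hF)

section

variable {g M : ℕ} {lam : ℝ} {s : ℕ → Fin 3 → ZMod M} {n : ℕ} {CM : Set (ZMod M)}
  {Ω : Type*} [MeasurableSpace Ω] {P : Measure Ω} {A : Ω → Set ℕ}

lemma prob_subset_le [IsProbabilityMeasure P] (hl : 0 ≤ lam)
    (hi : iIndepSet (fun x => {ω | x ∈ A ω}) P)
    (h1 : ∀ x, P {ω | x ∈ A ω} ≤ ENNReal.ofReal (dens g lam x)) (F : Finset ℕ) :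
    P.real {ω | (F : Set ℕ) ⊆ A ω} ≤ weight (dens g lam) F := by
  have e : {ω | (F : Set ℕ) ⊆ A ω} = ⋂ x ∈ F, {ω | x ∈ A ω} := by
    ext ω
    simp [Set.subset_def]
  rw [e, measureReal_def, hi.meas_biInter, ENNReal.toReal_prod]
  exact Finset.prod_le_prod (fun _ _ => ENNReal.toReal_nonneg) fun x _ =>
    ENNReal.toReal_le_of_le_ofReal (dens_nonneg hl x) (h1 x)

variable [IsProbabilityMeasure P]

lemma prob_crowd_crowdConst_le
    (hP : ∀ F : Finset ℕ, P.real {ω | (F : Set ℕ) ⊆ A ω} ≤ weight (dens g lam) F)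
    (hl : 0 ≤ lam) (hn : 1 ≤ n) {ι : Type*} (I : Finset ι)
    (e : ι → Finset ℕ) (h : ∑ i ∈ I, weight (dens g lam) (e i) ≤ smallErr g n) :
    P.real {ω | Crowd (A ω) I e (crowdConst g)} ≤ Real.exp 1 * (n : ℝ) ^ (-4 : ℝ) := by
  have hn0 : (0 : ℝ) < n := by exact_mod_cast hn
  have hlog : 0 ≤ Real.log n := Real.log_nonneg (by exact_mod_cast hn)
  refine (prob_crowd (dens_nonneg hl) hP I e (s := eta g ^ 2 / 32 * Real.log n) (by positivity)
    h).trans (le_of_eq ?_)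
  have h1 : eta g ^ 2 / 32 * crowdConst g = 4 := by
    unfold eta crowdConst
    push_cast
    field_simp
    norm_num
  rw [smallErr, Real.rpow_def_of_pos hn0, Real.rpow_def_of_pos hn0, ← Real.exp_add,
    ← Real.exp_add]
  congr 1
  have h2 : eta g ^ 2 / 32 * Real.log n + Real.log n * -(eta g ^ 2 / 32) = 0 := by ring
  rw [h2, Real.exp_zero]
  linear_combination (-Real.log n) * h1

lemma prob_crowd_crowdLog_le
    (hP : ∀ F : Finset ℕ, P.real {ω | (F : Set ℕ) ⊆ A ω} ≤ weight (dens g lam) F)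
    (hl : 0 ≤ lam) (hn : 1 ≤ n) {ι : Type*} (I : Finset ι)
    (e : ι → Finset ℕ) {C : ℝ} (h : ∑ i ∈ I, weight (dens g lam) (e i) ≤ C) :
    P.real {ω | Crowd (A ω) I e (crowdLog n)} ≤ Real.exp (Real.exp 1 * C) * (n : ℝ) ^ (-4 : ℝ) := by
  have hn0 : (0 : ℝ) < n := by exact_mod_cast hn
  refine (prob_crowd (dens_nonneg hl) hP I e zero_le_one h).trans ?_
  rw [Real.rpow_def_of_pos hn0, ← Real.exp_add]
  have := Nat.le_ceil (4 * Real.log n)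
  refine Real.exp_le_exp.2 ?_
  unfold crowdLog
  linarith

lemma prob_heavyBlocks_le
    (hP : ∀ F : Finset ℕ, P.real {ω | (F : Set ℕ) ⊆ A ω} ≤ weight (dens g lam) F)
    (hg : 2 ≤ g) (hl : 9 * 8 ^ g ≤ lam) (hs : GoodS M CM s) (hn : 1 ≤ n)
    (hb : DensBounds g lam n) (τ : Fin 3) :
    P.real {ω | HeavyBlocks g (blockBound g lam n) (heads g M lam s n τ) (A ω)} ≤
      (n : ℝ) ^ (-4 : ℝ) := by
  have hn0 : (0 : ℝ) < n := by exact_mod_cast hn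
  have h8 : (1 : ℝ) ≤ 8 ^ g := one_le_pow₀ (by norm_num)
  refine (prob_disjoint_family (dens_nonneg (by linarith)) hP _ _
    (fun i : Σ _ : ℕ × ℕ × ℕ, Finset (Finset ℕ) => (i.2.card : ℝ)) 1 _ zero_le_one).trans ?_
  rw [Real.rpow_def_of_pos hn0]
  refine Real.exp_le_exp.2 ?_
  have h1 := sum_blocks_heads_le hg hl hs hn hb τ (Real.exp_pos 1).le
    (Real.exp_one_lt_d9.le.trans (by norm_num))
  have h2 := Nat.le_ceil ((blockConst g * lam + 4) * Real.log n)
  simp only [Real.exp_one_pow] at h1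
  simp only [one_mul]
  unfold blockBound
  linarith

lemma prob_longChain_le
    (hP : ∀ F : Finset ℕ, P.real {ω | (F : Set ℕ) ⊆ A ω} ≤ weight (dens g lam) F)
    (hg : 2 ≤ g) (hl : 9 * 8 ^ g ≤ lam) (hs : GoodS M CM s) (hn : 1 ≤ n)
    (hb : DensBounds g lam n)
    (hcost : ∀ x : ℝ, 0 ≤ x → x ≤ spread g lam n →
      4 * (x + 3) ^ 2 * smallErr g n * (1 + 96 * lam ^ (2 * g + 2) * Real.log n) +
        (x + 3) ^ 2 * ((x + closeScale g n + 3) ^ 3 * (n + 1)) * (16 * (n : ℝ) ^ (-(1 + eta g))) ≤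
      (n : ℝ) ^ (-(eta g ^ 2 / 64))) (τ : Fin 3) :
    P.real {ω | LongChain g (closeScale g n) (chainBound g lam) (spread g lam n)
      (heads g M lam s n τ) (A ω)} ≤ (n : ℝ) ^ (-4 : ℝ) := by
  have hn0 : (0 : ℝ) < n := by exact_mod_cast hn
  have hlog : 0 ≤ Real.log n := Real.log_nonneg (by exact_mod_cast hn)
  have h8 : (1 : ℝ) ≤ 8 ^ g := one_le_pow₀ (by norm_num)
  refine (prob_disjoint_family_badChain (dens_nonneg (by linarith)) hP _ _
    (β := (n : ℝ) ^ (-(eta g ^ 2 / 64))) (𝓕 := (Finset.range (n + 1)).powerset) (by positivity)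
    (fun W σ h => Finset.mem_powerset.2 (h.subset_range fun h hh => sum_of_mem_heads hh))
    (fun W σ h => h.card_le) (fun W hW => ?_) _).trans ?_
  · exact (sum_isBad_heads_le hg (by linarith) hs hn hb
      (fun τ h hh => entryFloor_le_of_mem_heads hb hh) τ _ W).trans
      (hcost _ (Nat.cast_nonneg _) (by exact_mod_cast hW))
  · have h1 := sum_blocks_heads_le hg hl hs hn hb τ zero_le_one (by norm_num)
    simp only [one_pow, one_mul] at h1
    rw [Real.rpow_def_of_pos hn0, Real.rpow_def_of_pos hn0, ← Real.exp_nat_mul, ← Real.exp_add]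
    refine Real.exp_le_exp.2 ?_
    have h2 := Nat.le_ceil ((blockConst g * lam + 4) * (64 * (2 * (g : ℝ) + 1) ^ 2))
    have h3 : (blockConst g * lam + 4) * (64 * (2 * (g : ℝ) + 1) ^ 2) * (eta g ^ 2 / 64) =
        blockConst g * lam + 4 := by
      unfold eta
      field_simp
    have h4 := mul_le_mul_of_nonneg_right h2 (show 0 ≤ eta g ^ 2 / 64 by positivity)
    rw [h3] at h4
    have h5 := mul_le_mul_of_nonneg_right h4 hlog
    unfold chainBound
    linarith

lemma prob_crowded_le
    (hP : ∀ F : Finset ℕ, P.real {ω | (F : Set ℕ) ⊆ A ω} ≤ weight (dens g lam) F)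
    (hl : 1 ≤ lam) (hl' : 3 * 8 ^ g ≤ lam) (hn : 1 ≤ n)
    (hb : DensBounds g lam n) {C : ℝ} (hC : 1 ≤ C)
    (hdiff : ∀ (d : ℕ) (s : Finset ℕ), (∀ a ∈ s, 1 ≤ a + d) →
      ∑ a ∈ s, dens g lam a * dens g lam (a + d) ≤ C) :
    P.real {ω | Crowded g n (A ω)} ≤ 15 * n * (Real.exp (Real.exp 1 * C) * (n : ℝ) ^ (-4 : ℝ)) := by
  have hl0 : 0 ≤ lam := by linarith
  have hn1 : (1 : ℝ) ≤ n := by exact_mod_cast hn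
  set b := Real.exp (Real.exp 1 * C) * (n : ℝ) ^ (-4 : ℝ)
  have hb0 : 0 ≤ b := by positivity
  have hconst : Real.exp 1 * (n : ℝ) ^ (-4 : ℝ) ≤ b := by
    refine mul_le_mul_of_nonneg_right (Real.exp_le_exp.2 ?_) (by positivity)
    nlinarith [Real.add_one_le_exp 1]
  have hcard : ∀ (p : ℕ → Prop) [DecidablePred p], (((Finset.range (n + 1)).filter p).card : ℝ) ≤ 2 * n := by
    intro p _
    have := Finset.card_filter_le (Finset.range (n + 1)) p
    rw [Finset.card_range] at this
    have : (((Finset.range (n + 1)).filter p).card : ℝ) ≤ n + 1 := by exact_mod_cast this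
    linarith
  have hpairw : ∀ d, 0 < d → ∀ a, weight (dens g lam) {a, a + d} = dens g lam a * dens g lam (a + d) :=
    fun d hd a => Finset.prod_pair (by omega)
  have e1 := prob_exists_le (P := P) (b := b) (E := fun m ω =>
    Crowd (A ω) (Finset.range (m / 2 + 1)) (fun z => {z, m - z}) (crowdConst g))
    ((Finset.range (2 * n + 1)).filter (entryFloor g n ≤ ·)) fun m hm =>
      (prob_crowd_crowdConst_le hP hl0 hn _ _ (hb.pair m (Finset.mem_filter.1 hm).2)).trans hconst
  have e2 := prob_exists_le (P := P) (b := b) (E := fun (i : ℕ × ℕ) ω =>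
    Crowd (A ω) (diffStarts n (closeScale g n) i.1 i.2) (fun a => {a, a + i.1}) (crowdConst g))
    ((Finset.range (n + 1)).filter (0 < ·) ×ˢ Finset.range 2) fun i hi => by
      have hd := (Finset.mem_filter.1 (Finset.mem_product.1 hi).1).2
      refine (prob_crowd_crowdConst_le hP hl0 hn _ _ ?_).trans hconst
      simp only [hpairw _ hd]
      exact hb.diff _ _ fun a ha => (Finset.mem_filter.1 ha).2.1
  have e3 := prob_exists_le (P := P) (b := b) (E := fun r ω =>
    Crowd (A ω) ((Finset.range r).filter fun z => r < z + closeScale g n) (fun z => {z})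
      (crowdConst g)) ((Finset.range (n + 1)).filter (entryFloor g n ≤ ·)) fun r hr => by
      refine (prob_crowd_crowdConst_le hP hl0 hn _ _ ?_).trans hconst
      simpa [weight] using hb.close r (Finset.mem_filter.1 hr).2
  have e4 := prob_exists_le (P := P) (b := b) (E := fun (i : ℕ × ℕ) ω =>
    Crowd (A ω) (diffStarts n 1 i.1 i.2) (fun a => {a, a + i.1}) (crowdLog n))
    ((Finset.range (n + 1)).filter (0 < ·) ×ˢ Finset.range 2) fun i hi => by
      have hd := (Finset.mem_filter.1 (Finset.mem_product.1 hi).1).2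
      refine prob_crowd_crowdLog_le hP hl0 hn _ _ ?_
      simp only [hpairw _ hd]
      exact hdiff _ _ fun a ha => (Finset.mem_filter.1 ha).2.1
  have e5 := prob_exists_le (P := P) (b := b) (E := fun r ω =>
    Crowd (A ω) (tails g r) id (crowdLog n))
    ((Finset.range (n + 1)).filter (entryFloor g n ≤ ·)) fun r hr => by
      refine prob_crowd_crowdLog_le hP hl0 hn _ _ ((hb.tails r (Finset.mem_filter.1 hr).2).trans ?_)
      calc 3 * 8 ^ g * (lam⁻¹) ^ (2 * g + 1) ≤ lam * (lam⁻¹) ^ 1 := by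
            gcongr ?_ * ?_
            exact pow_le_pow_of_le_one (by positivity) (inv_le_one_of_one_le₀ hl) (by omega)
        _ = 1 := by rw [pow_one, mul_inv_cancel₀ (by linarith)]
        _ ≤ C := hC
  have h2n : (((Finset.range (2 * n + 1)).filter (entryFloor g n ≤ ·)).card : ℝ) ≤ 3 * n := by
    have := Finset.card_filter_le (Finset.range (2 * n + 1)) (entryFloor g n ≤ ·)
    rw [Finset.card_range] at this
    have : (((Finset.range (2 * n + 1)).filter (entryFloor g n ≤ ·)).card : ℝ) ≤ 2 * n + 1 := by
      exact_mod_cast this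
    linarith
  have hprod : (((Finset.range (n + 1)).filter (0 < ·) ×ˢ Finset.range 2).card : ℝ) ≤ 4 * n := by
    rw [Finset.card_product, Finset.card_range]
    push_cast
    linarith [hcard (0 < ·)]
  refine (prob_or_le e1 (prob_or_le e2 (prob_or_le e3 (prob_or_le e4 e5)))).trans ?_
  have h1 := mul_le_mul_of_nonneg_right h2n hb0
  have h2 := mul_le_mul_of_nonneg_right hprod hb0
  have h3 := mul_le_mul_of_nonneg_right (hcard (entryFloor g n ≤ ·)) hb0
  linarith

end

section

variable {g M : ℕ} {lam : ℝ} {s : ℕ → Fin 3 → ZMod M} {CM : Set (ZMod M)}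
  {Ω : Type*} [MeasurableSpace Ω] {P : Measure Ω} [IsProbabilityMeasure P] {A : Ω → Set ℕ}

open Filter in
lemma eventually_prob_rough_le (hg : 2 ≤ g) (hl : 9 * 8 ^ g ≤ lam) (hs : GoodS M CM s)
    (hP : ∀ F : Finset ℕ, P.real {ω | (F : Set ℕ) ⊆ A ω} ≤ weight (dens g lam) F) :
    ∃ c : ℝ, 0 ≤ c ∧ ∀ᶠ n : ℕ in atTop,
      P.real {ω | Rough g M lam s n (A ω)} ≤ c * (n : ℝ) ^ (-3 : ℝ) := by
  have h8 : (1 : ℝ) ≤ 8 ^ g := one_le_pow₀ (by norm_num)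
  have hl1 : 1 ≤ lam := by linarith
  obtain ⟨C, -, hdiff⟩ := sum_dens_diff_le g
  obtain ⟨C', hC', hw⟩ := eventually_spread_le (g := g) hl1
  set C1 := max C 1
  refine ⟨15 * Real.exp (Real.exp 1 * C1) + 6, by positivity, ?_⟩
  filter_upwards [eventually_densBounds hg hl1, eventually_ge_atTop 1, hw,
    eventually_bad_cost_le (lam := lam) hg (by linarith) hC'] with n hb hn hw hcost
  have hn1 : (1 : ℝ) ≤ n := by exact_mod_cast hn
  have h0 : P.real {ω | 0 ∈ A ω} ≤ 0 := by
    simpa [weight, dens_zero] using hP {0}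
  have h1 := prob_crowded_le hP hl1 (by linarith) hn hb (le_max_right C 1) fun d s hd =>
    (hdiff lam hl1 1 d s one_pos hd).trans (by simp)
  have h2 := prob_exists_le (P := P) (E := fun τ ω =>
    HeavyBlocks g (blockBound g lam n) (heads g M lam s n τ) (A ω)) Finset.univ
    fun τ _ => prob_heavyBlocks_le hP hg hl hs hn hb τ
  have h3 := prob_exists_le (P := P) (E := fun τ ω =>
    LongChain g (closeScale g n) (chainBound g lam) (spread g lam n)
      (heads g M lam s n τ) (A ω)) Finset.univ
    fun τ _ => prob_longChain_le hP hg hl hs hn hb (fun x hx hx' => hcost x hx (hx'.trans hw)) τ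
  refine (prob_or_le h0 (prob_or_le h1 (prob_or_le h2 h3))).trans ?_
  have h4 : (n : ℝ) ^ (-3 : ℝ) = n * (n : ℝ) ^ (-4 : ℝ) := by
    rw [← Real.rpow_one_add' (by positivity) (by norm_num)]
    norm_num
  have h5 : (n : ℝ) ^ (-4 : ℝ) ≤ n * (n : ℝ) ^ (-4 : ℝ) :=
    le_mul_of_one_le_left (by positivity) hn1
  simp only [Finset.card_univ, Fintype.card_fin, Nat.cast_ofNat, C1] at *
  rw [h4]
  linarith

open Filter in
lemma ae_eventually_not_of_prob_le {E : ℕ → Ω → Prop} {c : ℝ}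
    (h : ∀ᶠ n : ℕ in atTop, P.real {ω | E n ω} ≤ c * (n : ℝ) ^ (-3 : ℝ)) :
    ∀ᵐ ω ∂P, ∀ᶠ n : ℕ in atTop, ¬ E n ω := by
  obtain ⟨n0, hn0⟩ := eventually_atTop.1 h
  have hsum : ∑' n, P {ω | E (n + n0) ω} ≠ ⊤ := by
    have hs : Summable fun n : ℕ => c * ((n + n0 : ℕ) : ℝ) ^ (-3 : ℝ) :=
      (((summable_nat_add_iff n0).2 (Real.summable_nat_rpow.2 (by norm_num))).mul_left c)
    refine ne_top_of_le_ne_top hs.tsum_ofReal_ne_top (ENNReal.tsum_le_tsum fun n => ?_)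
    rw [← ENNReal.ofReal_toReal (measure_ne_top P {ω | E (n + n0) ω})]
    exact ENNReal.ofReal_le_ofReal (hn0 _ (by omega))
  filter_upwards [ae_eventually_notMem hsum] with ω hω
  obtain ⟨n1, hn1⟩ := eventually_atTop.1 hω
  refine eventually_atTop.2 ⟨n1 + n0, fun n hn hE => hn1 (n - n0) (by omega) ?_⟩
  simpa [show n - n0 + n0 = n by omega] using hE

end

end ThinBasis

open ThinBasis Filter in
theorem stmt18 (g M : ℕ) (hg : 2 ≤ g) (hM : 1 ≤ M) (CM : Set (ZMod M))
    (hSidon : IsSidonZ CM) (hcov : Covers3 CM) :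
    ∃ lam₀ : ℝ, 1 < lam₀ ∧
      ∀ s : ℕ → Fin 3 → ZMod M, GoodS M CM s →
      ∀ lam : ℝ, lam₀ ≤ lam →
      ∀ (Ω : Type) [MeasurableSpace Ω] (P : Measure Ω), IsProbabilityMeasure P →
      ∀ A : Ω → Set ℕ,
        (∀ x : ℕ, MeasurableSet {ω | x ∈ A ω}) →
        iIndepSet (fun x : ℕ => {ω | x ∈ A ω}) P →
        (∀ x : ℕ, 0 < x → (x : ZMod M) ∈ CM →
          P {ω | x ∈ A ω} = ENNReal.ofReal (lam⁻¹ * (x : ℝ) ^ (-alph g))) →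
        (∀ x : ℕ, (x : ZMod M) ∉ CM → P {ω | x ∈ A ω} = 0) →
        P {ω | 0 ∈ A ω} = 0 →
        ∀ᵐ ω ∂P, ∃ N : ℕ, ∀ n : ℕ, N ≤ n →
          (Set.ncard {x ∈ Tn g M lam s n | ((imgF x : Finset ℕ) : Set ℕ) ⊆ A ω} : ℝ)
            ≤ lam ^ 2 * Real.log n := by
  have h8 : (1 : ℝ) ≤ 8 ^ g := one_le_pow₀ (by norm_num)
  refine ⟨max (countConst g) (9 * 8 ^ g), lt_max_of_lt_right (by linarith), ?_⟩
  intro s hs lam hlam Ω _ P _ A _ hi hCM hnCM hzero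
  obtain ⟨hlc, hl9⟩ := max_le_iff.1 hlam
  have hl1 : 1 ≤ lam := by linarith
  have hl0 : 0 ≤ lam := by linarith
  have hle : ∀ x, P {ω | x ∈ A ω} ≤ ENNReal.ofReal (dens g lam x) := by
    intro x
    by_cases hx : (x : ZMod M) ∈ CM
    · rcases Nat.eq_zero_or_pos x with rfl | h0
      · simp [hzero]
      · exact (hCM x h0 hx).le
    · simp [hnCM x hx]
  obtain ⟨c, -, hc⟩ := eventually_prob_rough_le hg hl9 hs (prob_subset_le hl0 hi hle)
  filter_upwards [ae_eventually_not_of_prob_le hc] with ω hω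
  obtain ⟨N, hN⟩ := eventually_atTop.1 (hω.and (eventually_densBounds hg hl1))
  refine ⟨N, fun n hn => ?_⟩
  obtain ⟨h1, hb⟩ := hN n hn
  have hlog : 0 ≤ Real.log n := by linarith [hb.two_le_log]
  calc _ ≤ countConst g * lam * Real.log n :=
        ncard_tuples_le_countConst (by omega) hl1 hs hb h1
    _ ≤ lam * lam * Real.log n := by gcongr
    _ = _ := by ring
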